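/- arXiv:2310.05248 — 3 statements merged into one kernel-verified Lean document; each statement's English description precedes it below -/
import Mathlib

section
/- If G is an (X,Y)-bigraph containing no cycles (i.e., G is a forest), then G has a path X-cover consisting of at most def(G) paths. -/
open Finset SimpleGraph
open scoped Classical

variable {V : Type*}

/-- `Λ_G(S)`: the set of vertices of `Y` having at least two neighbors in `S`. -/
noncomputable def lamSet (G : SimpleGraph V) (Y S : Finset V) : Finset V :=
  Y.filter fun y => 1 < (S.filter fun x => G.Adj y x).card

/-- `def(G,S)`: the Λ-deficiency of the set `S`, namely `|S| - |Λ_G(S)|`. -/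
noncomputable def lamDefSet (G : SimpleGraph V) (Y S : Finset V) : ℤ :=
  (S.card : ℤ) - ((lamSet G Y S).card : ℤ)

/-- `def(G)`: the Λ-deficiency of the bigraph, `max_{S ⊆ X} def(G,S)`. -/
noncomputable def lamDef (G : SimpleGraph V) (X Y : Finset V) : ℤ :=
  X.powerset.sup' (Finset.powerset_nonempty X) fun S => lamDefSet G Y S

/-- `α_Λ(G)`: the maximum size of a Λ-independent subset of `X`. -/
noncomputable def alphaLam (G : SimpleGraph V) (X Y : Finset V) : ℕ :=
  (X.powerset.filter fun S => lamSet G Y S = ∅).sup Finset.card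

/-- `G` is an `(X,Y)`-bigraph: `X, Y` partition the vertex set and every edge
joins a vertex of `X` to a vertex of `Y`. -/
def IsBigraph (G : SimpleGraph V) (X Y : Finset V) : Prop :=
  Disjoint X Y ∧ (∀ v, v ∈ X ∨ v ∈ Y) ∧
    ∀ ⦃u v⦄, G.Adj u v → (u ∈ X ∧ v ∈ Y) ∨ (u ∈ Y ∧ v ∈ X)

/-- `P` is a path `X`-cover: a list of pairwise vertex-disjoint paths of `G`
whose vertex sets together contain every vertex of `X`. -/
def IsPathXCover (G : SimpleGraph V) (X : Finset V)
    (P : List (Σ u : V, Σ v : V, G.Walk u v)) : Prop :=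
  (∀ p ∈ P, p.2.2.IsPath) ∧
    P.Pairwise (fun p q => ∀ w : V, w ∈ p.2.2.support → w ∉ q.2.2.support) ∧
    ∀ x ∈ X, ∃ p ∈ P, x ∈ p.2.2.support

/-- `P` is a set of pairwise vertex-disjoint paths of `G` whose union of vertex
sets intersects `X` exactly in `S`. -/
def IsPathExactCover (G : SimpleGraph V) (X S : Finset V)
    (P : List (Σ u : V, Σ v : V, G.Walk u v)) : Prop :=
  (∀ p ∈ P, p.2.2.IsPath) ∧
    P.Pairwise (fun p q => ∀ w : V, w ∈ p.2.2.support → w ∉ q.2.2.support) ∧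
    ∀ x ∈ X, ((∃ p ∈ P, x ∈ p.2.2.support) ↔ x ∈ S)

/-- `C` is a collection of pairwise vertex-disjoint cycles of `G` whose vertex
sets together contain every vertex of `X`. -/
def IsCycleXCover (G : SimpleGraph V) (X : Finset V)
    (C : List (Σ u : V, G.Walk u u)) : Prop :=
  (∀ c ∈ C, c.2.IsCycle) ∧
    C.Pairwise (fun c d => ∀ w : V, w ∈ c.2.support → w ∉ d.2.support) ∧
    ∀ x ∈ X, ∃ c ∈ C, x ∈ c.2.support

/-- A finite nonempty set of vertices of a forest contains a vertex with at most one neighbor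
in the set. -/
theorem SimpleGraph.IsAcyclic.exists_mem_subsingleton_adj {G : SimpleGraph V} (hG : G.IsAcyclic)
    {U : Finset V} (hU : U.Nonempty) :
    ∃ v ∈ U, ∀ a ∈ U, ∀ b ∈ U, G.Adj v a → G.Adj v b → a = b := by
  by_contra! hno
  have key : ∀ n : ℕ, ∃ (u v : V) (p : G.Walk u v),
      p.IsPath ∧ p.length = n ∧ ∀ w ∈ p.support, w ∈ U := by
    intro n
    induction n with
    | zero =>
      obtain ⟨u, hu⟩ := hU
      exact ⟨u, u, .nil, by simp, rfl, by simpa using hu⟩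
    | succ n ih =>
      obtain ⟨u, v, p, hp, hlen, hsupp⟩ := ih
      obtain ⟨a, ha, b, hb, hua, hub, hab⟩ := hno u (hsupp u p.start_mem_support)
      obtain ⟨w, hw, huw, hne⟩ : ∃ w ∈ U, G.Adj u w ∧ w ≠ p.snd := by
        by_cases h : a = p.snd
        · exact ⟨b, hb, hub, fun h' => hab (h.trans h'.symm)⟩
        · exact ⟨a, ha, hua, h⟩
      refine ⟨w, v, .cons huw.symm p, ?_, by simp [hlen], ?_⟩
      · exact hp.cons fun hmem => hne (hG.eq_snd_of_adj_start hp huw hmem)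
      · simpa using ⟨hw, hsupp⟩
  obtain ⟨u, v, p, hp, hlen, hsupp⟩ := key U.card
  have h1 : p.support.toFinset.card = p.support.length :=
    List.toFinset_card_of_nodup hp.support_nodup
  have h2 : p.support.toFinset ⊆ U := fun w hw => hsupp w (by simpa using hw)
  have h3 := Finset.card_le_card h2
  rw [h1, Walk.length_support] at h3
  omega

/-- A vertex of a path having at most one neighbor on the path is one of its ends. -/
theorem SimpleGraph.Walk.IsPath.eq_or_eq_of_subsingleton_adj {G : SimpleGraph V} {u v x : V}
    {p : G.Walk u v} (hp : p.IsPath) (hx : x ∈ p.support)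
    (h : ∀ a ∈ p.support, ∀ b ∈ p.support, G.Adj x a → G.Adj x b → a = b) : x = u ∨ x = v := by
  induction p with
  | nil => left; simpa using hx
  | @cons u w v huw q ih =>
    rw [Walk.cons_isPath_iff] at hp
    rw [Walk.support_cons, List.mem_cons] at hx
    rcases hx with rfl | hx
    · exact Or.inl rfl
    rcases ih hp.1 hx (fun a ha b hb => h a (by simp [ha]) b (by simp [hb])) with rfl | rfl
    · cases q with
      | nil => exact Or.inr rfl
      | cons hxz r =>
        have := h u (by simp) _ (by simp : _ ∈ _) huw.symm hxz
        subst this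
        simp at hp
    · exact Or.inr rfl

theorem mem_lamSet {G : SimpleGraph V} {Y S : Finset V} {y : V} :
    y ∈ lamSet G Y S ↔ y ∈ Y ∧ ∃ a ∈ S, ∃ b ∈ S, G.Adj y a ∧ G.Adj y b ∧ a ≠ b := by
  simp only [lamSet, Finset.mem_filter, Finset.one_lt_card]
  grind

/-- The part of `G` on `A ∪ B` has a path `A`-cover with no more paths than the Λ-deficiency
of some subset of `A`. -/
def HasDeficiencyCover (G : SimpleGraph V) (A B : Finset V) : Prop :=
  ∃ (P : List (Σ u : V, Σ v : V, G.Walk u v)) (S : Finset V),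
    IsPathXCover G A P ∧ (∀ p ∈ P, ∀ w ∈ p.2.2.support, w ∈ A ∪ B) ∧
      S ⊆ A ∧ P.length + (lamSet G B S).card ≤ S.card

theorem HasDeficiencyCover.cons {G : SimpleGraph V} {A A' B B' : Finset V} {u v : V}
    (h : HasDeficiencyCover G A' B') (p : G.Walk u v) (hp : p.IsPath) (hA : A' ⊆ A) (hB : B' ⊆ B)
    (hsupp : ∀ w ∈ p.support, w ∈ A ∪ B) (hdisj : ∀ w ∈ p.support, w ∉ A' ∪ B')
    (hcov : ∀ x ∈ A, x ∉ A' → x ∈ p.support)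
    (hS : ∀ S' ⊆ A', ∃ S ⊆ A, S'.card + (lamSet G B S).card + 1 ≤ S.card + (lamSet G B' S').card) :
    HasDeficiencyCover G A B := by
  obtain ⟨P, S', ⟨hpath, hpw, hcover⟩, hin, hSA, hcard⟩ := h
  obtain ⟨S, hSA, hle⟩ := hS S' hSA
  refine ⟨⟨u, v, p⟩ :: P, S, ⟨?_, ?_, ?_⟩, ?_, hSA, ?_⟩
  · intro q hq
    rcases List.mem_cons.1 hq with rfl | hq
    · exact hp
    · exact hpath q hq
  · exact List.pairwise_cons.2 ⟨fun q hq w hw hwq => hdisj w hw (hin q hq w hwq), hpw⟩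
  · intro x hx
    by_cases hx' : x ∈ A'
    · obtain ⟨q, hq, hxq⟩ := hcover x hx'
      exact ⟨q, List.mem_cons_of_mem _ hq, hxq⟩
    · exact ⟨_, List.mem_cons_self, hcov x hx hx'⟩
  · intro q hq w hw
    rcases List.mem_cons.1 hq with rfl | hq
    · exact hsupp w hw
    · exact Finset.union_subset_union hA hB (hin q hq w hw)
  · simp only [List.length_cons]
    omega

/-- Removing a vertex of `B` with at most one neighbor in `A`. -/
theorem HasDeficiencyCover.of_erase {G : SimpleGraph V} {A B : Finset V} {y : V}
    (h : HasDeficiencyCover G A (B.erase y))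
    (hy : ∀ a ∈ A, ∀ b ∈ A, G.Adj y a → G.Adj y b → a = b) : HasDeficiencyCover G A B := by
  obtain ⟨P, S, hP, hin, hSA, hcard⟩ := h
  refine ⟨P, S, hP, fun p hp w hw => ?_, hSA, ?_⟩
  · exact Finset.union_subset_union_right (Finset.erase_subset _ _) (hin p hp w hw)
  · have : lamSet G B S ⊆ lamSet G (B.erase y) S := by
      intro z hz
      simp only [mem_lamSet, Finset.mem_erase] at hz ⊢
      obtain ⟨hzB, a, ha, b, hb, hza, hzb, hab⟩ := hz
      refine ⟨⟨?_, hzB⟩, a, ha, b, hb, hza, hzb, hab⟩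
      rintro rfl
      exact hab (hy a (hSA ha) b (hSA hb) hza hzb)
    have := Finset.card_le_card this
    omega

/-- Extending the path through `x₁` along `x₁ y₀ x₀`, when `x₁` has at most one other neighbor. -/
theorem HasDeficiencyCover.extend {G : SimpleGraph V} {A B : Finset V} {x₀ y₀ x₁ : V}
    (hAB : Disjoint A B) (hind : ∀ a ∈ A, ∀ b ∈ A, ¬ G.Adj a b)
    (h : HasDeficiencyCover G (A.erase x₀) (B.erase y₀))
    (hx₀ : x₀ ∈ A) (hy₀ : y₀ ∈ B) (hx₁ : x₁ ∈ A) (hne : x₁ ≠ x₀)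
    (h₀ : G.Adj x₀ y₀) (h₁ : G.Adj y₀ x₁)
    (hy : ∀ a ∈ A, G.Adj y₀ a → a = x₀ ∨ a = x₁)
    (hx : ∀ a ∈ B.erase y₀, ∀ b ∈ B.erase y₀, G.Adj x₁ a → G.Adj x₁ b → a = b) :
    HasDeficiencyCover G A B := by
  obtain ⟨P, S, ⟨hpath, hpw, hcover⟩, hin, hSA, hcard⟩ := h
  obtain ⟨q, hq, hxq⟩ := hcover x₁ (by simp [hx₁, hne])
  have hqU : ∀ w ∈ q.2.2.support, w ∈ A.erase x₀ ∪ B.erase y₀ := hin q hq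
  obtain ⟨v, r, hr, hrs⟩ : ∃ (v : V) (r : G.Walk x₁ v), r.IsPath ∧
      ∀ w, w ∈ r.support ↔ w ∈ q.2.2.support := by
    have hend := (hpath q hq).eq_or_eq_of_subsingleton_adj hxq fun a ha b hb hxa hxb => by
      have hBof : ∀ a ∈ q.2.2.support, G.Adj x₁ a → a ∈ B.erase y₀ := fun a ha hxa => by
        rcases Finset.mem_union.1 (hqU a ha) with h | h
        · exact absurd hxa (hind _ hx₁ _ (Finset.mem_of_mem_erase h))
        · exact h
      exact hx a (hBof a ha hxa) b (hBof b hb hxb) hxa hxb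
    have hqp := hpath q hq
    obtain ⟨s, t, q⟩ := q
    rcases hend with rfl | rfl
    · exact ⟨_, q, hqp, fun w => Iff.rfl⟩
    · exact ⟨_, q.reverse, hqp.reverse, fun w => by simp⟩
  have hxy : x₀ ≠ y₀ := h₀.ne
  have hx₀r : x₀ ∉ r.support := fun hmem => by
    have := hqU _ ((hrs _).1 hmem)
    have := Finset.disjoint_left.1 hAB hx₀
    grind
  have hy₀r : y₀ ∉ r.support := fun hmem => by
    have := hqU _ ((hrs _).1 hmem)
    have := Finset.disjoint_right.1 hAB hy₀
    grind
  have hperm := List.perm_cons_erase hq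
  have hpw' : (q :: P.erase q).Pairwise
      (fun p q => ∀ w : V, w ∈ p.2.2.support → w ∉ q.2.2.support) :=
    (hperm.pairwise_iff (fun {a b} hab w hwb hwa => hab w hwa hwb)).1 hpw
  rw [List.pairwise_cons] at hpw'
  refine ⟨⟨x₀, v, .cons h₀ (.cons h₁ r)⟩ :: P.erase q, S, ⟨?_, ?_, ?_⟩, ?_, ?_, ?_⟩
  · intro p hp
    rcases List.mem_cons.1 hp with rfl | hp
    · simp [Walk.cons_isPath_iff, hr, hx₀r, hy₀r, hxy]
    · exact hpath p (List.mem_of_mem_erase hp)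
  · refine List.pairwise_cons.2 ⟨fun p hp w hw hwp => ?_, hpw'.2⟩
    have hwU := hin p (List.mem_of_mem_erase hp) w hwp
    have := Finset.disjoint_left.1 hAB hx₀
    have := Finset.disjoint_right.1 hAB hy₀
    simp only [Walk.support_cons, List.mem_cons] at hw
    rcases hw with rfl | rfl | hw
    · grind
    · grind
    · exact hpw'.1 p hp w ((hrs w).1 hw) hwp
  · intro x hxA
    by_cases hxx : x = x₀
    · exact ⟨_, List.mem_cons_self, by simp [hxx]⟩
    obtain ⟨p, hp, hxp⟩ := hcover x (by simp [hxx, hxA])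
    rcases List.mem_cons.1 (hperm.mem_iff.1 hp) with rfl | hp
    · exact ⟨_, List.mem_cons_self, by simp [hrs, hxp]⟩
    · exact ⟨p, List.mem_cons_of_mem _ hp, hxp⟩
  · intro p hp w hw
    rcases List.mem_cons.1 hp with rfl | hp
    · simp only [Walk.support_cons, List.mem_cons] at hw
      rcases hw with rfl | rfl | hw
      · simp [hx₀]
      · simp [hy₀]
      · have := hqU w ((hrs w).1 hw)
        grind
    · have := hin p (List.mem_of_mem_erase hp) w hw
      grind
  · exact hSA.trans (Finset.erase_subset _ _)
  · have hsub : lamSet G B S ⊆ lamSet G (B.erase y₀) S := by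
      intro z hz
      simp only [mem_lamSet, Finset.mem_erase] at hz ⊢
      grind
    have := Finset.card_le_card hsub
    have := hperm.length_eq
    simp only [List.length_cons] at this ⊢
    omega

/-- Removing an isolated vertex of `A`. -/
theorem HasDeficiencyCover.of_isolated {G : SimpleGraph V} {A B : Finset V} {x : V}
    (hAB : Disjoint A B) (hx : x ∈ A) (hiso : ∀ y ∈ B, ¬ G.Adj x y)
    (h : HasDeficiencyCover G (A.erase x) B) : HasDeficiencyCover G A B := by
  have hxB := Finset.disjoint_left.1 hAB hx
  refine h.cons (Walk.nil : G.Walk x x) (by simp) (Finset.erase_subset _ _) subset_rfl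
    (by simp [hx]) (by simp [hxB]) (by grind [Walk.support_nil]) fun S' hS' => ?_
  have hxS : x ∉ S' := fun hmem => by simpa using hS' hmem
  refine ⟨insert x S', by grind, ?_⟩
  have hsub : lamSet G B (insert x S') ⊆ lamSet G B S' := by
    intro z hz
    simp only [mem_lamSet] at hz ⊢
    have := G.adj_comm x z
    grind
  have := Finset.card_le_card hsub
  rw [Finset.card_insert_of_notMem hxS]
  omega

/-- Removing a path `x y x'` whose ends `x` and `x'` are leaves. -/
theorem HasDeficiencyCover.of_two_leaves {G : SimpleGraph V} {A B : Finset V} {x y x' : V}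
    (hAB : Disjoint A B) (hx : x ∈ A) (hx' : x' ∈ A) (hy : y ∈ B) (hne : x ≠ x')
    (hxy : G.Adj x y) (hyx' : G.Adj y x')
    (hleaf : ∀ z ∈ B, G.Adj x z → z = y) (hleaf' : ∀ z ∈ B, G.Adj x' z → z = y)
    (h : HasDeficiencyCover G ((A.erase x).erase x') (B.erase y)) :
    HasDeficiencyCover G A B := by
  have hxB := Finset.disjoint_left.1 hAB hx
  have hx'B := Finset.disjoint_left.1 hAB hx'
  have hyA := Finset.disjoint_right.1 hAB hy
  have hsupp : (Walk.cons hxy (Walk.cons hyx' Walk.nil)).support = [x, y, x'] := rfl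
  refine h.cons (.cons hxy (.cons hyx' .nil)) ?_ (by grind) (by grind)
    (by grind) (by grind) (by grind) fun S' hS' => ?_
  · simp [Walk.cons_isPath_iff, hne, hxy.ne, hyx'.ne]
  have hxS : x ∉ S' := fun hmem => by simpa using hS' hmem
  have hxS' : x' ∉ S' := fun hmem => by simpa using hS' hmem
  refine ⟨insert x (insert x' S'), by grind, ?_⟩
  have hsub : lamSet G B (insert x (insert x' S')) ⊆ insert y (lamSet G (B.erase y) S') := by
    intro z hz
    simp only [mem_lamSet, Finset.mem_insert, Finset.mem_erase] at hz ⊢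
    have := G.adj_comm x z
    have := G.adj_comm x' z
    grind
  have := Finset.card_le_card hsub
  have := Finset.card_insert_le y (lamSet G (B.erase y) S')
  rw [Finset.card_insert_of_notMem (by simp [hxS, hne]), Finset.card_insert_of_notMem hxS']
  omega

/-- Removing a path `x₀ y₀ x₁ y₁ x₂` whose ends are leaves and in which `y₀` and `y₁` have no
neighbors outside the path. -/
theorem HasDeficiencyCover.of_two_branches {G : SimpleGraph V} {A B : Finset V}
    {x₀ y₀ x₁ y₁ x₂ : V} (hAB : Disjoint A B) (hx₀ : x₀ ∈ A) (hy₀ : y₀ ∈ B) (hx₁ : x₁ ∈ A)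
    (hy₁ : y₁ ∈ B) (hx₂ : x₂ ∈ A) (hy : y₀ ≠ y₁) (h01 : x₀ ≠ x₁) (h12 : x₁ ≠ x₂)
    (h₁ : G.Adj x₀ y₀) (h₂ : G.Adj y₀ x₁) (h₃ : G.Adj x₁ y₁) (h₄ : G.Adj y₁ x₂)
    (hleaf₀ : ∀ z ∈ B, G.Adj x₀ z → z = y₀) (hleaf₂ : ∀ z ∈ B, G.Adj x₂ z → z = y₁)
    (hdeg₀ : ∀ a ∈ A, G.Adj y₀ a → a = x₀ ∨ a = x₁)
    (hdeg₁ : ∀ a ∈ A, G.Adj y₁ a → a = x₂ ∨ a = x₁)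
    (h : HasDeficiencyCover G (((A.erase x₀).erase x₁).erase x₂) ((B.erase y₀).erase y₁)) :
    HasDeficiencyCover G A B := by
  have hxB₀ := Finset.disjoint_left.1 hAB hx₀
  have hxB₁ := Finset.disjoint_left.1 hAB hx₁
  have hxB₂ := Finset.disjoint_left.1 hAB hx₂
  have hyA₀ := Finset.disjoint_right.1 hAB hy₀
  have hyA₁ := Finset.disjoint_right.1 hAB hy₁
  have h02 : x₀ ≠ x₂ := by
    rintro rfl
    exact hy (hleaf₀ y₁ hy₁ h₄.symm).symm
  have hsupp : (Walk.cons h₁ (Walk.cons h₂ (Walk.cons h₃ (Walk.cons h₄ Walk.nil)))).support =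
    [x₀, y₀, x₁, y₁, x₂] := rfl
  refine h.cons (.cons h₁ (.cons h₂ (.cons h₃ (.cons h₄ .nil)))) ?_ (by grind) (by grind)
    (by grind) (by grind) (by grind) fun S' hS' => ?_
  · rw [Walk.isPath_def, hsupp]
    grind
  have hxS : x₀ ∉ S' := fun hmem => by simpa using hS' hmem
  refine ⟨insert x₀ S', by grind, ?_⟩
  have hsub : lamSet G B (insert x₀ S') ⊆ lamSet G ((B.erase y₀).erase y₁) S' := by
    intro z hz
    simp only [mem_lamSet, Finset.mem_insert, Finset.mem_erase] at hz ⊢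
    have := G.adj_comm x₀ z
    grind
  have := Finset.card_le_card hsub
  rw [Finset.card_insert_of_notMem hxS]
  omega

theorem SimpleGraph.IsAcyclic.hasDeficiencyCover {G : SimpleGraph V} (hG : G.IsAcyclic)
    {A B : Finset V} (hAB : Disjoint A B) (hA : ∀ a ∈ A, ∀ b ∈ A, ¬ G.Adj a b) :
    HasDeficiencyCover G A B := by
  induction hn : A.card + B.card using Nat.strong_induction_on generalizing A B with
  | _ n ih =>
  subst hn
  have step : ∀ A' ⊆ A, ∀ B' ⊆ B, A'.card + B'.card < A.card + B.card →
      HasDeficiencyCover G A' B' := fun A' hA' B' hB' hlt =>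
    ih _ hlt (Finset.disjoint_of_subset_left hA' (Finset.disjoint_of_subset_right hB' hAB))
      (fun a ha b hb => hA a (hA' ha) b (hA' hb)) rfl
  rcases A.eq_empty_or_nonempty with rfl | hne
  · refine ⟨[], ∅, ⟨by simp, by simp, by simp⟩, by simp, by simp, ?_⟩
    simp [lamSet]
  by_cases hdeg : ∀ y ∈ B, ∃ a ∈ A, ∃ b ∈ A, G.Adj y a ∧ G.Adj y b ∧ a ≠ b
  swap
  · push Not at hdeg
    obtain ⟨y, hy, hdeg⟩ := hdeg
    have := Finset.card_erase_lt_of_mem hy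
    exact (step A subset_rfl _ (Finset.erase_subset y B) (by omega)).of_erase hdeg
  by_cases hiso : ∃ x ∈ A, ∀ y ∈ B, ¬ G.Adj x y
  · obtain ⟨x, hx, hiso⟩ := hiso
    have := Finset.card_erase_lt_of_mem hx
    exact .of_isolated hAB hx hiso
      (step _ (Finset.erase_subset x A) B subset_rfl (by omega))
  push Not at hiso
  have hlt : ∀ A' ⊆ A, ∀ y ∈ B, ∀ B' ⊆ B.erase y, A'.card + B'.card < A.card + B.card := by
    intro A' hA' y hy B' hB'
    have := Finset.card_erase_lt_of_mem hy
    have := Finset.card_le_card hA'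
    have := Finset.card_le_card hB'
    omega
  have herase : ∀ (C : Finset V) (a b : V), (C.erase a).erase b ⊆ C := fun C a b =>
    (Finset.erase_subset _ _).trans (Finset.erase_subset _ _)
  obtain ⟨L, hL⟩ : ∃ L : Finset V,
      ∀ x, x ∈ L ↔ x ∈ A ∧ ∀ y ∈ B, ∀ z ∈ B, G.Adj x y → G.Adj x z → y = z :=
    ⟨A.filter fun x => ∀ y ∈ B, ∀ z ∈ B, G.Adj x y → G.Adj x z → y = z, by simp⟩
  by_cases htwo : ∃ y ∈ B, ∃ x ∈ L, ∃ x' ∈ L, G.Adj y x ∧ G.Adj y x' ∧ x ≠ x'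
  · obtain ⟨y, hy, x, hx, x', hx', hyx, hyx', hxx'⟩ := htwo
    rw [hL] at hx hx'
    exact .of_two_leaves hAB hx.1 hx'.1 hy hxx' hyx.symm hyx'
      (fun z hz hxz => hx.2 z hz y hy hxz hyx.symm)
      (fun z hz hxz => hx'.2 z hz y hy hxz hyx'.symm)
      (step _ (herase A x x') _ (Finset.erase_subset y B)
        (hlt _ (herase A x x') y hy _ subset_rfl))
  push Not at htwo
  obtain ⟨B₁, hB₁⟩ : ∃ B₁ : Finset V, ∀ y, y ∈ B₁ ↔
      y ∈ B ∧ ∀ a ∈ A \ L, ∀ b ∈ A \ L, G.Adj y a → G.Adj y b → a = b :=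
    ⟨B.filter fun y => ∀ a ∈ A \ L, ∀ b ∈ A \ L, G.Adj y a → G.Adj y b → a = b, by simp⟩
  have hpend : ∀ y ∈ B₁, ∀ x₁ ∈ A \ L, G.Adj y x₁ → ∃ x₀ ∈ L, G.Adj y x₀ ∧
      ∀ a ∈ A, G.Adj y a → a = x₀ ∨ a = x₁ := by
    intro y hy x₁ hx₁ hyx₁
    obtain ⟨hyB, huniq⟩ := (hB₁ y).1 hy
    obtain ⟨x₀, hx₀, hyx₀⟩ : ∃ x₀ ∈ L, G.Adj y x₀ := by
      obtain ⟨a, ha, b, hb, hya, hyb, hab⟩ := hdeg y hyB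
      by_contra! hno
      exact hab (huniq a (Finset.mem_sdiff.2 ⟨ha, fun h => hno a h hya⟩)
        b (Finset.mem_sdiff.2 ⟨hb, fun h => hno b h hyb⟩) hya hyb)
    refine ⟨x₀, hx₀, hyx₀, fun a ha hya => ?_⟩
    by_cases haL : a ∈ L
    · exact Or.inl (htwo y hyB a haL x₀ hx₀ hya hyx₀)
    · exact Or.inr (huniq a (Finset.mem_sdiff.2 ⟨ha, haL⟩) x₁ hx₁ hya hyx₁)
  have hnonleaf : (A \ L).Nonempty := by
    obtain ⟨x, hx⟩ := hne
    obtain ⟨y, hy, hxy⟩ := hiso x hx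
    obtain ⟨a, ha, b, hb, hya, hyb, hab⟩ := hdeg y hy
    by_contra hemp
    rw [Finset.not_nonempty_iff_eq_empty, Finset.sdiff_eq_empty_iff_subset] at hemp
    exact hab (htwo y hy a (hemp ha) b (hemp hb) hya hyb)
  obtain ⟨x₁, hx₁U, hx₁⟩ := hG.exists_mem_subsingleton_adj
    (U := (A \ L) ∪ (B \ B₁)) (hnonleaf.mono Finset.subset_union_left)
  have hx₁AL : x₁ ∈ A \ L := by
    rcases Finset.mem_union.1 hx₁U with h | h
    · exact h
    · grind
  obtain ⟨hx₁A, hx₁L⟩ := Finset.mem_sdiff.1 hx₁AL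
  obtain ⟨y₀, hy₀, hx₁y₀⟩ : ∃ y₀ ∈ B₁, G.Adj x₁ y₀ := by
    by_contra! hno
    refine hx₁L ((hL x₁).2 ⟨hx₁A, fun y hy z hz hxy hxz => hx₁ y ?_ z ?_ hxy hxz⟩) <;> grind
  obtain ⟨x₀, hx₀, hyx₀, hdeg₀⟩ := hpend y₀ hy₀ x₁ hx₁AL hx₁y₀.symm
  have hy₀B := ((hB₁ y₀).1 hy₀).1
  have hx₀' := (hL x₀).1 hx₀
  have h01 : x₀ ≠ x₁ := by grind
  by_cases hother : ∃ y₁ ∈ B₁, G.Adj x₁ y₁ ∧ y₀ ≠ y₁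
  · obtain ⟨y₁, hy₁, hx₁y₁, hy⟩ := hother
    obtain ⟨x₂, hx₂, hyx₂, hdeg₁⟩ := hpend y₁ hy₁ x₁ hx₁AL hx₁y₁.symm
    have hy₁B := ((hB₁ y₁).1 hy₁).1
    have hx₂' := (hL x₂).1 hx₂
    have hsub : ((A.erase x₀).erase x₁).erase x₂ ⊆ A :=
      (herase _ x₁ x₂).trans (Finset.erase_subset _ _)
    exact .of_two_branches hAB hx₀'.1 hy₀B hx₁A hy₁B hx₂'.1 hy h01 (by grind)
      hyx₀.symm hx₁y₀.symm hx₁y₁ hyx₂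
      (fun z hz hxz => hx₀'.2 z hz y₀ hy₀B hxz hyx₀.symm)
      (fun z hz hxz => hx₂'.2 z hz y₁ hy₁B hxz hyx₂.symm) hdeg₀ hdeg₁
      (step _ hsub _ (herase B y₀ y₁) (hlt _ hsub y₀ hy₀B _ (Finset.erase_subset _ _)))
  · push Not at hother
    refine .extend hAB hA (step _ (Finset.erase_subset x₀ A) _ (Finset.erase_subset y₀ B)
        (hlt _ (Finset.erase_subset x₀ A) y₀ hy₀B _ subset_rfl))
      hx₀'.1 hy₀B hx₁A h01.symm hyx₀.symm hx₁y₀.symm hdeg₀ fun a ha b hb hxa hxb => ?_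
    refine hx₁ a ?_ b ?_ hxa hxb <;> grind

/-- If `G` is an `(X,Y)`-bigraph with no cycles (a forest),
then `G` has a path `X`-cover of size at most `def(G)`. -/
theorem forest_path_cover {V : Type*} (G : SimpleGraph V) (X Y : Finset V)
    (hBG : IsBigraph G X Y) (hforest : G.IsAcyclic) :
    ∃ P : List (Σ u : V, Σ v : V, G.Walk u v),
      IsPathXCover G X P ∧ (P.length : ℤ) ≤ lamDef G X Y := by
  obtain ⟨hXY, -, hadj⟩ := hBG
  have hX : ∀ a ∈ X, ∀ b ∈ X, ¬ G.Adj a b := fun a ha b hb hab => by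
    rcases hadj hab with h | h
    · exact Finset.disjoint_left.1 hXY hb h.2
    · exact Finset.disjoint_left.1 hXY ha h.1
  obtain ⟨P, S, hP, -, hSX, hcard⟩ := hforest.hasDeficiencyCover hXY hX
  refine ⟨P, hP, le_trans ?_ (Finset.le_sup' _ (Finset.mem_powerset.2 hSX))⟩
  simp only [lamDefSet]
  omega
end

section
/- If G is a 3-regular (X,Y)-bigraph (every vertex of G has degree exactly 3), then G has a path X-cover consisting of at most α_Λ(G) paths. -/
open Finset SimpleGraph
open scoped Classical

variable {V : Type*}

/-- A regular bipartite multigraph, given by an edge set `E` with endpoint maps `l` and `r`,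
has a perfect matching. -/
theorem exists_perfect_edge_selection {ε α β : Type*} (E : Finset ε) (l : ε → α) (r : ε → β)
    (A : Finset α) (B : Finset β) {k : ℕ} (hk : 0 < k)
    (hl : ∀ e ∈ E, l e ∈ A) (hr : ∀ e ∈ E, r e ∈ B)
    (hA : ∀ a ∈ A, (E.filter fun e => l e = a).card = k)
    (hB : ∀ b ∈ B, (E.filter fun e => r e = b).card = k) :
    ∃ M ⊆ E, (∀ a ∈ A, ∃! e, e ∈ M ∧ l e = a) ∧ (∀ b ∈ B, ∃! e, e ∈ M ∧ r e = b) := by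
  have hcardl : ∀ S ⊆ A, (E.filter fun e => l e ∈ S).card = S.card * k := by
    intro S hS
    rw [Finset.card_eq_sum_card_fiberwise (f := l) (t := S) (by intro e he; simp at he; exact he.2)]
    refine Finset.sum_const_nat fun a ha => ?_
    rw [← hA a (hS ha), Finset.filter_filter]
    congr 1
    ext e
    simp only [Finset.mem_filter]
    exact ⟨fun h => ⟨h.1, h.2.2⟩, fun h => ⟨h.1, h.2 ▸ ha, h.2⟩⟩
  have hcardr : ∀ S ⊆ B, (E.filter fun e => r e ∈ S).card = S.card * k := by
    intro S hS
    rw [Finset.card_eq_sum_card_fiberwise (f := r) (t := S) (by intro e he; simp at he; exact he.2)]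
    refine Finset.sum_const_nat fun a ha => ?_
    rw [← hB a (hS ha), Finset.filter_filter]
    congr 1
    ext e
    simp only [Finset.mem_filter]
    exact ⟨fun h => ⟨h.1, h.2.2⟩, fun h => ⟨h.1, h.2 ▸ ha, h.2⟩⟩
  have hAB : A.card = B.card := by
    have h1 := hcardl A subset_rfl
    have h2 := hcardr B subset_rfl
    rw [Finset.filter_true_of_mem hl] at h1
    rw [Finset.filter_true_of_mem hr] at h2
    exact Nat.eq_of_mul_eq_mul_right hk (h1.symm.trans h2)
  let t : A → Finset β := fun a => (E.filter fun e => l e = a).image r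
  obtain ⟨f, hf, hft⟩ := (Finset.all_card_le_biUnion_card_iff_exists_injective t).1 (by
    intro s
    have hsub : s.biUnion t ⊆ B := by
      intro b hb
      simp only [t, Finset.mem_biUnion, Finset.mem_image, Finset.mem_filter] at hb
      obtain ⟨a, -, e, he, rfl⟩ := hb
      exact hr e he.1
    have h1 := hcardl (s.map (Function.Embedding.subtype _)) (by
      intro a ha
      simp only [Finset.mem_map] at ha
      obtain ⟨a, -, rfl⟩ := ha
      exact a.2)
    have h2 := hcardr _ hsub
    rw [Finset.card_map] at h1
    refine Nat.le_of_mul_le_mul_right ?_ hk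
    rw [← h1, ← h2]
    refine Finset.card_le_card fun e he => ?_
    simp only [Finset.mem_filter, Finset.mem_map, Finset.mem_biUnion, t, Finset.mem_image] at he ⊢
    obtain ⟨he, a, ha, hae⟩ := he
    exact ⟨he, a, ha, e, ⟨he, hae.symm⟩, rfl⟩)
  have hex : ∀ a : A, ∃ e ∈ E, l e = a ∧ r e = f a := by
    intro a
    obtain ⟨e, he, hfe⟩ := Finset.mem_image.1 (hft a)
    exact ⟨e, (Finset.mem_filter.1 he).1, (Finset.mem_filter.1 he).2, hfe⟩
  choose g hgE hgl hgr using hex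
  refine ⟨Finset.univ.image g, ?_, ?_, ?_⟩
  · intro e he
    obtain ⟨a, -, rfl⟩ := Finset.mem_image.1 he
    exact hgE a
  · intro a ha
    refine ⟨g ⟨a, ha⟩, ⟨by simp, hgl _⟩, ?_⟩
    rintro e ⟨he, hea⟩
    obtain ⟨a', -, rfl⟩ := Finset.mem_image.1 he
    congr 1
    exact Subtype.ext ((hgl a').symm.trans hea)
  · have himg : Finset.univ.image f = B := by
      refine Finset.eq_of_subset_of_card_le ?_ ?_
      · intro b hb
        obtain ⟨a, -, rfl⟩ := Finset.mem_image.1 hb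
        rw [← hgr]
        exact hr _ (hgE a)
      · rw [Finset.card_image_of_injective _ hf]
        simp [hAB]
    intro b hb
    rw [← himg] at hb
    obtain ⟨a, -, rfl⟩ := Finset.mem_image.1 hb
    refine ⟨g a, ⟨by simp, hgr a⟩, ?_⟩
    rintro e ⟨he, hea⟩
    obtain ⟨a', -, rfl⟩ := Finset.mem_image.1 he
    rw [hgr] at hea
    rw [hf hea]

/-- The vertices `a, b, c, d` form, in this cyclic order, a `4`-cycle of `G`. -/
def IsSquare4 (G : SimpleGraph V) (a b c d : V) : Prop :=
  a ≠ c ∧ b ≠ d ∧ G.Adj a b ∧ G.Adj b c ∧ G.Adj c d ∧ G.Adj d a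

/-- The map sending `c i` to `a i` for each `i`, and fixing every other vertex. -/
noncomputable def foldMap {ι : Type*} (a c : ι → V) (v : V) : V :=
  if h : ∃ i, v = c i then a h.choose else v

theorem foldMap_apply {ι : Type*} {a c : ι → V} (hc : Function.Injective c) (i : ι) :
    foldMap a c (c i) = a i := by
  have h : ∃ j, c i = c j := ⟨i, rfl⟩
  rw [foldMap, dif_pos h, ← hc h.choose_spec]

theorem foldMap_of_ne {ι : Type*} {a c : ι → V} {v : V} (h : ∀ i, v ≠ c i) :
    foldMap a c v = v := by
  rw [foldMap, dif_neg (by simpa using h)]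

theorem foldMap_eq_iff {ι : Type*} {a c : ι → V} (hc : Function.Injective c)
    (ha : Function.Injective a) (hac : ∀ i j, a i ≠ c j) (v : V) (i : ι) :
    foldMap a c v = a i ↔ v = a i ∨ v = c i := by
  by_cases h : ∃ j, v = c j
  · obtain ⟨j, rfl⟩ := h
    rw [foldMap_apply hc]
    constructor
    · intro h
      rw [ha h]
      exact Or.inr rfl
    · rintro (h | h)
      · exact absurd h.symm (hac i j)
      · rw [hc h]
  · push Not at h
    rw [foldMap_of_ne h]
    simp [h i]

theorem foldMap_eq_iff_of_ne {ι : Type*} {a c : ι → V} (hc : Function.Injective c)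
    {u : V} (hua : ∀ i, u ≠ a i) (huc : ∀ i, u ≠ c i) (v : V) :
    foldMap a c v = u ↔ v = u := by
  by_cases h : ∃ j, v = c j
  · obtain ⟨j, rfl⟩ := h
    rw [foldMap_apply hc]
    exact ⟨fun h => absurd h.symm (hua j), fun h => absurd h.symm (huc j)⟩
  · push Not at h
    rw [foldMap_of_ne h]

/-- A family of pairwise disjoint squares of the `3`-regular bigraph `G` whose sides are given by
`X` and its complement; the first and third vertices of each square lie in `X`. -/
structure SquareFamily (G : SimpleGraph V) (X : Finset V) {ι : Type*} (a b c d : ι → V) :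
    Prop where
  side : ∀ u v, G.Adj u v → (u ∈ X ↔ v ∉ X)
  square : ∀ i, IsSquare4 G (a i) (b i) (c i) (d i)
  mem : ∀ i, a i ∈ X
  disj : ∀ i j, i ≠ j → ∀ u, (u = a i ∨ u = b i ∨ u = c i ∨ u = d i) →
    ¬ (u = a j ∨ u = b j ∨ u = c j ∨ u = d j)

/-- The edges of `G`, directed away from `X`, that join different squares of the family or
are the chosen edge of a square. -/
noncomputable def contractedEdges [Fintype V] (G : SimpleGraph V) (X : Finset V) {ι : Type*}
    (a b c d : ι → V) : Finset (V × V) :=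
  Finset.univ.filter fun e => e.1 ∈ X ∧ G.Adj e.1 e.2 ∧
    ∀ i, (e.1 = a i ∨ e.1 = c i) → (e.2 = b i ∨ e.2 = d i) → e = (a i, b i)

namespace SquareFamily

variable {G : SimpleGraph V} {X : Finset V} {ι : Type*} {a b c d : ι → V}

theorem swap [Fintype V] (h : SquareFamily G X a b c d) : SquareFamily G Xᶜ b a d c where
  side u v huv := by simp [h.side u v huv]
  square i := by
    obtain ⟨h1, h2, h3, h4, h5, h6⟩ := h.square i
    exact ⟨h2, h1, h3.symm, h6.symm, h5.symm, h4.symm⟩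
  mem i := by
    have := (h.side _ _ (h.square i).2.2.1).1 (h.mem i)
    simpa using this
  disj i j hij u := by
    have := h.disj i j hij u
    tauto

theorem mem_third (h : SquareFamily G X a b c d) (i : ι) : c i ∈ X := by
  obtain ⟨h1, h2, h3, h4, h5, h6⟩ := h.square i
  have := h.side _ _ h3
  have := h.side _ _ h4
  have := h.mem i
  tauto

theorem injective_fst (h : SquareFamily G X a b c d) : Function.Injective a := by
  intro i j hij
  by_contra hne
  exact h.disj i j hne (a i) (by simp) (by simp [hij])

theorem injective_third (h : SquareFamily G X a b c d) : Function.Injective c := by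
  intro i j hij
  by_contra hne
  exact h.disj i j hne (c i) (by simp) (by simp [hij])

theorem fst_ne_third (h : SquareFamily G X a b c d) (i j : ι) : a i ≠ c j := by
  intro hij
  by_cases hne : i = j
  · subst hne
    exact (h.square i).1 hij
  · exact h.disj i j hne (a i) (by simp) (by simp [hij])

theorem exists_third_nbr [Fintype V] (hreg : ∀ v, (Finset.univ.filter (G.Adj v)).card = 3)
    {a b d : V} (hbd : b ≠ d) (hab : G.Adj a b) (had : G.Adj a d) :
    ∃ w, w ≠ b ∧ w ≠ d ∧ ∀ u, G.Adj a u ↔ u = b ∨ u = d ∨ u = w := by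
  obtain ⟨p, q, r, hpq, hpr, hqr, hs⟩ := Finset.card_eq_three.1 (hreg a)
  have key : ∀ u, G.Adj a u ↔ u = p ∨ u = q ∨ u = r := by
    intro u
    simpa using congrArg (u ∈ ·) hs
  have h1 := (key b).1 hab
  have h2 := (key d).1 had
  by_cases hp : p ≠ b ∧ p ≠ d
  · exact ⟨p, hp.1, hp.2, by grind⟩
  by_cases hq : q ≠ b ∧ q ≠ d
  · exact ⟨q, hq.1, hq.2, by grind⟩
  · exact ⟨r, by grind, by grind, by grind⟩

theorem card_fiber [Fintype V] (h : SquareFamily G X a b c d)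
    (hreg : ∀ v, (Finset.univ.filter (G.Adj v)).card = 3)
    (x : V) (hx : x ∈ X) :
    ((contractedEdges G X a b c d).filter fun e => foldMap a c e.1 = foldMap a c x).card = 3 := by
  by_cases hD : ∃ i, x = a i ∨ x = c i
  · obtain ⟨i, hi⟩ := hD
    rw [(foldMap_eq_iff h.injective_third h.injective_fst h.fst_ne_third x i).2 hi]
    simp only [foldMap_eq_iff h.injective_third h.injective_fst h.fst_ne_third]
    obtain ⟨h1, h2, h3, h4, h5, h6⟩ := h.square i
    obtain ⟨w, hwb, hwd, hw⟩ := exists_third_nbr hreg h2 h3 h6.symm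
    obtain ⟨w', hwb', hwd', hw'⟩ := exists_third_nbr hreg h2 h4.symm h5
    refine Finset.card_eq_three.2 ⟨(a i, w), (a i, b i), (c i, w'), ?_, ?_, ?_, ?_⟩
    · simp [hwb]
    · simp [h1]
    · simp [h1]
    · have hij : ∀ u, (u = a i ∨ u = c i) → ∀ j, (u = a j ∨ u = c j) → j = i := by
        intro u hu j hj
        by_contra hne
        exact h.disj j i hne u (by tauto) (by tauto)
      ext ⟨u, v⟩
      simp only [contractedEdges, Finset.mem_filter, Finset.mem_univ, true_and,
        Finset.mem_insert, Finset.mem_singleton, Prod.mk.injEq]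
      constructor
      · rintro ⟨⟨hu, huv, hE⟩, rfl | rfl⟩
        · have := hE i
          rw [hw] at huv
          tauto
        · have := hE i
          rw [hw'] at huv
          tauto
      · rintro (⟨rfl, rfl⟩ | ⟨rfl, rfl⟩ | ⟨rfl, rfl⟩)
        · refine ⟨⟨h.mem i, by simp [hw], ?_⟩, Or.inl rfl⟩
          intro j hj hj'
          rw [hij _ (Or.inl rfl) j hj] at hj'
          tauto
        · refine ⟨⟨h.mem i, h3, ?_⟩, Or.inl rfl⟩
          intro j hj hj'
          rw [hij _ (Or.inl rfl) j hj]
          simp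
        · refine ⟨⟨h.mem_third i, by simp [hw'], ?_⟩, Or.inr rfl⟩
          intro j hj hj'
          rw [hij _ (Or.inr rfl) j hj] at hj'
          tauto
  · push Not at hD
    rw [foldMap_of_ne fun i => (hD i).2]
    simp only [foldMap_eq_iff_of_ne h.injective_third (fun i => (hD i).1) (fun i => (hD i).2)]
    rw [← hreg x]
    refine Finset.card_bij (fun e _ => e.2) ?_ ?_ ?_
    · simp only [contractedEdges, Finset.mem_filter, Finset.mem_univ, true_and]
      rintro ⟨u, v⟩ ⟨⟨hu, huv, hE⟩, rfl⟩
      exact huv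
    · simp only [contractedEdges, Finset.mem_filter, Finset.mem_univ, true_and]
      rintro ⟨u, v⟩ ⟨⟨hu, huv, hE⟩, rfl⟩ ⟨u', v'⟩ ⟨_, h'⟩ h''
      exact Prod.ext h'.symm h''
    · intro v hv
      simp only [Finset.mem_filter, Finset.mem_univ, true_and] at hv
      refine ⟨(x, v), ?_, rfl⟩
      simp only [contractedEdges, Finset.mem_filter, Finset.mem_univ, true_and]
      refine ⟨⟨hx, hv, fun i hi => ?_⟩, trivial⟩
      have := hD i
      tauto

theorem card_fiber_snd [Fintype V] (h : SquareFamily G X a b c d)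
    (hreg : ∀ v, (Finset.univ.filter (G.Adj v)).card = 3)
    (y : V) (hy : y ∉ X) :
    ((contractedEdges G X a b c d).filter fun e => foldMap b d e.2 = foldMap b d y).card = 3 := by
  rw [← h.swap.card_fiber hreg y (by simpa using hy)]
  refine Finset.card_bij (fun e _ => e.swap) ?_ ?_ ?_
  · simp only [contractedEdges, Finset.mem_filter, Finset.mem_univ, true_and]
    rintro ⟨u, v⟩ ⟨⟨hu, huv, hE⟩, he⟩
    have := h.side u v huv
    refine ⟨⟨by simp; tauto, huv.symm, fun i hi hi' => ?_⟩, he⟩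
    have := hE i hi' hi
    simp_all
  · intro e _ e' _ hee
    exact Prod.swap_injective hee
  · simp only [contractedEdges, Finset.mem_filter, Finset.mem_univ, true_and]
    rintro ⟨v, u⟩ ⟨⟨hu, huv, hE⟩, he⟩
    have := h.side v u huv
    refine ⟨(u, v), ⟨⟨by simp at hu; tauto, huv.symm, fun i hi hi' => ?_⟩, he⟩, rfl⟩
    have := hE i hi' hi
    simp_all

/-- A selection of edges meeting each contracted vertex exactly once covers exactly one of
the two folded vertices of each square. -/
theorem exists_covered (h : SquareFamily G X a b c d) {M : Finset (V × V)} (f : V × V → V)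
    (hM : ∀ x ∈ X, ∃! e, e ∈ M ∧ foldMap a c (f e) = foldMap a c x) (i : ι) :
    ((∃ e ∈ M, f e = a i) ∧ ∀ e ∈ M, f e ≠ c i) ∨
      ((∃ e ∈ M, f e = c i) ∧ ∀ e ∈ M, f e ≠ a i) := by
  obtain ⟨e, ⟨heM, he⟩, huniq⟩ := hM (a i) (h.mem i)
  have hi := foldMap_eq_iff h.injective_third h.injective_fst h.fst_ne_third
  rw [(hi (a i) i).2 (Or.inl rfl)] at he huniq
  simp only [hi] at he huniq
  have hac := h.fst_ne_third i i
  rcases he with he | he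
  · refine Or.inl ⟨⟨e, heM, he⟩, fun e' he' hc => ?_⟩
    have := huniq e' ⟨he', Or.inr hc⟩
    subst this
    exact hac (he.symm.trans hc)
  · refine Or.inr ⟨⟨e, heM, he⟩, fun e' he' hc => ?_⟩
    have := huniq e' ⟨he', Or.inl hc⟩
    subst this
    exact hac (hc.symm.trans he)

theorem exists_covered_of_ne (h : SquareFamily G X a b c d) {M : Finset (V × V)} (f : V × V → V)
    (hM : ∀ x ∈ X, ∃! e, e ∈ M ∧ foldMap a c (f e) = foldMap a c x) {x : V} (hx : x ∈ X)
    (hne : ∀ i, x ≠ a i ∧ x ≠ c i) : ∃ e ∈ M, f e = x := by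
  obtain ⟨e, ⟨heM, he⟩, -⟩ := hM x hx
  rw [foldMap_of_ne fun i => (hne i).2, foldMap_eq_iff_of_ne h.injective_third
    (fun i => (hne i).1) (fun i => (hne i).2)] at he
  exact ⟨e, heM, he⟩

theorem existsUnique_of_uncovered (h : SquareFamily G X a b c d) {M : Finset (V × V)}
    (f : V × V → V) (hM : ∀ x ∈ X, ∃! e, e ∈ M ∧ foldMap a c (f e) = foldMap a c x)
    (P : ι → V × V) (hP : ∀ i, f (P i) = a i ∨ f (P i) = c i)
    (hPM : ∀ i, ∀ e ∈ M, f e ≠ f (P i)) {x : V} (hx : x ∈ X) :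
    ∃! e, (e ∈ M ∨ ∃ i, e = P i) ∧ f e = x := by
  have hex : ∃ e, (e ∈ M ∨ ∃ i, e = P i) ∧ f e = x := by
    by_cases hD : ∃ i, x = a i ∨ x = c i
    · obtain ⟨i, hi⟩ := hD
      by_cases hxP : f (P i) = x
      · exact ⟨P i, Or.inr ⟨i, rfl⟩, hxP⟩
      · have := hP i
        rcases h.exists_covered f hM i with ⟨⟨e, he, hea⟩, h2⟩ | ⟨⟨e, he, hea⟩, h2⟩
        · have := hPM i e he
          exact ⟨e, Or.inl he, by grind⟩
        · have := hPM i e he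
          exact ⟨e, Or.inl he, by grind⟩
    · push Not at hD
      obtain ⟨e, he, hex⟩ := h.exists_covered_of_ne f hM hx hD
      exact ⟨e, Or.inl he, hex⟩
  obtain ⟨e, he, hex⟩ := hex
  refine ⟨e, ⟨he, hex⟩, ?_⟩
  rintro e' ⟨he', hex'⟩
  have hPP : ∀ i j, f (P i) = f (P j) → i = j := by
    intro i j hij
    by_contra hne
    have h1 := hP i
    have h2 := hP j
    rw [hij] at h1
    exact h.disj i j hne (f (P j)) (by tauto) (by tauto)
  rcases he with he | ⟨i, rfl⟩ <;> rcases he' with he' | ⟨j, rfl⟩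
  · exact (hM x hx).unique ⟨he', by rw [hex']⟩ ⟨he, by rw [hex]⟩
  · exact absurd (hex.trans hex'.symm) (hPM j e he)
  · exact absurd (hex'.trans hex.symm) (hPM i e' he')
  · rw [hPP i j (hex.trans hex'.symm)]

end SquareFamily

/-- The map `m` sends every vertex to its partner in a perfect matching of `G`. -/
structure IsMate (G : SimpleGraph V) (m : V → V) : Prop where
  adj : ∀ v, G.Adj v (m v)
  invol : ∀ v, m (m v) = v

/-- The matching `m` contains an edge of the square `a, b, c, d`. -/
def HitsSquare (m : V → V) (a b c d : V) : Prop :=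
  m a = b ∨ m b = c ∨ m c = d ∨ m d = a

theorem exists_isMate_of_existsUnique {G : SimpleGraph V} {X : Finset V} (N : V × V → Prop)
    (hN : ∀ e, N e → e.1 ∈ X ∧ e.2 ∉ X ∧ G.Adj e.1 e.2)
    (h1 : ∀ x ∈ X, ∃! e, N e ∧ e.1 = x) (h2 : ∀ y, y ∉ X → ∃! e, N e ∧ e.2 = y) :
    ∃ m, IsMate G m ∧ ∀ e, N e → m e.1 = e.2 := by
  choose f hf hfu using h1
  choose g hg hgu using h2
  let m : V → V := fun v => if hv : v ∈ X then (f v hv).2 else (g v hv).1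
  have hm1 : ∀ e, N e → m e.1 = e.2 := by
    intro e he
    have hx := (hN e he).1
    simp only [m, dif_pos hx]
    rw [← hfu e.1 hx e ⟨he, rfl⟩]
  have hm2 : ∀ e, N e → m e.2 = e.1 := by
    intro e he
    have hx := (hN e he).2.1
    simp only [m, dif_neg hx]
    rw [← hgu e.2 hx e ⟨he, rfl⟩]
  have hex : ∀ v, ∃ e, N e ∧ (e.1 = v ∨ e.2 = v) := by
    intro v
    by_cases hv : v ∈ X
    · exact ⟨f v hv, (hf v hv).1, Or.inl (hf v hv).2⟩
    · exact ⟨g v hv, (hg v hv).1, Or.inr (hg v hv).2⟩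
  refine ⟨m, ⟨fun v => ?_, fun v => ?_⟩, hm1⟩
  · obtain ⟨e, he, rfl | rfl⟩ := hex v
    · rw [hm1 e he]
      exact (hN e he).2.2
    · rw [hm2 e he]
      exact (hN e he).2.2.symm
  · obtain ⟨e, he, rfl | rfl⟩ := hex v
    · rw [hm1 e he, hm2 e he]
    · rw [hm2 e he, hm1 e he]

/-- A `3`-regular bigraph has a perfect matching that contains an edge of each square of a given
family of pairwise disjoint squares. -/
theorem SquareFamily.exists_isMate [Fintype V] {G : SimpleGraph V} {X : Finset V} {ι : Type*}
    {a b c d : ι → V} (h : SquareFamily G X a b c d)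
    (hreg : ∀ v, (Finset.univ.filter (G.Adj v)).card = 3) :
    ∃ m, IsMate G m ∧ ∀ i, HitsSquare m (a i) (b i) (c i) (d i) := by
  obtain ⟨M, hME, hMA, hMB⟩ := exists_perfect_edge_selection (contractedEdges G X a b c d)
    (fun e => foldMap a c e.1) (fun e => foldMap b d e.2)
    (X.image (foldMap a c)) (Xᶜ.image (foldMap b d)) (k := 3) (by norm_num)
    (by
      intro e he
      simp only [contractedEdges, Finset.mem_filter, Finset.mem_univ, true_and] at he
      exact Finset.mem_image_of_mem _ he.1)
    (by
      intro e he
      simp only [contractedEdges, Finset.mem_filter, Finset.mem_univ, true_and] at he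
      exact Finset.mem_image_of_mem _ (by simpa using (h.side _ _ he.2.1).1 he.1))
    (by
      intro u hu
      obtain ⟨x, hx, rfl⟩ := Finset.mem_image.1 hu
      exact h.card_fiber hreg x hx)
    (by
      intro u hu
      obtain ⟨x, hx, rfl⟩ := Finset.mem_image.1 hu
      exact h.card_fiber_snd hreg x (by simpa using hx))
  have hMX : ∀ x ∈ X, ∃! e, e ∈ M ∧ foldMap a c e.1 = foldMap a c x :=
    fun x hx => hMA _ (Finset.mem_image_of_mem _ hx)
  have hMY : ∀ y ∈ Xᶜ, ∃! e, e ∈ M ∧ foldMap b d e.2 = foldMap b d y :=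
    fun y hy => hMB _ (Finset.mem_image_of_mem _ hy)
  have hP : ∀ i, ∃ P : V × V, (P.1 = a i ∨ P.1 = c i) ∧ (P.2 = b i ∨ P.2 = d i) ∧
      (∀ e ∈ M, e.1 ≠ P.1) ∧ (∀ e ∈ M, e.2 ≠ P.2) := by
    intro i
    rcases h.exists_covered Prod.fst hMX i with ⟨-, h1⟩ | ⟨-, h1⟩ <;>
      rcases h.swap.exists_covered Prod.snd hMY i with ⟨-, h2⟩ | ⟨-, h2⟩
    · exact ⟨(c i, d i), by simp, by simp, h1, h2⟩
    · exact ⟨(c i, b i), by simp, by simp, h1, h2⟩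
    · exact ⟨(a i, d i), by simp, by simp, h1, h2⟩
    · exact ⟨(a i, b i), by simp, by simp, h1, h2⟩
  choose P hP1 hP2 hPM1 hPM2 using hP
  have hN : ∀ e, (e ∈ M ∨ ∃ i, e = P i) → e.1 ∈ X ∧ e.2 ∉ X ∧ G.Adj e.1 e.2 := by
    rintro e (he | ⟨i, rfl⟩)
    · have := hME he
      simp only [contractedEdges, Finset.mem_filter, Finset.mem_univ, true_and] at this
      exact ⟨this.1, (h.side _ _ this.2.1).1 this.1, this.2.1⟩
    · obtain ⟨h1, h2, h3, h4, h5, h6⟩ := h.square i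
      have hadj : G.Adj (P i).1 (P i).2 := by
        rcases hP1 i with h7 | h7 <;> rcases hP2 i with h8 | h8 <;> rw [h7, h8]
        exacts [h3, h6.symm, h4.symm, h5]
      have hx : (P i).1 ∈ X := by
        rcases hP1 i with h7 | h7 <;> rw [h7]
        exacts [h.mem i, h.mem_third i]
      exact ⟨hx, (h.side _ _ hadj).1 hx, hadj⟩
  obtain ⟨m, hm, hmN⟩ := exists_isMate_of_existsUnique _ hN
    (fun x hx => h.existsUnique_of_uncovered Prod.fst hMX P hP1 hPM1 hx)
    (fun y hy => h.swap.existsUnique_of_uncovered Prod.snd hMY P hP2 hPM2 (by simpa using hy))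
  refine ⟨m, hm, fun i => ?_⟩
  have h1 := hmN (P i) (Or.inr ⟨i, rfl⟩)
  have h2 := hm.invol (P i).1
  have h3 := hP1 i
  have h4 := hP2 i
  unfold HitsSquare
  grind

section Squares

variable {G : SimpleGraph V} {m : V → V} {a b c d : V}

theorem IsSquare4.rotate (h : IsSquare4 G a b c d) : IsSquare4 G b c d a :=
  ⟨h.2.1, h.1.symm, h.2.2.2.1, h.2.2.2.2.1, h.2.2.2.2.2, h.2.2.1⟩

theorem IsSquare4.reflect (h : IsSquare4 G a b c d) : IsSquare4 G b a d c :=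
  ⟨h.2.1, h.1, h.2.2.1.symm, h.2.2.2.2.2.symm, h.2.2.2.2.1.symm, h.2.2.2.1.symm⟩

theorem HitsSquare.rotate (h : HitsSquare m a b c d) : HitsSquare m b c d a := by
  unfold HitsSquare at *
  tauto

theorem IsMate.injective (hm : IsMate G m) : Function.Injective m :=
  Function.Involutive.injective hm.invol

theorem IsMate.eq_comm (hm : IsMate G m) {u v : V} : m u = v ↔ m v = u :=
  ⟨fun h => h ▸ hm.invol u, fun h => h ▸ hm.invol v⟩

theorem HitsSquare.reflect (hm : IsMate G m) (h : HitsSquare m a b c d) :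
    HitsSquare m b a d c := by
  rcases h with h | h | h | h
  · exact Or.inl (hm.eq_comm.1 h)
  · exact Or.inr (Or.inr (Or.inr (hm.eq_comm.1 h)))
  · exact Or.inr (Or.inr (Or.inl (hm.eq_comm.1 h)))
  · exact Or.inr (Or.inl (hm.eq_comm.1 h))

theorem hitsSquare_iff {X : Finset V} (hside : ∀ u v, G.Adj u v → (u ∈ X ↔ v ∉ X))
    (hm : IsMate G m) (h : IsSquare4 G a b c d) :
    HitsSquare m a b c d ↔ ∃ u ∈ ({a, b, c, d} : Finset V), m u ∈ ({a, b, c, d} : Finset V) := by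
  obtain ⟨h1, h2, h3, h4, h5, h6⟩ := h
  have e3 := hside _ _ h3
  have e4 := hside _ _ h4
  have e5 := hside _ _ h5
  have e6 := hside _ _ h6
  have hn : ∀ u w, (u ∈ X ↔ w ∈ X) → m u ≠ u ∧ m u ≠ w := by
    refine fun u w huw => ⟨(hm.adj u).ne', fun hu => ?_⟩
    have := hside _ _ (hm.adj u)
    rw [hu, huw] at this
    exact iff_not_self this
  have na := hn a c (by rw [e3, e4, not_not])
  have nb := hn b d (by rw [e4, e5, not_not])
  have nc := hn c a (by rw [e5, e6, not_not])
  have nd := hn d b (by rw [e6, e3, not_not])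
  simp only [Finset.mem_insert, Finset.mem_singleton, exists_eq_or_imp, exists_eq_left, na.1,
    na.2, nb.1, nb.2, nc.1, nc.2, nd.1, nd.2, false_or, or_false, HitsSquare,
    hm.eq_comm (u := a) (v := d), hm.eq_comm (u := b) (v := a), hm.eq_comm (u := c) (v := b),
    hm.eq_comm (u := d) (v := c)]
  clear * -
  tauto

/-- Swap the matching along the square `a, b, m b, m a`. -/
noncomputable def switchMate (m : V → V) (a b v : V) : V :=
  if v = a then b else if v = b then a else if v = m a then m b else if v = m b then m a else m v

theorem switchMate_comm {m : V → V} {a b : V} (hm : IsMate G m) (hab : a ≠ b) :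
    switchMate m a b = switchMate m b a := by
  ext v
  have := hm.injective.ne hab
  unfold switchMate
  grind

theorem IsMate.switch (hm : IsMate G m) (hab : G.Adj a b) (hmab : G.Adj (m a) (m b)) :
    IsMate G (switchMate m a b) := by
  have h1 := hab.ne
  have h2 := hmab.ne
  have h3 := hab.symm
  have h4 := hmab.symm
  have ia := hm.invol a
  have ib := hm.invol b
  refine ⟨fun v => ?_, fun v => ?_⟩
  · have := hm.adj v
    unfold switchMate
    grind
  · have := hm.invol v
    have := (hm.adj a).ne
    have := (hm.adj b).ne
    have := @hm.injective
    unfold switchMate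
    grind [Function.Injective]

variable [Fintype V]

theorem IsSquare4.adj_iff (hreg : ∀ v, (Finset.univ.filter (G.Adj v)).card = 3)
    (hm : IsMate G m) (h : IsSquare4 G a b c d) (hmiss : ¬ HitsSquare m a b c d) (u : V) :
    G.Adj a u ↔ u = b ∨ u = d ∨ u = m a := by
  obtain ⟨w, hwb, hwd, hw⟩ := SquareFamily.exists_third_nbr hreg h.2.1 h.2.2.1 h.2.2.2.2.2.symm
  have h1 := (hw (m a)).1 (hm.adj a)
  have h2 := hm.invol a
  unfold HitsSquare at hmiss
  rw [hw]
  grind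

theorem HitsSquare.switch_of_eq {X : Finset V} (hside : ∀ u v, G.Adj u v → (u ∈ X ↔ v ∉ X))
    (hreg : ∀ v, (Finset.univ.filter (G.Adj v)).card = 3)
    (hm : IsMate G m) (h : IsSquare4 G a b c d) (hmiss : ¬ HitsSquare m a b c d)
    (hmab : G.Adj (m a) (m b)) {g k : V} (h' : IsSquare4 G a (m a) g k) :
    HitsSquare (switchMate m a b) a (m a) g k := by
  have hm' := hm.switch h.2.2.1 hmab
  have ha := h.adj_iff hreg hm hmiss
  have hc := h.rotate.rotate.adj_iff hreg hm fun hh => hmiss hh.rotate.rotate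
  have hd := h.rotate.rotate.rotate.adj_iff hreg hm fun hh => hmiss hh.rotate
  have hak := (ha k).1 h'.2.2.2.2.2.symm
  have hkm := h'.2.1
  have e1 := hside _ _ h.2.2.1
  have e2 := hside _ _ h.2.2.2.1
  have e3 := hside _ _ h.2.2.2.2.1
  have e4 := hside _ _ (hm.adj b)
  have hab : switchMate m a b a = b := by simp [switchMate]
  rcases hak with rfl | rfl | hak
  · exact Or.inr (Or.inr (Or.inr (hm'.eq_comm.1 hab)))
  · have hg := (hd g).1 h'.2.2.2.2.1.symm
    have hg' := h'.2.2.2.1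
    have hga := h'.1
    rcases hg with rfl | rfl | rfl
    · exact absurd rfl hga
    · have := (hc _).1 hg'.symm
      have := hm.injective.ne h.1
      unfold HitsSquare at hmiss
      grind [hm.invol a]
    · refine Or.inr (Or.inr (Or.inl (hm'.eq_comm.1 ?_)))
      have h1 := h.2.1
      have h2 := h.2.2.2.2.2.ne
      unfold HitsSquare at hmiss
      have h3 : k ≠ m a := hkm.symm
      have h4 : k ≠ m b := by rintro rfl; tauto
      simp [switchMate, h1.symm, h2, h3, h4]
  · exact absurd hak.symm hkm

theorem HitsSquare.switch {X : Finset V} (hside : ∀ u v, G.Adj u v → (u ∈ X ↔ v ∉ X))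
    (hreg : ∀ v, (Finset.univ.filter (G.Adj v)).card = 3)
    (hm : IsMate G m) (h : IsSquare4 G a b c d) (hmiss : ¬ HitsSquare m a b c d)
    (hmab : G.Adj (m a) (m b)) {e f g k : V} (h' : IsSquare4 G e f g k)
    (hh : HitsSquare m e f g k) :
    HitsSquare (switchMate m a b) e f g k := by
  have hm' := hm.switch h.2.2.1 hmab
  have hmiss' : ¬ HitsSquare m b a d c := fun hh => hmiss (hh.reflect hm)
  have key : ∀ {e f g k : V}, IsSquare4 G e f g k → m e = f →
      HitsSquare (switchMate m a b) e f g k := by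
    rintro e f g k h' rfl
    by_cases hea : e = a
    · subst hea
      exact switch_of_eq hside hreg hm h hmiss hmab h'
    by_cases heb : e = b
    · subst heb
      rw [switchMate_comm hm h.2.2.1.ne]
      exact switch_of_eq hside hreg hm h.reflect hmiss' hmab.symm h'
    by_cases hema : e = m a
    · subst hema
      have h'' := h'.reflect
      rw [hm.invol] at h'' ⊢
      exact (switch_of_eq hside hreg hm h hmiss hmab h'').reflect hm'
    by_cases hemb : e = m b
    · subst hemb
      have h'' := h'.reflect
      rw [hm.invol] at h'' ⊢
      refine HitsSquare.reflect hm' ?_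
      rw [switchMate_comm hm h.2.2.1.ne]
      exact switch_of_eq hside hreg hm h.reflect hmiss' hmab.symm h''
    · left
      simp [switchMate, hea, heb, hema, hemb]
  rcases hh with hh | hh | hh | hh
  · exact key h' hh
  · exact (key h'.rotate hh).rotate.rotate.rotate
  · exact (key h'.rotate.rotate hh).rotate.rotate
  · exact (key h'.rotate.rotate.rotate hh).rotate

/-- A square missed by a perfect matching which shares a vertex with a different square has an
edge next to it along which the matching can be switched. -/
theorem adj_mate_of_corner (hreg : ∀ v, (Finset.univ.filter (G.Adj v)).card = 3)
    (hm : IsMate G m) (h : IsSquare4 G a b c d) (hmiss : ¬ HitsSquare m a b c d)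
    {f g k : V} (h' : IsSquare4 G a f g k)
    (hne : ({a, f, g, k} : Finset V) ≠ {a, b, c, d}) :
    G.Adj (m a) (m b) ∨ G.Adj (m d) (m a) := by
  have ha := h.adj_iff hreg hm hmiss
  have hb := h.rotate.adj_iff hreg hm fun hh => hmiss hh.rotate.rotate.rotate
  have hc := h.rotate.rotate.adj_iff hreg hm fun hh => hmiss hh.rotate.rotate
  have hd := h.rotate.rotate.rotate.adj_iff hreg hm fun hh => hmiss hh.rotate
  have hne' : ¬ (g = c ∧ (f = b ∧ k = d ∨ f = d ∧ k = b)) := by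
    rintro ⟨rfl, ⟨rfl, rfl⟩ | ⟨rfl, rfl⟩⟩
    · exact hne rfl
    · exact hne (by ext; simp; tauto)
  have hbd := hm.injective.ne h.2.1
  have hac := hm.injective.ne h.1
  obtain ⟨h1, h2, h3, h4, h5, h6⟩ := h'
  have hf := (ha f).1 h3
  have hk := (ha k).1 h6.symm
  have ia := hm.invol a
  have hmac : ¬ G.Adj (m a) c := by
    intro hh
    have := (hc _).1 hh.symm
    unfold HitsSquare at hmiss
    grind
  have hmab : ∀ u, G.Adj u g → u = m a → g = c → False := by
    rintro u hu rfl rfl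
    exact hmac hu
  have h7 : f = b → g = c ∨ g = m b := fun hfb => by
    have := (hb g).1 (hfb ▸ h4)
    grind
  have h8 : f = d → g = c ∨ g = m d := fun hfb => by
    have := (hd g).1 (hfb ▸ h4)
    grind
  have h9 : k = b → g = c ∨ g = m b := fun hfb => by
    have := (hb g).1 (hfb ▸ h5.symm)
    grind
  have h10 : k = d → g = c ∨ g = m d := fun hfb => by
    have := (hd g).1 (hfb ▸ h5.symm)
    grind
  have h11 := h4.symm
  have h12 := hmab _ h4
  have h13 := hmab _ h5.symm
  have h14 := h5.symm
  grind

end Squares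

/-- `D` is the vertex set of a `4`-cycle of `G`. -/
def IsSquareSet (G : SimpleGraph V) (D : Finset V) : Prop :=
  ∃ a b c d, IsSquare4 G a b c d ∧ D = {a, b, c, d}

theorem IsSquareSet.exists_corner {G : SimpleGraph V} {D : Finset V} (h : IsSquareSet G D) {u : V}
    (hu : u ∈ D) : ∃ b c d, IsSquare4 G u b c d ∧ D = {u, b, c, d} := by
  obtain ⟨a, b, c, d, h, rfl⟩ := h
  simp only [Finset.mem_insert, Finset.mem_singleton] at hu
  rcases hu with rfl | rfl | rfl | rfl
  · exact ⟨b, c, d, h, rfl⟩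
  · exact ⟨c, d, a, h.rotate, by ext; simp; tauto⟩
  · exact ⟨d, a, b, h.rotate.rotate, by ext; simp; tauto⟩
  · exact ⟨a, b, c, h.rotate.rotate.rotate, by ext; simp; tauto⟩

section

variable [Fintype V] {G : SimpleGraph V} {X : Finset V} {m : V → V}

theorem exists_isMate_switch (hside : ∀ u v, G.Adj u v → (u ∈ X ↔ v ∉ X))
    (hreg : ∀ v, (Finset.univ.filter (G.Adj v)).card = 3) (hm : IsMate G m)
    {D D' : Finset V} (hD : IsSquareSet G D) (hD' : IsSquareSet G D')
    (hmiss : ¬ ∃ u ∈ D, m u ∈ D) (hne : D' ≠ D) (hdisj : ¬ Disjoint D' D) :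
    ∃ m', IsMate G m' ∧ (∀ E, IsSquareSet G E → (∃ u ∈ E, m u ∈ E) → ∃ u ∈ E, m' u ∈ E) ∧
      ∃ u ∈ D, m' u ∈ D := by
  obtain ⟨a, ha', ha⟩ := Finset.not_disjoint_iff.1 hdisj
  obtain ⟨b, c, d, h, rfl⟩ := hD.exists_corner ha
  obtain ⟨f, g, k, h', rfl⟩ := hD'.exists_corner ha'
  rw [← hitsSquare_iff hside hm h] at hmiss
  have key : ∀ b c d, IsSquare4 G a b c d → ¬ HitsSquare m a b c d → G.Adj (m a) (m b) →
      ∃ m', IsMate G m' ∧ (∀ E, IsSquareSet G E → (∃ u ∈ E, m u ∈ E) → ∃ u ∈ E, m' u ∈ E) ∧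
        m' a = b := by
    intro b c d h hmiss hab
    have hm' := hm.switch h.2.2.1 hab
    refine ⟨_, hm', ?_, by simp [switchMate]⟩
    rintro E ⟨e, f, g, k, hE, rfl⟩ hit
    rw [← hitsSquare_iff hside hm hE] at hit
    rw [← hitsSquare_iff hside hm' hE]
    exact hit.switch hside hreg hm h hmiss hab hE
  rcases adj_mate_of_corner hreg hm h hmiss h' hne with hab | hab
  · obtain ⟨m', hm', hE, hab⟩ := key b c d h hmiss hab
    exact ⟨m', hm', hE, a, by simp, by simp [hab]⟩
  · obtain ⟨m', hm', hE, hab⟩ := key d c b h.rotate.rotate.rotate.reflect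
      (fun hh => hmiss (hh.reflect hm).rotate) hab.symm
    exact ⟨m', hm', hE, a, by simp, by simp [hab]⟩

theorem exists_isMate_hits_isolated (hside : ∀ u v, G.Adj u v → (u ∈ X ↔ v ∉ X))
    (hreg : ∀ v, (Finset.univ.filter (G.Adj v)).card = 3) :
    ∃ m, IsMate G m ∧ ∀ D, IsSquareSet G D →
      (∀ D', IsSquareSet G D' → ¬ Disjoint D' D → D' = D) → ∃ u ∈ D, m u ∈ D := by
  let ι := {D : Finset V // IsSquareSet G D ∧
    ∀ D', IsSquareSet G D' → ¬ Disjoint D' D → D' = D}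
  have hι : ∀ i : ι, ∃ a b c d, a ∈ X ∧ IsSquare4 G a b c d ∧ i.1 = {a, b, c, d} := by
    rintro ⟨D, ⟨a, b, c, d, h, hD⟩, -⟩
    by_cases ha : a ∈ X
    · exact ⟨a, b, c, d, ha, h, hD⟩
    · refine ⟨b, c, d, a, ?_, h.rotate, hD.trans (by ext; simp; tauto)⟩
      have := hside _ _ h.2.2.1
      tauto
  choose a b c d haX hsq hD using hι
  have hfam : SquareFamily G X a b c d := by
    refine ⟨hside, hsq, haX, ?_⟩
    intro i j hij u hu hu'
    refine hij (Subtype.ext (j.2.2 i.1 i.2.1 (Finset.not_disjoint_iff.2 ⟨u, ?_, ?_⟩)))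
    · rw [hD i]
      simpa using hu
    · rw [hD j]
      simpa using hu'
  obtain ⟨m, hm, hhit⟩ := hfam.exists_isMate hreg
  refine ⟨m, hm, fun D h1 h2 => ?_⟩
  have := (hitsSquare_iff hside hm (hsq ⟨D, h1, h2⟩)).1 (hhit ⟨D, h1, h2⟩)
  rwa [← hD] at this

/-- A `3`-regular bigraph has a perfect matching that contains an edge of each `4`-cycle. -/
theorem exists_isMate_hits (hside : ∀ u v, G.Adj u v → (u ∈ X ↔ v ∉ X))
    (hreg : ∀ v, (Finset.univ.filter (G.Adj v)).card = 3) :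
    ∃ m, IsMate G m ∧ ∀ a b c d, IsSquare4 G a b c d → HitsSquare m a b c d := by
  suffices h : ∃ m, IsMate G m ∧ ∀ D, IsSquareSet G D → ∃ u ∈ D, m u ∈ D by
    obtain ⟨m, hm, h⟩ := h
    exact ⟨m, hm, fun a b c d hsq =>
      (hitsSquare_iff hside hm hsq).2 (h _ ⟨a, b, c, d, hsq, rfl⟩)⟩
  obtain ⟨m, hm, hiso⟩ := exists_isMate_hits_isolated hside hreg
  induction hn : (Finset.univ.filter fun D => IsSquareSet G D ∧ ¬ ∃ u ∈ D, m u ∈ D).card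
    using Nat.strong_induction_on generalizing m with
  | _ n ih =>
    by_cases hall : ∀ D, IsSquareSet G D → ∃ u ∈ D, m u ∈ D
    · exact ⟨m, hm, hall⟩
    push Not at hall
    obtain ⟨D, hD, hmiss⟩ := hall
    have hmiss : ¬ ∃ u ∈ D, m u ∈ D := by simpa using hmiss
    have hD' : ∃ D', IsSquareSet G D' ∧ ¬ Disjoint D' D ∧ D' ≠ D := by
      by_contra hcon
      push Not at hcon
      exact hmiss (hiso D hD hcon)
    obtain ⟨D', hD', hdisj, hne⟩ := hD'
    obtain ⟨m', hm', hE, hhit⟩ := exists_isMate_switch hside hreg hm hD hD' hmiss hne hdisj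
    refine ih _ ?_ m' hm' (fun E h1 h2 => hE E h1 (hiso E h1 h2)) rfl
    rw [← hn]
    refine Finset.card_lt_card ⟨fun E h => ?_, fun h => ?_⟩
    · simp only [Finset.mem_filter, Finset.mem_univ, true_and] at h ⊢
      exact ⟨h.1, fun hh => h.2 (hE E h.1 hh)⟩
    · have := h (show D ∈ _ by simpa [hD] using hmiss)
      simp only [Finset.mem_filter, Finset.mem_univ, true_and] at this
      exact this.2 hhit

end

section TwoFactor

variable {F : SimpleGraph V}

/-- In a finite `2`-regular graph, every vertex is the start of a path covering exactly its
connected component. -/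
theorem exists_path_covering_component [Finite V]
    (hF : ∀ v, (F.neighborSet v).ncard = 2) (v : V) :
    ∃ w, ∃ p : F.Walk v w, p.IsPath ∧
      ∀ u, u ∈ p.support ↔ F.connectedComponentMk u = F.connectedComponentMk v := by
  have hcyc : F.IsCycles := fun v _ => hF v
  have hne : (F.neighborSet v).Nonempty := Set.nonempty_of_ncard_ne_zero (by rw [hF]; norm_num)
  obtain ⟨p, hp, hverts⟩ := hcyc.exists_cycle_toSubgraph_verts_eq_connectedComponentSupp
    (c := F.connectedComponentMk v) rfl hne
  cases p with
  | nil => exact absurd rfl hp.ne_nil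
  | cons h q =>
    rw [Walk.cons_isCycle_iff] at hp
    refine ⟨_, q.reverse, hp.1.reverse, fun u => ?_⟩
    have h1 : u ∈ (Walk.cons h q).toSubgraph.verts ↔ u ∈ (F.connectedComponentMk v).supp := by
      rw [hverts]
    rw [Walk.mem_verts_toSubgraph, ConnectedComponent.mem_supp_iff] at h1
    rw [← h1]
    simp only [Walk.support_reverse, List.mem_reverse, Walk.support_cons, List.mem_cons]
    refine ⟨Or.inr, ?_⟩
    rintro (rfl | hu)
    · exact q.end_mem_support
    · exact hu

/-- A component of a `2`-regular bigraph without `4`-cycles has at least three vertices on each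
side. -/
theorem three_le_card_side [Fintype V] {X : Finset V}
    (hside : ∀ u v, F.Adj u v → (u ∈ X ↔ v ∉ X))
    (hF : ∀ v, (F.neighborSet v).ncard = 2)
    (hsq : ∀ a b c d, ¬ IsSquare4 F a b c d) (Q : F.ConnectedComponent) :
    3 ≤ (X.filter fun x => F.connectedComponentMk x = Q).card := by
  have hother : ∀ v u, F.Adj v u → ∃ w, w ≠ u ∧ F.Adj v w := by
    intro v u _
    obtain ⟨p, q, hpq, hs⟩ := Set.ncard_eq_two.1 (hF v)
    have hp : F.Adj v p := by
      have : p ∈ F.neighborSet v := by simp [hs]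
      exact this
    have hq : F.Adj v q := by
      have : q ∈ F.neighborSet v := by simp [hs]
      exact this
    by_cases hpu : p = u
    · exact ⟨q, hpu ▸ hpq.symm, hq⟩
    · exact ⟨p, hpu, hp⟩
  have hstart : ∃ x ∈ X, F.connectedComponentMk x = Q := by
    induction Q using ConnectedComponent.ind with
    | _ v =>
      by_cases hv : v ∈ X
      · exact ⟨v, hv, rfl⟩
      · obtain ⟨w, hw⟩ := Set.nonempty_of_ncard_ne_zero (s := F.neighborSet v)
          (by rw [hF]; norm_num)
        have := hside _ _ hw
        exact ⟨w, by tauto, ConnectedComponent.sound hw.symm.reachable⟩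
  obtain ⟨x, hx, hxQ⟩ := hstart
  obtain ⟨y₁, y₂, hy, hs⟩ := Set.ncard_eq_two.1 (hF x)
  have h1 : F.Adj x y₁ := by
    have : y₁ ∈ F.neighborSet x := by simp [hs]
    exact this
  have h2 : F.Adj x y₂ := by
    have : y₂ ∈ F.neighborSet x := by simp [hs]
    exact this
  obtain ⟨x₁, hx₁, ha₁⟩ := hother y₁ x h1.symm
  obtain ⟨x₂, hx₂, ha₂⟩ := hother y₂ x h2.symm
  have hne : x₁ ≠ x₂ := by
    rintro rfl
    exact hsq x y₁ x₁ y₂ ⟨hx₁.symm, hy, h1, ha₁, ha₂.symm, h2.symm⟩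
  rw [← show ({x, x₁, x₂} : Finset V).card = 3 from
    Finset.card_eq_three.2 ⟨x, x₁, x₂, hx₁.symm, hx₂.symm, hne, rfl⟩]
  refine Finset.card_le_card fun u hu => ?_
  have s1 := hside _ _ h1
  have s2 := hside _ _ h2
  have s3 := hside _ _ ha₁
  have s4 := hside _ _ ha₂
  simp only [Finset.mem_insert, Finset.mem_singleton] at hu
  rw [Finset.mem_filter, ← hxQ]
  rcases hu with rfl | rfl | rfl
  · exact ⟨hx, rfl⟩
  · exact ⟨by tauto, ConnectedComponent.sound (h1.reachable.trans ha₁.reachable).symm⟩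
  · exact ⟨by tauto, ConnectedComponent.sound (h2.reachable.trans ha₂.reachable).symm⟩

end TwoFactor

/-- Let `J` be a graph and `W` a nonempty finite set of vertices inducing a connected subgraph of
`J` with maximum degree at most `k`. Then `W` contains an independent set `I` with
`|W| ≤ k |I| + 1`. -/
theorem exists_indep_of_connected (J : SimpleGraph V) (W : Finset V) (hW : W.Nonempty) {k : ℕ}
    (hdeg : ∀ v ∈ W, (W.filter (J.Adj v)).card ≤ k)
    (hconn : ∀ T ⊆ W, T.Nonempty → T ≠ W → ∃ t ∈ T, ∃ w ∈ W, w ∉ T ∧ J.Adj t w) :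
    ∃ I ⊆ W, (∀ u ∈ I, ∀ v ∈ I, ¬ J.Adj u v) ∧ W.card ≤ k * I.card + 1 := by
  let N : Finset V → Finset V := fun I => I ∪ W.filter fun w => ∃ t ∈ I, J.Adj t w
  have hex : ∃ I, I ∈ W.powerset.filter fun I => I.Nonempty ∧ (∀ u ∈ I, ∀ v ∈ I, ¬ J.Adj u v) ∧
      (N I).card ≤ k * I.card + 1 := by
    obtain ⟨v, hv⟩ := hW
    refine ⟨{v}, ?_⟩
    simp only [Finset.mem_filter, Finset.mem_powerset, Finset.singleton_subset_iff]
    refine ⟨hv, Finset.singleton_nonempty v, by simp, ?_⟩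
    refine (Finset.card_union_le _ _).trans ?_
    have := hdeg v hv
    have h1 : (W.filter fun w => ∃ t ∈ ({v} : Finset V), J.Adj t w).card ≤
        (W.filter (J.Adj v)).card := Finset.card_le_card (by intro u; simp)
    rw [Finset.card_singleton]
    omega
  obtain ⟨I, hI, hmax⟩ := Finset.exists_max_image _ Finset.card hex
  simp only [Finset.mem_filter, Finset.mem_powerset] at hI hmax
  obtain ⟨hIW, hIne, hind, hcard⟩ := hI
  refine ⟨I, hIW, hind, ?_⟩
  have hNW : N I ⊆ W := Finset.union_subset hIW (Finset.filter_subset _ _)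
  by_cases hNe : N I = W
  · rwa [hNe] at hcard
  exfalso
  obtain ⟨t, ht, w, hw, hwN, htw⟩ := hconn (N I) hNW
    (hIne.mono Finset.subset_union_left) hNe
  have hwI : w ∉ I := fun h => hwN (Finset.mem_union_left _ h)
  have hwJ : ∀ s ∈ I, ¬ J.Adj s w := fun s hs hsw =>
    hwN (Finset.mem_union_right _ (Finset.mem_filter.2 ⟨hw, s, hs, hsw⟩))
  have hmax' := hmax (insert w I) ⟨Finset.insert_subset hw hIW, Finset.insert_nonempty _ _, ?_, ?_⟩
  · rw [Finset.card_insert_of_notMem hwI] at hmax'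
    omega
  · intro u hu v hv
    rcases Finset.mem_insert.1 hu with hu' | hu' <;> rcases Finset.mem_insert.1 hv with hv' | hv'
    · rw [hu', hv']
      exact J.loopless.irrefl _
    · rw [hu']
      exact fun h => hwJ v hv' h.symm
    · rw [hv']
      exact hwJ u hu'
    · exact hind u hu' v hv'
  · have hsub : N (insert w I) ⊆ insert w (N I ∪ (W.filter (J.Adj w)).erase t) := by
      intro v hv
      by_cases hvw : v = w
      · simp [hvw]
      by_cases hvN : v ∈ N I
      · simp [hvN]
      refine Finset.mem_insert_of_mem (Finset.mem_union_right _ ?_)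
      rw [Finset.mem_erase]
      refine ⟨fun h => hvN (by rwa [h]), ?_⟩
      have hvI : v ∉ I := fun h => hvN (Finset.mem_union_left _ h)
      rcases Finset.mem_union.1 hv with hv | hv
      · rcases Finset.mem_insert.1 hv with hv | hv
        exacts [absurd hv hvw, absurd hv hvI]
      · obtain ⟨hvW, s, hs, hsv⟩ := Finset.mem_filter.1 hv
        rcases Finset.mem_insert.1 hs with rfl | hs
        · exact Finset.mem_filter.2 ⟨hvW, hsv⟩
        · exact absurd (Finset.mem_union_right _ (Finset.mem_filter.2 ⟨hvW, s, hs, hsv⟩)) hvN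
    have h1 := Finset.card_le_card hsub
    have h2 := Finset.card_insert_le w (N I ∪ (W.filter (J.Adj w)).erase t)
    have h3 := Finset.card_union_le (N I) ((W.filter (J.Adj w)).erase t)
    have h4 := Finset.card_erase_of_mem (Finset.mem_filter.2 ⟨hNW ht, htw.symm⟩)
    have h5 := hdeg w hw
    have h6 : 0 < (W.filter (J.Adj w)).card :=
      Finset.card_pos.2 ⟨t, Finset.mem_filter.2 ⟨hNW ht, htw.symm⟩⟩
    rw [Finset.card_insert_of_notMem hwI, mul_add]
    omega

/-- Two vertices are adjacent in the common neighbor graph if they are distinct and have a common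
neighbor in `G`. -/
def commonNbrGraph (G : SimpleGraph V) : SimpleGraph V where
  Adj u v := u ≠ v ∧ ∃ y, G.Adj u y ∧ G.Adj v y
  symm := ⟨fun _ _ ⟨h, y, h1, h2⟩ => ⟨h.symm, y, h2, h1⟩⟩
  loopless := ⟨fun _ h => h.1 rfl⟩

theorem card_commonNbrGraph_le [Fintype V] {G : SimpleGraph V}
    (hreg : ∀ v, (Finset.univ.filter (G.Adj v)).card = 3) (W : Finset V) (v : V) :
    (W.filter ((commonNbrGraph G).Adj v)).card ≤ 6 := by
  have hsub : W.filter ((commonNbrGraph G).Adj v) ⊆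
      (Finset.univ.filter (G.Adj v)).biUnion fun y => (Finset.univ.filter (G.Adj y)).erase v := by
    intro u hu
    obtain ⟨-, hne, y, h1, h2⟩ := Finset.mem_filter.1 hu
    simp only [Finset.mem_biUnion, Finset.mem_filter, Finset.mem_univ, true_and, Finset.mem_erase]
    exact ⟨y, h1, hne.symm, h2.symm⟩
  refine (Finset.card_le_card hsub).trans ?_
  refine (Finset.card_biUnion_le_card_mul _ _ 2 fun y hy => ?_).trans (by rw [hreg])
  have hvy : v ∈ Finset.univ.filter (G.Adj y) := by
    simpa using (Finset.mem_filter.1 hy).2.symm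
  rw [Finset.card_erase_of_mem hvy, hreg]

/-- The graph on the components of `F` in which two components are adjacent if they are joined by
an edge of `G`. -/
def linkGraph (G F : SimpleGraph V) : SimpleGraph F.ConnectedComponent where
  Adj Q R := Q ≠ R ∧ ∃ u v, F.connectedComponentMk u = Q ∧ F.connectedComponentMk v = R ∧ G.Adj u v
  symm := ⟨fun _ _ ⟨h, u, v, hu, hv, huv⟩ => ⟨h.symm, v, u, hv, hu, huv.symm⟩⟩
  loopless := ⟨fun _ h => h.1 rfl⟩

/-- `F` is a `2`-factor of the `3`-regular bigraph `G` that contains no `4`-cycle. -/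
structure IsSquareFreeTwoFactor (G F : SimpleGraph V) (X : Finset V) : Prop where
  side : ∀ u v, G.Adj u v → (u ∈ X ↔ v ∉ X)
  le : F ≤ G
  ncard : ∀ v, (F.neighborSet v).ncard = 2
  not_square : ∀ a b c d, ¬ IsSquare4 F a b c d
  adj_or : ∀ y x x', x ≠ x' → G.Adj y x → G.Adj y x' → F.Adj y x ∨ F.Adj y x'

namespace IsSquareFreeTwoFactor

variable {G F : SimpleGraph V} {X : Finset V}

theorem exists_adj (h : IsSquareFreeTwoFactor G F X) (v : V) : ∃ w, F.Adj v w :=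
  Set.nonempty_of_ncard_ne_zero (s := F.neighborSet v) (by rw [h.ncard]; norm_num)

variable {ι : Type*} {K : SimpleGraph ι}

/-- The vertices of `X` on the cycles of `F` indexed by a component of `K`. -/
noncomputable def sideOf (X : Finset V) (e : K ↪g linkGraph G F) (D : K.ConnectedComponent) :
    Finset V :=
  X.filter fun x => ∃ i, K.connectedComponentMk i = D ∧ F.connectedComponentMk x = e i

theorem mem_sideOf {e : K ↪g linkGraph G F} {D : K.ConnectedComponent} {x : V} :
    x ∈ sideOf X e D ↔
      x ∈ X ∧ ∃ i, K.connectedComponentMk i = D ∧ F.connectedComponentMk x = e i := by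
  simp [sideOf]

theorem sideOf_connected (h : IsSquareFreeTwoFactor G F X) (e : K ↪g linkGraph G F)
    (D : K.ConnectedComponent) (T : Finset V) (hT : T ⊆ sideOf X e D) (hne : T.Nonempty)
    (hTD : T ≠ sideOf X e D) :
    ∃ t ∈ T, ∃ w ∈ sideOf X e D, w ∉ T ∧ (commonNbrGraph G).Adj t w := by
  by_contra hcon
  push Not at hcon
  have hcl : ∀ t ∈ T, ∀ w ∈ sideOf X e D, ∀ y, G.Adj t y → G.Adj w y → w ∈ T := by
    intro t ht w hw y h1 h2
    by_contra hwT
    exact hcon t ht w hw hwT ⟨fun h => hwT (h ▸ ht), y, h1, h2⟩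
  have hTX : ∀ t ∈ T, t ∈ X := fun t ht => (mem_sideOf.1 (hT ht)).1
  have hcomp : ∀ t ∈ T, ∀ x ∈ X, F.connectedComponentMk x = F.connectedComponentMk t →
      x ∈ T := by
    intro t ht
    have key : ∀ v, F.Reachable t v →
        F.connectedComponentMk v = F.connectedComponentMk t ∧
          (v ∈ X → v ∈ T) ∧ (v ∉ X → ∃ s ∈ T, F.Adj v s) := by
      intro v hv
      rw [reachable_iff_reflTransGen] at hv
      induction hv with
      | refl => exact ⟨rfl, fun _ => ht, fun hh => absurd (hTX t ht) hh⟩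
      | @tail v w _ hvw ih =>
        obtain ⟨ih1, ih2, ih3⟩ := ih
        have hw : F.connectedComponentMk w = F.connectedComponentMk t :=
          (ConnectedComponent.sound hvw.symm.reachable).trans ih1
        have hs := h.side _ _ (h.le hvw)
        refine ⟨hw, fun hwX => ?_, fun hwX => ⟨v, ih2 (by tauto), hvw.symm⟩⟩
        obtain ⟨s, hs, hvs⟩ := ih3 (by tauto)
        refine hcl s hs w ?_ v (h.le hvs.symm) (h.le hvw.symm)
        obtain ⟨-, i, hi, hti⟩ := mem_sideOf.1 (hT ht)
        exact mem_sideOf.2 ⟨hwX, i, hi, hw.trans hti⟩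
    intro x hx hxt
    exact (key x (ConnectedComponent.exact hxt).symm).2.1 hx
  have hstep : ∀ i j, K.connectedComponentMk i = D → K.Adj i j →
      (∃ t ∈ T, F.connectedComponentMk t = e i) → ∃ t ∈ T, F.connectedComponentMk t = e j := by
    rintro i j hi hij ⟨t, ht, hti⟩
    have hj : K.connectedComponentMk j = D :=
      (ConnectedComponent.sound hij.symm.reachable).trans hi
    obtain ⟨-, u, v, hu, hv, huv⟩ := e.map_adj_iff.2 hij
    have hs := h.side _ _ huv
    by_cases huX : u ∈ X
    · obtain ⟨x, hx⟩ := h.exists_adj v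
      have hs' := h.side _ _ (h.le hx)
      have hxj : F.connectedComponentMk x = e j :=
        (ConnectedComponent.sound hx.symm.reachable).trans hv
      exact ⟨x, hcl u (hcomp t ht u huX (hu.trans hti.symm)) x
        (mem_sideOf.2 ⟨by tauto, j, hj, hxj⟩) v huv (h.le hx.symm), hxj⟩
    · obtain ⟨x, hx⟩ := h.exists_adj u
      have hs' := h.side _ _ (h.le hx)
      have hxi : F.connectedComponentMk x = F.connectedComponentMk t :=
        (ConnectedComponent.sound hx.symm.reachable).trans (hu.trans hti.symm)
      exact ⟨v, hcl x (hcomp t ht x (by tauto) hxi) v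
        (mem_sideOf.2 ⟨by tauto, j, hj, hv⟩) u (h.le hx.symm) huv.symm, hv⟩
  obtain ⟨t, ht⟩ := hne
  obtain ⟨-, i, hi, hti⟩ := mem_sideOf.1 (hT ht)
  have hall : ∀ j, K.Reachable i j →
      K.connectedComponentMk j = D ∧ ∃ t ∈ T, F.connectedComponentMk t = e j := by
    intro j hj
    rw [reachable_iff_reflTransGen] at hj
    induction hj with
    | refl => exact ⟨hi, t, ht, hti⟩
    | tail _ hvw ih =>
      exact ⟨(ConnectedComponent.sound hvw.symm.reachable).trans ih.1, hstep _ _ ih.1 hvw ih.2⟩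
  refine hTD (Finset.Subset.antisymm hT fun x hx => ?_)
  obtain ⟨hxX, j, hj, hxj⟩ := mem_sideOf.1 hx
  obtain ⟨-, s, hs, hsj⟩ := hall j (ConnectedComponent.exact (hi.trans hj.symm))
  exact hcomp s hs x hxX (hxj.trans hsj.symm)

theorem three_mul_le_card_sideOf [Fintype V] [Fintype ι] (h : IsSquareFreeTwoFactor G F X)
    (e : K ↪g linkGraph G F) (D : K.ConnectedComponent) :
    3 * (Finset.univ.filter fun i => K.connectedComponentMk i = D).card ≤ (sideOf X e D).card := by
  have hsub : ((Finset.univ.filter fun i => K.connectedComponentMk i = D).biUnion fun i =>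
      X.filter fun x => F.connectedComponentMk x = e i) ⊆ sideOf X e D := by
    intro x hx
    simp only [Finset.mem_biUnion, Finset.mem_filter, Finset.mem_univ, true_and] at hx
    obtain ⟨i, hi, hx, hxi⟩ := hx
    exact mem_sideOf.2 ⟨hx, i, hi, hxi⟩
  refine le_trans ?_ (Finset.card_le_card hsub)
  rw [Finset.card_biUnion, mul_comm]
  · exact Finset.card_nsmul_le_sum _ _ _ fun i _ =>
      three_le_card_side (fun u v huv => h.side u v (h.le huv)) h.ncard h.not_square _
  · intro i _ j _ hij
    refine Finset.disjoint_left.2 fun x hx hx' => hij (e.injective ?_)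
    exact (Finset.mem_filter.1 hx).2.symm.trans (Finset.mem_filter.1 hx').2

theorem exists_indep_sideOf [Fintype V] [Fintype ι] (h : IsSquareFreeTwoFactor G F X)
    (hreg : ∀ v, (Finset.univ.filter (G.Adj v)).card = 3)
    (e : K ↪g linkGraph G F) (D : K.ConnectedComponent) :
    ∃ I ⊆ sideOf X e D, (∀ u ∈ I, ∀ v ∈ I, ¬ (commonNbrGraph G).Adj u v) ∧
      D.supp.ncard + (if Odd D.supp.ncard then 1 else 0) ≤ 2 * I.card := by
  have hD : D.supp.ncard = (Finset.univ.filter fun i => K.connectedComponentMk i = D).card := by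
    rw [← Set.ncard_coe_finset]
    congr 1
    ext i
    simp
  have hpos : 0 < D.supp.ncard := by
    rw [Set.ncard_pos]
    exact D.nonempty_supp
  have h3 := h.three_mul_le_card_sideOf e D
  rw [← hD] at h3
  obtain ⟨I, hI, hind, hcard⟩ := exists_indep_of_connected (commonNbrGraph G) (sideOf X e D)
    (Finset.card_pos.1 (by omega)) (fun v _ => card_commonNbrGraph_le hreg _ v)
    (h.sideOf_connected e D)
  refine ⟨I, hI, hind, ?_⟩
  split_ifs with hodd
  · obtain ⟨s, hs⟩ := hodd
    omega
  · obtain ⟨s, hs⟩ := Nat.not_odd_iff_even.1 hodd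
    omega

/-- The number of vertices plus the number of odd components of an induced subgraph of the link
graph is at most `2 * alphaLam G X Y`. -/
theorem card_add_oddComponents_le [Fintype V] [Fintype ι] (h : IsSquareFreeTwoFactor G F X)
    (hreg : ∀ v, (Finset.univ.filter (G.Adj v)).card = 3) (Y : Finset V)
    (e : K ↪g linkGraph G F) :
    Fintype.card ι + K.oddComponents.ncard ≤ 2 * alphaLam G X Y := by
  choose I hI hind hcard using h.exists_indep_sideOf hreg e
  have hsame : ∀ D D' x x', x ∈ I D → x' ∈ I D' →
      F.connectedComponentMk x = F.connectedComponentMk x' → D = D' := by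
    intro D D' x x' hx hx' hxx
    obtain ⟨-, i, hi, hxi⟩ := mem_sideOf.1 (hI D hx)
    obtain ⟨-, j, hj, hxj⟩ := mem_sideOf.1 (hI D' hx')
    have : i = j := e.injective (by rw [← hxi, ← hxj, hxx])
    rw [← hi, ← hj, this]
  have hnear : ∀ D D' x x' y, x ∈ I D → x' ∈ I D' → F.Adj y x → G.Adj y x' → D = D' := by
    intro D D' x x' y hx hx' h1 h2
    have hyx : F.connectedComponentMk y = F.connectedComponentMk x :=
      ConnectedComponent.sound h1.reachable
    by_cases hxx : F.connectedComponentMk x = F.connectedComponentMk x'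
    · exact hsame D D' x x' hx hx' hxx
    obtain ⟨-, i, hi, hxi⟩ := mem_sideOf.1 (hI D hx)
    obtain ⟨-, j, hj, hxj⟩ := mem_sideOf.1 (hI D' hx')
    have hadj : (linkGraph G F).Adj (e i) (e j) :=
      ⟨by rwa [← hxi, ← hxj], y, x', hyx.trans hxi, hxj, h2⟩
    rw [← hi, ← hj]
    exact ConnectedComponent.sound (e.map_adj_iff.1 hadj).reachable
  have halpha : (Finset.univ.biUnion I).card ≤ alphaLam G X Y := by
    refine Finset.le_sup (f := Finset.card) (Finset.mem_filter.2 ⟨?_, ?_⟩)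
    · rw [Finset.mem_powerset]
      intro x hx
      obtain ⟨D, -, hx⟩ := Finset.mem_biUnion.1 hx
      exact (mem_sideOf.1 (hI D hx)).1
    · refine Finset.filter_eq_empty_iff.2 fun y _ hy => ?_
      obtain ⟨x, hx, x', hx', hne⟩ := Finset.one_lt_card.1 hy
      simp only [Finset.mem_filter, Finset.mem_biUnion, Finset.mem_univ, true_and] at hx hx'
      obtain ⟨⟨D, hxD⟩, hyx⟩ := hx
      obtain ⟨⟨D', hxD'⟩, hyx'⟩ := hx'
      have hDD : D = D' := by
        rcases h.adj_or y x x' hne hyx hyx' with hF | hF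
        · exact hnear D D' x x' y hxD hxD' hF hyx'
        · exact (hnear D' D x' x y hxD' hxD hF hyx).symm
      subst hDD
      exact hind D x hxD x' hxD' ⟨hne, y, hyx.symm, hyx'.symm⟩
  rw [Finset.card_biUnion fun D _ D' _ hne => Finset.disjoint_left.2 fun x hx hx' =>
    hne (hsame D D' x x hx hx' rfl)] at halpha
  have hsum := Finset.sum_le_sum fun D (_ : D ∈ Finset.univ) => hcard D
  rw [Finset.sum_add_distrib, ← Finset.mul_sum] at hsum
  have hodd : K.oddComponents.ncard =
      ∑ D : K.ConnectedComponent, if Odd D.supp.ncard then 1 else 0 := by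
    rw [Finset.sum_boole, Nat.cast_id, ← Set.ncard_coe_finset]
    congr 1
    ext D
    simp [oddComponents]
  have htot : Fintype.card ι = ∑ D : K.ConnectedComponent, D.supp.ncard := by
    rw [← Finset.card_univ, Finset.card_eq_sum_card_fiberwise (f := K.connectedComponentMk)
      (t := Finset.univ) (by simp)]
    refine Finset.sum_congr rfl fun D _ => ?_
    rw [← Set.ncard_coe_finset]
    congr 1
    ext i
    simp
  omega

end IsSquareFreeTwoFactor

/-- The graph obtained from `H` by adding `d` vertices adjacent to everything. -/
def addUniversal {Q : Type*} (H : SimpleGraph Q) (d : ℕ) : SimpleGraph (Q ⊕ Fin d) where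
  Adj x y := x ≠ y ∧ ∀ q q', x = Sum.inl q → y = Sum.inl q' → H.Adj q q'
  symm := ⟨fun _ _ ⟨h, h'⟩ => ⟨h.symm, fun q q' hq hq' => (h' q' q hq' hq).symm⟩⟩
  loopless := ⟨fun _ h => h.1 rfl⟩

theorem addUniversal_adj_inl {Q : Type*} {H : SimpleGraph Q} {d : ℕ} {q q' : Q} :
    (addUniversal H d).Adj (Sum.inl q) (Sum.inl q') ↔ H.Adj q q' := by
  constructor
  · exact fun h => h.2 q q' rfl rfl
  · refine fun h => ⟨fun hq => h.ne (Sum.inl_injective hq), ?_⟩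
    rintro _ _ ⟨⟩ ⟨⟩
    exact h

/-- If every graph `K` embedding into `H` satisfies `|K| + odd(K) ≤ 2 * a`, where `odd(K)` is the
number of odd components of `K`, then the vertices of `H`, together with some additional points, can be paired off into `a` pairs in such a way that all
pairs of two vertices of `H` are edges. -/
theorem exists_pairing.{u} {Q : Type u} [Fintype Q] (H : SimpleGraph Q) (a : ℕ)
    (hodd : ∀ (ι : Type u) [Fintype ι] (K : SimpleGraph ι), (K ↪g H) →
      Fintype.card ι + K.oddComponents.ncard ≤ 2 * a) :
    ∃ (d : ℕ) (μ : Q ⊕ Fin d → Q ⊕ Fin d), Fintype.card Q + d = 2 * a ∧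
      (∀ i, μ i ≠ i) ∧ (∀ i, μ (μ i) = i) ∧
      ∀ q q', μ (Sum.inl q) = Sum.inl q' → H.Adj q q' := by
  have hk : Fintype.card Q ≤ 2 * a :=
    (Nat.le_add_right _ _).trans (hodd Q H (RelIso.refl _).toRelEmbedding)
  obtain ⟨d, hd⟩ := Nat.exists_eq_add_of_le hk
  have htutte : ∃ M : (addUniversal H d).Subgraph, M.IsPerfectMatching := by
    rw [SimpleGraph.tutte]
    intro u hu
    unfold IsTutteViolator at hu
    set K := ((⊤ : (addUniversal H d).Subgraph).deleteVerts u) with hK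
    have hverts : ∀ v, v ∈ K.verts ↔ v ∉ u := by simp [hK]
    have hadj : ∀ v w : K.verts, K.coe.Adj v w ↔ (addUniversal H d).Adj v w := by
      intro v w
      have hv := (hverts v).1 v.2
      have hw := (hverts w).1 w.2
      simp [hK, hv, hw]
    have hcard : Fintype.card K.verts + u.ncard = 2 * a := by
      have h1 : K.verts = uᶜ := by
        ext v
        exact hverts v
      have h2 := Set.ncard_add_ncard_compl u
      rw [← h1, Nat.card_eq_fintype_card, Fintype.card_sum, Fintype.card_fin, ← hd] at h2
      rw [← Nat.card_eq_fintype_card, Nat.card_coe_set_eq]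
      omega
    by_cases hz : ∃ z : Fin d, Sum.inr z ∉ u
    · obtain ⟨z, hz⟩ := hz
      let z' : K.verts := ⟨Sum.inr z, (hverts _).2 hz⟩
      have hreach : ∀ v, K.coe.Reachable v z' := by
        intro v
        by_cases hv : v = z'
        · rw [hv]
        · refine Adj.reachable ((hadj _ _).2 ⟨fun h => hv (Subtype.ext h), ?_⟩)
          rintro q q' - ⟨⟩
      have hsub : K.coe.oddComponents.ncard ≤ 1 := by
        refine (Set.ncard_le_one_iff (Set.toFinite _)).2 fun {c c'} _ _ => ?_
        induction c using ConnectedComponent.ind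
        induction c' using ConnectedComponent.ind
        exact ConnectedComponent.sound ((hreach _).trans (hreach _).symm)
      have h1 : K.coe.oddComponents.ncard = 1 := by omega
      have h2 := (odd_ncard_oddComponents (G := K.coe)).1 (by rw [h1]; exact odd_one)
      rw [Nat.card_eq_fintype_card] at h2
      obtain ⟨s, hs⟩ := h2
      omega
    · push Not at hz
      have hex : ∀ v : K.verts, ∃ q, v.1 = Sum.inl q := by
        rintro ⟨q | z, hv⟩
        · exact ⟨q, rfl⟩
        · exact absurd (hz z) ((hverts _).1 hv)
      choose f hf using hex
      have hinj : Function.Injective f := fun v w hvw => Subtype.ext (by rw [hf, hf, hvw])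
      have h1 := hodd K.verts K.coe
        ⟨⟨f, hinj⟩, fun {v w} => by
          rw [hadj, hf, hf, addUniversal_adj_inl]
          rfl⟩
      omega
  obtain ⟨M, hM⟩ := htutte
  rw [Subgraph.isPerfectMatching_iff] at hM
  choose μ hμ huniq using hM
  refine ⟨d, μ, hd.symm, fun i => (hμ i).adj_sub.ne', fun i => ?_, fun q q' hq => ?_⟩
  · exact (huniq _ i (hμ i).symm).symm
  · have := (hμ (Sum.inl q)).adj_sub
    rw [hq] at this
    exact addUniversal_adj_inl.1 this

theorem exists_paths_of_disjoint_blocks (G : SimpleGraph V) (𝓑 : Finset (Finset V))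
    (hdisj : ∀ B ∈ 𝓑, ∀ B' ∈ 𝓑, ∀ v, v ∈ B → v ∈ B' → B = B')
    (hpath : ∀ B ∈ 𝓑, ∃ u v, ∃ p : G.Walk u v, p.IsPath ∧ ∀ w, w ∈ p.support ↔ w ∈ B) :
    ∃ P : List (Σ u : V, Σ v : V, G.Walk u v), (∀ p ∈ P, p.2.2.IsPath) ∧
      P.Pairwise (fun p q => ∀ w : V, w ∈ p.2.2.support → w ∉ q.2.2.support) ∧
      (∀ B ∈ 𝓑, ∀ w ∈ B, ∃ p ∈ P, w ∈ p.2.2.support) ∧ P.length = 𝓑.card := by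
  choose! u v p hp hsupp using fun B : 𝓑 => hpath B.1 B.2
  refine ⟨𝓑.attach.toList.map fun B => ⟨u B, v B, p B⟩, ?_, ?_, ?_, by simp⟩
  · intro q hq
    obtain ⟨B, -, rfl⟩ := List.mem_map.1 hq
    exact hp B
  · rw [List.pairwise_map]
    refine (Finset.nodup_toList _).imp fun {B B'} hne w hw hw' => hne (Subtype.ext ?_)
    exact hdisj B B.2 B' B'.2 w ((hsupp B w).1 hw) ((hsupp B' w).1 hw')
  · intro B hB w hw
    exact ⟨_, List.mem_map.2 ⟨⟨B, hB⟩, by simp, rfl⟩, (hsupp ⟨B, hB⟩ w).2 hw⟩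

theorem IsMate.isSquareFreeTwoFactor [Fintype V] {G : SimpleGraph V} {X : Finset V} {m : V → V}
    (hside : ∀ u v, G.Adj u v → (u ∈ X ↔ v ∉ X))
    (hreg : ∀ v, (Finset.univ.filter (G.Adj v)).card = 3) (hm : IsMate G m)
    (hsq : ∀ a b c d, IsSquare4 G a b c d → HitsSquare m a b c d) :
    ∃ F, IsSquareFreeTwoFactor G F X := by
  let F : SimpleGraph V :=
    { Adj := fun u v => G.Adj u v ∧ m u ≠ v
      symm := ⟨fun u v ⟨h1, h2⟩ => ⟨h1.symm, fun h => h2 (hm.eq_comm.1 h)⟩⟩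
      loopless := ⟨fun v h => h.1.ne rfl⟩ }
  refine ⟨F, hside, fun u v h => h.1, fun v => ?_, ?_, ?_⟩
  · have h1 : F.neighborSet v = ((Finset.univ.filter (G.Adj v)).erase (m v) : Finset V) := by
      ext w
      simp only [mem_neighborSet, Finset.coe_erase, Set.mem_sdiff, Finset.mem_coe,
        Finset.mem_filter, Finset.mem_univ, true_and, Set.mem_singleton_iff, F]
      exact and_congr_right fun _ => ne_comm
    rw [h1, Set.ncard_coe_finset, Finset.card_erase_of_mem (by simpa using hm.adj v), hreg]
  · rintro a b c d ⟨h1, h2, h3, h4, h5, h6⟩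
    rcases hsq a b c d ⟨h1, h2, h3.1, h4.1, h5.1, h6.1⟩ with h | h | h | h
    exacts [h3.2 h, h4.2 h, h5.2 h, h6.2 h]
  · intro y x x' hne h1 h2
    by_cases hx : m y = x
    · exact Or.inr ⟨h2, fun h => hne (hx.symm.trans h)⟩
    · exact Or.inl ⟨h1, hx⟩

namespace IsSquareFreeTwoFactor

variable [Fintype V] {G F : SimpleGraph V} {X : Finset V}

theorem exists_path (h : IsSquareFreeTwoFactor G F X) (v : V) :
    ∃ w, ∃ p : G.Walk v w, p.IsPath ∧
      ∀ u, u ∈ p.support ↔ F.connectedComponentMk u = F.connectedComponentMk v := by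
  obtain ⟨w, p, hp, hs⟩ := exists_path_covering_component h.ncard v
  exact ⟨w, p.mapLe h.le, hp.mapLe h.le, fun u => by simp [hs]⟩

theorem exists_path_of_link (h : IsSquareFreeTwoFactor G F X) {Q R : F.ConnectedComponent}
    (hQR : (linkGraph G F).Adj Q R) :
    ∃ u v, ∃ p : G.Walk u v, p.IsPath ∧
      ∀ w, w ∈ p.support ↔ F.connectedComponentMk w = Q ∨ F.connectedComponentMk w = R := by
  obtain ⟨hne, u, v, rfl, rfl, huv⟩ := hQR
  obtain ⟨u', p, hp, hps⟩ := h.exists_path u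
  obtain ⟨v', q, hq, hqs⟩ := h.exists_path v
  have hsupp : (p.reverse.append (Walk.cons huv q)).support = p.support.reverse ++ q.support := by
    rw [Walk.support_append, Walk.support_reverse, Walk.support_cons, List.tail_cons]
  refine ⟨u', v', p.reverse.append (Walk.cons huv q), ?_, fun w => ?_⟩
  · rw [Walk.isPath_def, hsupp, List.nodup_append]
    refine ⟨List.nodup_reverse.2 hp.support_nodup, hq.support_nodup, ?_⟩
    rintro a ha b hb rfl
    rw [List.mem_reverse, hps] at ha
    exact hne (ha.symm.trans ((hqs a).1 hb))
  · rw [hsupp, List.mem_append, List.mem_reverse, hps, hqs]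

theorem exists_path_cover (h : IsSquareFreeTwoFactor G F X)
    (hreg : ∀ v, (Finset.univ.filter (G.Adj v)).card = 3) (Y : Finset V) :
    ∃ P : List (Σ u : V, Σ v : V, G.Walk u v),
      IsPathXCover G X P ∧ P.length ≤ alphaLam G X Y := by
  obtain ⟨d, μ, hd, hne, hinv, hadj⟩ := exists_pairing (linkGraph G F) (alphaLam G X Y)
    fun ι _ K e => h.card_add_oddComponents_le hreg Y e
  let block : F.ConnectedComponent ⊕ Fin d → Finset V := fun i =>
    Finset.univ.filter fun v => Sum.inl (F.connectedComponentMk v) = i ∨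
      Sum.inl (F.connectedComponentMk v) = μ i
  have hmem : ∀ i v, v ∈ block i ↔ Sum.inl (F.connectedComponentMk v) = i ∨
      Sum.inl (F.connectedComponentMk v) = μ i := fun i v => by simp [block]
  have hμ : ∀ i, block (μ i) = block i := by
    intro i
    ext v
    rw [hmem, hmem, hinv, or_comm]
  have hblock : ∀ i v, v ∈ block i → block i = block (Sum.inl (F.connectedComponentMk v)) := by
    intro i v hv
    rcases (hmem i v).1 hv with h | h <;> rw [h]
    exact (hμ i).symm
  let 𝓑 : Finset (Finset V) := Finset.univ.image fun Q => block (Sum.inl Q)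
  have hpath : ∀ B ∈ 𝓑, ∃ u v, ∃ p : G.Walk u v, p.IsPath ∧ ∀ w, w ∈ p.support ↔ w ∈ B := by
    intro B hB
    obtain ⟨Q, -, rfl⟩ := Finset.mem_image.1 hB
    simp only [hmem, Sum.inl.injEq]
    rcases hQ : μ (Sum.inl Q) with R | z
    · simpa using h.exists_path_of_link (hadj Q R hQ)
    · induction Q using ConnectedComponent.ind with
      | _ v =>
        obtain ⟨w, p, hp, hs⟩ := h.exists_path v
        exact ⟨v, w, p, hp, by simpa using hs⟩
  obtain ⟨P, hP, hPP, hcov, hlen⟩ := exists_paths_of_disjoint_blocks G 𝓑 (by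
    intro B hB B' hB' v hv hv'
    obtain ⟨Q, -, rfl⟩ := Finset.mem_image.1 hB
    obtain ⟨Q', -, rfl⟩ := Finset.mem_image.1 hB'
    rw [hblock _ v hv, hblock _ v hv']) hpath
  refine ⟨P, ⟨hP, hPP, fun x _ => hcov (block (Sum.inl (F.connectedComponentMk x))) ?_ x ?_⟩, ?_⟩
  · exact Finset.mem_image_of_mem _ (Finset.mem_univ _)
  · simp [hmem]
  · have h1 : 𝓑.card * 2 ≤
        (Finset.univ : Finset (F.ConnectedComponent ⊕ Fin d)).card := by
      refine (Finset.card_nsmul_le_sum 𝓑 (fun B => (Finset.univ.filter (block · = B)).card) 2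
        fun B hB => ?_).trans ?_
      · obtain ⟨Q, -, rfl⟩ := Finset.mem_image.1 hB
        exact Finset.one_lt_card.2 ⟨Sum.inl Q, by simp, μ (Sum.inl Q), by simp [hμ],
          (hne _).symm⟩
      · rw [← Finset.card_biUnion]
        · exact Finset.card_le_card (Finset.subset_univ _)
        · intro B _ B' _ hBB
          refine Finset.disjoint_left.2 fun i hi hi' => hBB ?_
          exact (Finset.mem_filter.1 hi).2.symm.trans (Finset.mem_filter.1 hi').2
    rw [Finset.card_univ, Fintype.card_sum, Fintype.card_fin, hd] at h1
    omega

end IsSquareFreeTwoFactor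

/-- If `G` is a `3`-regular `(X,Y)`-bigraph, then `G` has a
path `X`-cover of size at most `α_Λ(G)`. -/
theorem three_regular_path_cover {V : Type*} [Fintype V] (G : SimpleGraph V)
    [DecidableRel G.Adj] (X Y : Finset V) (hBG : IsBigraph G X Y)
    (hreg : ∀ v : V, G.degree v = 3) :
    ∃ P : List (Σ u : V, Σ v : V, G.Walk u v),
      IsPathXCover G X P ∧ P.length ≤ alphaLam G X Y := by
  obtain ⟨hdisj, -, hedge⟩ := hBG
  have hside : ∀ u v, G.Adj u v → (u ∈ X ↔ v ∉ X) := by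
    intro u v huv
    rcases hedge huv with ⟨hu, hv⟩ | ⟨hu, hv⟩
    · exact iff_of_true hu (Finset.disjoint_right.1 hdisj hv)
    · exact iff_of_false (Finset.disjoint_right.1 hdisj hu) (not_not.2 hv)
  have hreg' : ∀ v, (@Finset.filter V (G.Adj v) (fun _ => Classical.propDecidable _)
      Finset.univ).card = 3 := by
    intro v
    rw [← hreg v, ← card_neighborFinset_eq_degree, neighborFinset_eq_filter]
    convert rfl
  obtain ⟨m, hm, hsq⟩ := exists_isMate_hits hside hreg'
  obtain ⟨F, hF⟩ := hm.isSquareFreeTwoFactor hside hreg' hsq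
  exact hF.exists_path_cover hreg' Y
end

section
/- If G is an (X,Y)-bigraph with maximum degree at most 3, then G has a path X-cover consisting of at most def(G) paths. -/
open Finset SimpleGraph
open scoped Classical

variable {V : Type*}

/-- The number of occurrences of `v` on the members of a multiset of vertex lists. -/
noncomputable def occ (L : Multiset (List V)) (v : V) : ℕ := (L.map (List.count v)).sum

/-- A vertex list that follows edges of `G` and, unless it is a singleton, ends outside `Y`. -/
def IsTrail (G : SimpleGraph V) (Y : Finset V) (p : List V) : Prop :=
  p.IsChain G.Adj ∧ ∀ y ∈ p.getLast?, y ∈ Y → p = [y]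

/-- `L` is a family of disjoint paths, starting at the elements of `E`, whose vertices outside `Y`
are exactly the elements of `X`. -/
structure IsCov (G : SimpleGraph V) (Y X : Finset V) (E : Multiset V)
    (L : Multiset (List V)) : Prop where
  trail : ∀ p ∈ L, IsTrail G Y p
  le_one : ∀ v, occ L v ≤ 1
  mem_iff : ∀ v, v ∉ Y → (v ∈ X ↔ 0 < occ L v)
  heads : L.map List.head? = E.map some

/-- Adjacency switches sides of `Y`, and no vertex of `Y` has four neighbors. -/
structure IsSubcubic (G : SimpleGraph V) (Y : Finset V) : Prop where
  side : ∀ u v, G.Adj u v → (u ∈ Y ↔ v ∉ Y)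
  four : ∀ y ∈ Y, ∀ a b c d, G.Adj y a → G.Adj y b → G.Adj y c → G.Adj y d →
    a = b ∨ a = c ∨ a = d ∨ b = c ∨ b = d ∨ c = d

/-- `y` has at most one neighbor in `X`. -/
def AtMostOne (G : SimpleGraph V) (X : Finset V) (y : V) : Prop :=
  ∀ a ∈ X, ∀ b ∈ X, G.Adj y a → G.Adj y b → a = b

/-- `y` has at most two neighbors in `X`. -/
def AtMostTwo (G : SimpleGraph V) (X : Finset V) (y : V) : Prop :=
  ∀ a ∈ X, ∀ b ∈ X, ∀ c ∈ X, G.Adj y a → G.Adj y b → G.Adj y c → a = b ∨ a = c ∨ b = c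

/-- Some cover of `X` starts from `E` with one element removed. -/
def Reducible (G : SimpleGraph V) (Y X : Finset V) (E : Multiset V) : Prop :=
  ∃ e E' L', E = e ::ₘ E' ∧ IsCov G Y X E' L'

section Basic

variable {G : SimpleGraph V} {Y X X' : Finset V} {E E' : Multiset V} {L L' : Multiset (List V)}

@[simp] lemma occ_zero (v : V) : occ 0 v = 0 := by simp [occ]

@[simp] lemma occ_cons (p : List V) (L : Multiset (List V)) (v : V) :
    occ (p ::ₘ L) v = p.count v + occ L v := by simp [occ]

lemma occ_pos_iff {v : V} : 0 < occ L v ↔ ∃ p ∈ L, v ∈ p := by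
  induction L using Multiset.induction_on with
  | empty => simp
  | cons p L ih =>
    have := List.count_pos_iff (a := v) (l := p)
    simp only [occ_cons, Multiset.mem_cons, exists_eq_or_imp, ← ih, ← this]
    omega

lemma IsCov.nodup (h : IsCov G Y X E L) {p : List V} (hp : p ∈ L) : p.Nodup := by
  obtain ⟨L, rfl⟩ := Multiset.exists_cons_of_mem hp
  rw [List.nodup_iff_count_le_one]
  intro v
  have := h.le_one v
  rw [occ_cons] at this
  omega

lemma IsCov.eq_of_mem (h : IsCov G Y X E L) {p q : List V} (hp : p ∈ L) (hq : q ∈ L) {v : V}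
    (hvp : v ∈ p) (hvq : v ∈ q) : p = q := by
  obtain ⟨L, rfl⟩ := Multiset.exists_cons_of_mem hp
  rcases Multiset.mem_cons.1 hq with rfl | hq
  · rfl
  have h1 := h.le_one v
  have h2 : 0 < occ L v := occ_pos_iff.2 ⟨q, hq, hvq⟩
  have h3 := List.count_pos_iff.2 hvp
  rw [occ_cons] at h1
  omega

lemma IsCov.split_unique (h : IsCov G Y X E L) {l r l' r' : List V} {v : V}
    (hp : l ++ v :: r ∈ L) (hq : l' ++ v :: r' ∈ L) : l = l' ∧ r = r' := by
  have he := h.eq_of_mem (v := v) hp hq (by simp) (by simp)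
  have hn := h.nodup hp
  have hn' := h.nodup hq
  rw [List.append_cons_inj_of_notMem] at he
  · exact ⟨he.1, he.2.2⟩
  · simp [List.nodup_append] at hn
    grind
  · simp [List.nodup_append] at hn'
    grind

lemma IsCov.exists_head (h : IsCov G Y X E L) {p : List V} (hp : p ∈ L) :
    ∃ s p' L₀ E₀, p = s :: p' ∧ L = p ::ₘ L₀ ∧ E = s ::ₘ E₀ ∧
      L₀.map List.head? = E₀.map some := by
  obtain ⟨L, rfl⟩ := Multiset.exists_cons_of_mem hp
  have hh := h.heads
  rw [Multiset.map_cons] at hh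
  have : p.head? ∈ E.map some := hh ▸ Multiset.mem_cons_self _ _
  obtain ⟨s, hs, hsp⟩ := Multiset.mem_map.1 this
  obtain ⟨E₀, rfl⟩ := Multiset.exists_cons_of_mem hs
  cases p with
  | nil => simp at hsp
  | cons a p =>
    simp only [List.head?_cons, Option.some.injEq] at hsp
    subst hsp
    refine ⟨s, p, L, E₀, rfl, rfl, rfl, ?_⟩
    simpa using hh

lemma IsCov.exists_of_start (h : IsCov G Y X E L) {s : V} (hs : s ∈ E) :
    ∃ p, s :: p ∈ L := by
  have : some s ∈ L.map List.head? := h.heads ▸ Multiset.mem_map_of_mem _ hs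
  obtain ⟨p, hp, hps⟩ := Multiset.mem_map.1 this
  cases p with
  | nil => simp at hps
  | cons a p =>
    simp only [List.head?_cons, Option.some.injEq] at hps
    exact ⟨p, hps ▸ hp⟩

lemma IsCov.start_mem (h : IsCov G Y X E L) {s : V} {p : List V} (hp : s :: p ∈ L) : s ∈ E := by
  obtain ⟨s', p', L₀, E₀, he, -, rfl, -⟩ := h.exists_head hp
  simp_all

lemma IsCov.start_nil (h : IsCov G Y X E L) {s : V} {l r : List V} (hs : s ∈ E)
    (hp : l ++ s :: r ∈ L) : l = [] := by
  obtain ⟨p, hp'⟩ := h.exists_of_start hs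
  exact (h.split_unique (l' := []) hp hp').1

lemma IsCov.mem_of (h : IsCov G Y X E L) {p : List V} (hp : p ∈ L) {v : V} (hv : v ∈ p)
    (hY : v ∉ Y) : v ∈ X := (h.mem_iff v hY).2 (occ_pos_iff.2 ⟨p, hp, hv⟩)

/-- A used vertex of `Y` that is not a start has distinct neighbors before and after it. -/
lemma IsCov.exists_split (h : IsCov G Y X E L) (hG : IsSubcubic G Y) {y : V} (hy : y ∈ Y)
    (hE : y ∉ E) (ho : occ L y ≠ 0) :
    ∃ l a c r, l ++ a :: y :: c :: r ∈ L ∧ a ∈ X ∧ c ∈ X ∧ G.Adj y a ∧ G.Adj y c ∧ a ≠ c := by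
  obtain ⟨p, hp, hyp⟩ := occ_pos_iff.1 (Nat.pos_of_ne_zero ho)
  obtain ⟨l, r, rfl⟩ := List.append_of_mem hyp
  obtain ⟨hc, hl⟩ := h.trail _ hp
  rcases List.eq_nil_or_concat l with rfl | ⟨l, a, rfl⟩
  · exact absurd (h.start_mem hp) hE
  cases r with
  | nil =>
    have := congrArg List.length (hl y (by simp) hy)
    simp at this
  | cons c r =>
    have hn := h.nodup hp
    have e : (l ++ [a]) ++ y :: c :: r = l ++ a :: y :: c :: r := by simp
    simp only [List.concat_eq_append, e] at *
    have h1 : G.Adj a y := by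
      rw [List.isChain_append_cons_cons] at hc
      exact hc.2.1
    have h2 : G.Adj y c := by
      rw [List.isChain_append_cons_cons] at hc
      simpa using hc.2.2.rel
    refine ⟨l, a, c, r, hp, h.mem_of hp (by simp) ?_, h.mem_of hp (by simp) ?_, h1.symm, h2, ?_⟩
    · have := hG.side _ _ h1; tauto
    · have := hG.side _ _ h2; tauto
    · simp [List.nodup_append] at hn
      grind

lemma IsCov.occ_eq_zero (h : IsCov G Y X E L) (hG : IsSubcubic G Y) {y : V} (hy : y ∈ Y)
    (hE : y ∉ E) (ho : AtMostOne G X y) : occ L y = 0 := by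
  by_contra hne
  obtain ⟨l, a, c, r, -, ha, hc, h1, h2, hac⟩ := h.exists_split hG hy hE hne
  exact hac (ho a ha c hc h1 h2)

/-- Add a path disjoint from all others. -/
lemma IsCov.add (h : IsCov G Y X' E L) {A : List V} {s : V} (hA : IsTrail G Y A)
    (hn : A.Nodup) (hs : A.head? = some s) (ho : ∀ v ∈ A, occ L v = 0)
    (hX : ∀ v, v ∉ Y → (v ∈ X ↔ v ∈ X' ∨ v ∈ A)) : IsCov G Y X (s ::ₘ E) (A ::ₘ L) := by
  refine ⟨?_, ?_, ?_, ?_⟩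
  · simp only [Multiset.mem_cons, forall_eq_or_imp]
    exact ⟨hA, h.trail⟩
  · intro v
    have h1 := h.le_one v
    have h2 := List.nodup_iff_count_le_one.1 hn v
    by_cases hv : v ∈ A
    · have := ho v hv
      rw [occ_cons]
      omega
    · rw [occ_cons, List.count_eq_zero_of_not_mem hv]
      omega
  · intro v hv
    rw [hX v hv, h.mem_iff v hv, ← List.count_pos_iff, occ_cons]
    omega
  · simp [hs, h.heads]

lemma IsTrail.append {A B : List V} {u : V} (hA : IsTrail G Y A) (hB : IsTrail G Y (u :: B))
    (hu : u :: B ≠ [u] ∨ u ∉ Y)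
    (hc : ∀ x ∈ A.getLast?, G.Adj x u) : IsTrail G Y (A ++ u :: B) := by
  refine ⟨List.isChain_append.2 ⟨hA.1, hB.1, by simpa using hc⟩, ?_⟩
  intro y hy hyY
  rw [List.getLast?_append_of_ne_nil _ (by simp)] at hy
  have := hB.2 y hy hyY
  simp only [List.cons.injEq] at this
  obtain ⟨rfl, rfl⟩ := this
  simp_all

lemma IsCov.drop_trivial {y : V} (h : IsCov G Y X (y ::ₘ E) ([y] ::ₘ L)) (hy : y ∈ Y) :
    IsCov G Y X E L := by
  refine ⟨fun q hq => h.trail q (Multiset.mem_cons_of_mem hq), fun v => ?_, fun v hv => ?_,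
    by simpa using h.heads⟩
  · have := h.le_one v
    rw [occ_cons] at this
    omega
  · rw [h.mem_iff v hv, occ_cons, List.count_eq_zero_of_not_mem]
    · simp
    · rintro h
      simp at h
      exact hv (h ▸ hy)

/-- Prepend a prefix to the path starting at `u`. -/
lemma IsCov.glue (h : IsCov G Y X' (u ::ₘ E) L) {A : List V} {s : V} (hA : IsTrail G Y A)
    (hn : A.Nodup) (hs : A.head? = some s) (ho : ∀ v ∈ A, occ L v = 0)
    (hc : ∀ x ∈ A.getLast?, G.Adj x u)
    (hX : ∀ v, v ∉ Y → (v ∈ X ↔ v ∈ X' ∨ v ∈ A)) :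
    ∃ B L', IsCov G Y X (s ::ₘ E) ((A ++ B) ::ₘ L') ∧
      (∀ w, occ ((A ++ B) ::ₘ L') w ≤ A.count w + occ L w) := by
  obtain ⟨p, hp⟩ := h.exists_of_start (Multiset.mem_cons_self u E)
  obtain ⟨u', p', L₀, E₀, he, rfl, hE, hh⟩ := h.exists_head hp
  obtain ⟨rfl, rfl⟩ := List.cons.inj he
  obtain rfl := (Multiset.cons_inj_right _).1 hE
  by_cases hu : u :: p ≠ [u] ∨ u ∉ Y
  · refine ⟨u :: p, L₀, ⟨?_, ?_, ?_, ?_⟩, ?_⟩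
    · simp only [Multiset.mem_cons, forall_eq_or_imp]
      exact ⟨hA.append (h.trail _ hp) hu hc,
        fun q hq => h.trail q (Multiset.mem_cons_of_mem hq)⟩
    · intro v
      have h1 := h.le_one v
      have h2 := List.nodup_iff_count_le_one.1 hn v
      have h3 := ho v
      rw [← List.count_pos_iff] at h3
      simp only [occ_cons, List.count_append] at *
      omega
    · intro v hv
      rw [hX v hv, h.mem_iff v hv, ← List.count_pos_iff]
      simp only [occ_cons, List.count_append] at *
      omega
    · have : A ≠ [] := by rintro rfl; simp at hs
      simp [hh, hs]
    · intro w
      simp only [occ_cons, List.count_append]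
      omega
  · push Not at hu
    obtain ⟨hu, huY⟩ := hu
    obtain rfl : p = [] := by simpa using hu
    have hcov := h.drop_trivial huY
    refine ⟨[], L₀, ?_, ?_⟩
    · rw [List.append_nil]
      refine hcov.add hA hn hs (fun v hv => ?_) hX
      have := ho v hv
      rw [occ_cons] at this
      omega
    · intro w
      simp only [occ_cons, List.append_nil]
      omega

end Basic

/-- Induction hypothesis for `IsCov.reducible`, with measure `2 |X| + |E ∩ Y|`. -/
def SmallerReducible (G : SimpleGraph V) (Y X : Finset V) (E : Multiset V) : Prop :=
  ∀ X₁ ⊆ X, ∀ E₁ L₁, E₁.card = E.card →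
    2 * X₁.card + (E₁.filter (· ∈ Y)).card < 2 * X.card + (E.filter (· ∈ Y)).card →
    IsCov G Y X₁ E₁ L₁ → (∀ y ∈ E₁, y ∈ Y → AtMostTwo G X₁ y) → Reducible G Y X₁ E₁

section Detach

variable {G : SimpleGraph V} {Y X X' : Finset V} {E E' : Multiset V} {L L' L₀ : Multiset (List V)}

lemma IsCov.start_pos (h : IsCov G Y X E L) {s : V} (hs : s ∈ E) : 0 < occ L s := by
  obtain ⟨p, hp⟩ := h.exists_of_start hs
  exact occ_pos_iff.2 ⟨_, hp, by simp⟩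

/-- Deleting a prefix of a path, the rest starting at `u`. -/
lemma IsCov.delete_prefix {A B : List V} {s u : V} {E₀ : Multiset V}
    (h : IsCov G Y X (s ::ₘ E₀) ((A ++ u :: B) ::ₘ L₀)) (hs : A.head? = some s) :
    IsCov G Y (X \ A.toFinset) (u ::ₘ E₀) ((u :: B) ::ₘ L₀) := by
  have hA : A ≠ [] := by rintro rfl; simp at hs
  obtain ⟨hc, hl⟩ := h.trail _ (Multiset.mem_cons_self _ _)
  refine ⟨?_, ?_, ?_, ?_⟩
  · simp only [Multiset.mem_cons, forall_eq_or_imp]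
    refine ⟨⟨(List.isChain_append.1 hc).2.1, fun y hy hyY => ?_⟩,
      fun q hq => h.trail q (Multiset.mem_cons_of_mem hq)⟩
    have := hl y (by rwa [List.getLast?_append_of_ne_nil _ (by simp)]) hyY
    have h2 := congrArg List.length this
    have h3 := List.length_pos_iff.2 hA
    simp only [List.length_append, List.length_cons, List.length_nil] at h2
    omega
  · intro v
    have := h.le_one v
    simp only [occ_cons, List.count_append] at *
    omega
  · intro v hv
    have h1 := h.le_one v
    have h2 := h.mem_iff v hv
    have h3 := List.count_pos_iff (a := v) (l := A)
    simp only [occ_cons, List.count_append, mem_sdiff, List.mem_toFinset] at *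
    rw [h2, ← h3]
    omega
  · have := h.heads
    simp only [Multiset.map_cons, List.head?_append, hs, List.head?_cons] at *
    simpa using this

lemma IsCov.still_unused (h : IsCov G Y X E L) (hG : IsSubcubic G Y) {e : V}
    (he : E = e ::ₘ E') (h' : IsCov G Y X E' L') {v : V} (ho : occ L v = 0)
    (hv : v ∈ Y → AtMostOne G X v) : occ L' v = 0 := by
  by_cases hY : v ∈ Y
  · refine h'.occ_eq_zero hG hY (fun hE' => ?_) (hv hY)
    have := h.start_pos (s := v) (he ▸ Multiset.mem_cons_of_mem hE')
    omega
  · have h1 := h.mem_iff v hY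
    have h2 := h'.mem_iff v hY
    rw [h1] at h2
    omega

lemma IsCov.adj_last (h : IsCov G Y X E L) {A B : List V} {u : V} (hp : A ++ u :: B ∈ L) :
    ∀ x ∈ A.getLast?, G.Adj x u := by
  have := (List.isChain_append.1 (h.trail _ hp).1).2.2
  simpa using this

lemma IsCov.atMostOne_of_prefix (h : IsCov G Y X E L) (hG : IsSubcubic G Y)
    (hE : ∀ y ∈ E, y ∈ Y → AtMostTwo G X y) {A B : List V} (hp : A ++ B ∈ L)
    (hA : IsTrail G Y A) (hA1 : ∀ y, A = [y] → y ∈ Y → AtMostOne G X y)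
    (hX : ∀ x ∈ X', x ∈ X ∧ x ∉ A) {v : V} (hv : v ∈ A) (hvY : v ∈ Y) :
    AtMostOne G X' v := by
  obtain ⟨l, r, rfl⟩ := List.append_of_mem hv
  have hn : (l ++ v :: r).Nodup := (List.nodup_append.1 (h.nodup hp)).1
  cases r with
  | nil =>
    have h1 := hA.2 v (by simp) hvY
    have h2 := hA1 v h1 hvY
    exact fun a ha b hb => h2 a (hX a ha).1 b (hX b hb).1
  | cons c r =>
    have hvc : G.Adj v c := by
      have h1 := hA.1
      rw [List.isChain_append] at h1
      exact h1.2.1.rel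
    have hcX : c ∈ X := by
      refine h.mem_of hp (by simp) ?_
      have := hG.side _ _ hvc
      tauto
    rcases List.eq_nil_or_concat l with rfl | ⟨l, a, rfl⟩
    · intro x hx z hz hxv hzv
      have h3 := hE v (h.start_mem hp) hvY x (hX x hx).1 z (hX z hz).1 c hcX hxv hzv hvc
      have := hX x hx
      have := hX z hz
      grind
    · have hav : G.Adj v a := by
        have h1 := hA.1
        rw [List.concat_eq_append, List.append_assoc, List.singleton_append,
          List.isChain_append_cons_cons] at h1
        exact h1.2.1.symm
      have hac : a ≠ c := by
        simp [List.nodup_append] at hn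
        grind
      intro x hx z hz hxv hzv
      have h3 := hG.four v hvY x z a c hxv hzv hav hvc
      have := hX x hx
      have := hX z hz
      grind

lemma atMostTwo_of_adj (hG : IsSubcubic G Y) {x u : V} (hu : u ∈ Y) (hx : G.Adj x u)
    (hX : x ∉ X) : AtMostTwo G X u := by
  intro a ha b hb c hc h1 h2 h3
  have := hG.four u hu x a b c hx.symm h1 h2 h3
  grind

lemma AtMostTwo.mono {y : V} (h : AtMostTwo G X y) (hX : X' ⊆ X) : AtMostTwo G X' y :=
  fun a ha b hb c hc => h a (hX ha) b (hX hb) c (hX hc)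

lemma exists_last {A : List V} (h : A ≠ []) : ∃ a, a ∈ A.getLast? ∧ a ∈ A :=
  ⟨A.getLast h, List.getLast?_eq_getLast_of_ne_nil h, List.getLast_mem h⟩

lemma exists_first {A : List V} (h : A ≠ []) : ∃ a, A.head? = some a := by
  cases A with
  | nil => simp at h
  | cons a A => exact ⟨a, rfl⟩

/-- Effect of deleting a prefix on the measure of the induction. -/
lemma IsCov.measure_delete {A B : List V} {s u : V} {E₀ : Multiset V}
    (h : IsCov G Y X (s ::ₘ E₀) ((A ++ u :: B) ::ₘ L₀)) (hG : IsSubcubic G Y)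
    (hs : A.head? = some s) (hA : IsTrail G Y A) :
    2 * (X \ A.toFinset).card + ((u ::ₘ E₀).filter (· ∈ Y)).card <
      2 * X.card + ((s ::ₘ E₀).filter (· ∈ Y)).card := by
  have hA0 : A ≠ [] := by rintro rfl; simp at hs
  obtain ⟨a, ha, haA⟩ := exists_last hA0
  by_cases haY : a ∈ Y
  · have h1 := hA.2 a ha haY
    have hau := h.adj_last (Multiset.mem_cons_self _ _) a ha
    have := (hG.side _ _ hau).1 haY
    obtain rfl : a = s := by simpa [h1] using hs
    have := Finset.card_le_card (Finset.sdiff_subset (s := X) (t := A.toFinset))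
    simp only [Multiset.filter_cons, Multiset.card_add]
    simp [*] at *
    omega
  · have haX : a ∈ X := h.mem_of (Multiset.mem_cons_self _ _) (by simp [haA]) haY
    have : (X \ A.toFinset).card < X.card := by
      apply Finset.card_lt_card
      refine ⟨Finset.sdiff_subset, fun hX => ?_⟩
      have := hX haX
      simp [haA] at this
    simp only [Multiset.filter_cons, Multiset.card_add]
    split_ifs <;> simp <;> omega

lemma IsCov.roots_delete {A B : List V} {s u : V} {E₀ : Multiset V}
    (h : IsCov G Y X (s ::ₘ E₀) ((A ++ u :: B) ::ₘ L₀)) (hG : IsSubcubic G Y)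
    (hs : A.head? = some s)
    (hE : ∀ y ∈ s ::ₘ E₀, y ∈ Y → AtMostTwo G X y) :
    ∀ y ∈ u ::ₘ E₀, y ∈ Y → AtMostTwo G (X \ A.toFinset) y := by
  have hA0 : A ≠ [] := by rintro rfl; simp at hs
  obtain ⟨a, ha, haA⟩ := exists_last hA0
  intro y hy hyY
  rcases Multiset.mem_cons.1 hy with rfl | hy
  · exact atMostTwo_of_adj hG hyY (h.adj_last (Multiset.mem_cons_self _ _) a ha) (by simp [haA])
  · exact (hE y (Multiset.mem_cons_of_mem hy) hyY).mono Finset.sdiff_subset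

/-- Either `E` is reducible or the prefix `A` can be made a path of its own. -/
lemma IsCov.detach (h : IsCov G Y X E L) (hG : IsSubcubic G Y)
    (hE : ∀ y ∈ E, y ∈ Y → AtMostTwo G X y) (ih : SmallerReducible G Y X E)
    {A B : List V} {u : V} (hp : A ++ u :: B ∈ L) (hA0 : A ≠ []) (hA : IsTrail G Y A)
    (hA1 : ∀ y, A = [y] → y ∈ Y → AtMostOne G X y) (hr : ¬ Reducible G Y X E) :
    ∃ L', IsCov G Y X E (A ::ₘ L') ∧
      ∀ w ∈ Y, occ L w = 0 → AtMostOne G (X \ A.toFinset) w → occ (A ::ₘ L') w = 0 := by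
  obtain ⟨s, hs⟩ := exists_first hA0
  obtain ⟨s', p', L₀, E₀, he, rfl, rfl, hh⟩ := h.exists_head hp
  obtain rfl : s = s' := by
    have := congrArg List.head? he
    simpa [hs] using this
  have hD := h.delete_prefix hs
  obtain ⟨e, E', L', heE, hL'⟩ := ih _ Finset.sdiff_subset _ _ (by simp)
    (h.measure_delete hG hs hA) hD (h.roots_delete hG hs hE)
  have hAn : A.Nodup := (List.nodup_append.1 (h.nodup hp)).1
  have hun : ∀ v, occ ((u :: B) ::ₘ L₀) v = 0 → (v ∈ Y → AtMostOne G (X \ A.toFinset) v) →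
      occ L' v = 0 := fun v => hD.still_unused hG heE hL'
  have hAo : ∀ v ∈ A, occ L' v = 0 := by
    intro v hv
    apply hun
    · have h1 := h.le_one v
      have h2 := List.count_pos_iff.2 hv
      simp only [occ_cons, List.count_append] at *
      omega
    · exact fun hvY => h.atMostOne_of_prefix hG hE hp hA hA1 (by simp) hv hvY
  have hX : ∀ v, v ∉ Y → (v ∈ X ↔ v ∈ X \ A.toFinset ∨ v ∈ A) := by
    intro v hv
    have : v ∈ A → v ∈ X := fun hvA => h.mem_of hp (by simp [hvA]) hv
    simp only [mem_sdiff, List.mem_toFinset]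
    tauto
  by_cases hue : e = u
  · subst hue
    obtain rfl := (Multiset.cons_inj_right _).1 heE
    refine ⟨L', hL'.add hA hAn hs hAo hX, fun w hw ho hw1 => ?_⟩
    have : occ L' w = 0 := by
      apply hun w _ fun _ => hw1
      simp only [occ_cons, List.count_append] at *
      omega
    simp only [occ_cons, List.count_append] at *
    omega
  · exfalso
    have hu : u ∈ E' := by
      have : u ∈ e ::ₘ E' := heE ▸ Multiset.mem_cons_self _ _
      simpa [Ne.symm hue] using this
    obtain ⟨E'', rfl⟩ := Multiset.exists_cons_of_mem hu
    obtain ⟨B', L'', hL'', -⟩ := hL'.glue hA hAn hs hAo (h.adj_last hp) hX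
    refine hr ⟨e, _, _, ?_, hL''⟩
    rw [Multiset.cons_swap] at heE
    rw [(Multiset.cons_inj_right _).1 heE, Multiset.cons_swap]

/-- Either `E` is reducible or one of the prefixes `A₁`, `A₂` can be made a path of its own. -/
lemma IsCov.detach_two (h : IsCov G Y X E L) (hG : IsSubcubic G Y)
    (hE : ∀ y ∈ E, y ∈ Y → AtMostTwo G X y) (ih : SmallerReducible G Y X E)
    {A₁ B₁ A₂ B₂ : List V} {u₁ u₂ : V}
    (hL : L = (A₁ ++ u₁ :: B₁) ::ₘ (A₂ ++ u₂ :: B₂) ::ₘ L₀)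
    (hA₁ : IsTrail G Y A₁) (hA₂ : IsTrail G Y A₂) (h01 : A₁ ≠ []) (h02 : A₂ ≠ [])
    (hA11 : ∀ y, A₁ = [y] → y ∈ Y → AtMostOne G X y)
    (hA21 : ∀ y, A₂ = [y] → y ∈ Y → AtMostOne G X y)
    (hr : ¬ Reducible G Y X E) :
    ∃ B L', (IsCov G Y X E (A₁ ::ₘ (A₂ ++ B) ::ₘ L') ∧
      ∀ w ∈ Y, occ L w = 0 → AtMostOne G ((X \ A₁.toFinset) \ A₂.toFinset) w →
        occ (A₁ ::ₘ (A₂ ++ B) ::ₘ L') w = 0) ∨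
      (IsCov G Y X E (A₂ ::ₘ (A₁ ++ B) ::ₘ L') ∧
      ∀ w ∈ Y, occ L w = 0 → AtMostOne G ((X \ A₁.toFinset) \ A₂.toFinset) w →
        occ (A₂ ::ₘ (A₁ ++ B) ::ₘ L') w = 0) := by
  subst hL
  obtain ⟨s₁, hs₁⟩ := exists_first h01
  obtain ⟨s₂, hs₂⟩ := exists_first h02
  have hp₁ : A₁ ++ u₁ :: B₁ ∈ (A₁ ++ u₁ :: B₁) ::ₘ (A₂ ++ u₂ :: B₂) ::ₘ L₀ := by simp
  have hp₂ : A₂ ++ u₂ :: B₂ ∈ (A₁ ++ u₁ :: B₁) ::ₘ (A₂ ++ u₂ :: B₂) ::ₘ L₀ := by simp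
  obtain ⟨s', p', L₁, E₀, he, hL₁, rfl, hh⟩ := h.exists_head hp₁
  obtain rfl := (Multiset.cons_inj_right _).1 hL₁
  obtain rfl : s₁ = s' := by
    have := congrArg List.head? he
    simpa [hs₁] using this
  have hD := h.delete_prefix hs₁
  rw [Multiset.map_cons] at hh
  have hs₂E : s₂ ∈ E₀ := by
    have : some s₂ ∈ E₀.map some := by
      rw [← hh]
      simp [hs₂]
    simpa using this
  obtain ⟨E₁, rfl⟩ := Multiset.exists_cons_of_mem hs₂E
  rw [Multiset.cons_swap u₁ s₂, Multiset.cons_swap (u₁ :: B₁)] at hD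
  have hD₂ := hD.delete_prefix hs₂
  have hm₁ := h.measure_delete hG hs₁ hA₁
  rw [Multiset.cons_swap u₁ s₂] at hm₁
  have hroot := h.roots_delete hG hs₁ hE
  rw [Multiset.cons_swap u₁ s₂] at hroot
  obtain ⟨e, E', L', heE, hL'⟩ := ih _ (Finset.sdiff_subset.trans Finset.sdiff_subset) _ _ (by simp)
    ((hD.measure_delete hG hs₂ hA₂).trans hm₁) hD₂ (hD.roots_delete hG hs₂ hroot)
  have hAn₁ : A₁.Nodup := (List.nodup_append.1 (h.nodup hp₁)).1
  have hAn₂ : A₂.Nodup := (List.nodup_append.1 (h.nodup hp₂)).1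
  set X₂ := (X \ A₁.toFinset) \ A₂.toFinset with hX₂
  have hun : ∀ v, occ ((u₂ :: B₂) ::ₘ (u₁ :: B₁) ::ₘ L₀) v = 0 → (v ∈ Y → AtMostOne G X₂ v) →
      occ L' v = 0 := fun v => hD₂.still_unused hG heE hL'
  have hAo₁ : ∀ v ∈ A₁, occ L' v = 0 := by
    intro v hv
    apply hun
    · have h1 := h.le_one v
      have h2 := List.count_pos_iff.2 hv
      simp only [occ_cons, List.count_append] at *
      omega
    · exact fun hvY => h.atMostOne_of_prefix hG hE hp₁ hA₁ hA11 (by simp +contextual [hX₂]) hv hvY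
  have hAo₂ : ∀ v ∈ A₂, occ L' v = 0 := by
    intro v hv
    apply hun
    · have h1 := h.le_one v
      have h2 := List.count_pos_iff.2 hv
      simp only [occ_cons, List.count_append] at *
      omega
    · exact fun hvY => h.atMostOne_of_prefix hG hE hp₂ hA₂ hA21 (by simp +contextual [hX₂]) hv hvY
  have hdisj : ∀ v, v ∈ A₁ → v ∉ A₂ := by
    intro v hv hv2
    have h1 := h.le_one v
    have h2 := List.count_pos_iff.2 hv
    have h3 := List.count_pos_iff.2 hv2
    simp only [occ_cons, List.count_append] at *
    omega
  have hm1 : ∀ v, v ∉ Y → v ∈ A₁ → v ∈ X := fun v hv hvA => h.mem_of hp₁ (by simp [hvA]) hv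
  have hm2 : ∀ v, v ∉ Y → v ∈ A₂ → v ∈ X := fun v hv hvA => h.mem_of hp₂ (by simp [hvA]) hv
  have hX21 : ∀ v, v ∉ Y → (v ∈ X \ A₂.toFinset ↔ v ∈ X₂ ∨ v ∈ A₁) := by
    intro v hv
    have := hm1 v hv
    have := hdisj v
    simp only [hX₂, mem_sdiff, List.mem_toFinset]
    tauto
  have hX22 : ∀ v, v ∉ Y → (v ∈ X \ A₁.toFinset ↔ v ∈ X₂ ∨ v ∈ A₂) := by
    intro v hv
    have := hm2 v hv
    have := hdisj v
    simp only [hX₂, mem_sdiff, List.mem_toFinset]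
    tauto
  have hX1 : ∀ v, v ∉ Y → (v ∈ X ↔ v ∈ X \ A₁.toFinset ∨ v ∈ A₁) := by
    intro v hv
    have := hm1 v hv
    simp only [mem_sdiff, List.mem_toFinset]
    tauto
  have hX2 : ∀ v, v ∉ Y → (v ∈ X ↔ v ∈ X \ A₂.toFinset ∨ v ∈ A₂) := by
    intro v hv
    have := hm2 v hv
    simp only [mem_sdiff, List.mem_toFinset]
    tauto
  have hw : ∀ w ∈ Y, occ ((A₁ ++ u₁ :: B₁) ::ₘ (A₂ ++ u₂ :: B₂) ::ₘ L₀) w = 0 →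
      AtMostOne G X₂ w → A₁.count w + (A₂.count w + occ L' w) = 0 := by
    intro w _ ho hw1
    have : occ L' w = 0 := by
      apply hun w _ fun _ => hw1
      simp only [occ_cons, List.count_append] at *
      omega
    simp only [occ_cons, List.count_append] at *
    omega
  by_cases hue : e = u₂
  · subst hue
    obtain rfl := (Multiset.cons_inj_right _).1 heE
    obtain ⟨B', L'', hL'', ho''⟩ := hL'.glue hA₁ hAn₁ hs₁ hAo₁ (h.adj_last hp₁) hX21
    refine ⟨B', L'', Or.inr ⟨?_, ?_⟩⟩
    · rw [Multiset.cons_swap]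
      refine hL''.add hA₂ hAn₂ hs₂ (fun v hv => ?_) hX2
      have h1 := ho'' v
      have h2 := hAo₂ v hv
      have h3 : A₁.count v = 0 := List.count_eq_zero_of_not_mem fun h => hdisj v h hv
      omega
    · intro w hwY hwo hw1
      have h1 := hw w hwY hwo hw1
      have h2 := ho'' w
      rw [occ_cons]
      omega
  by_cases hue' : e = u₁
  · subst hue'
    rw [Multiset.cons_swap] at heE
    obtain rfl := (Multiset.cons_inj_right _).1 heE
    obtain ⟨B', L'', hL'', ho''⟩ := hL'.glue hA₂ hAn₂ hs₂ hAo₂ (h.adj_last hp₂) hX22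
    refine ⟨B', L'', Or.inl ⟨?_, ?_⟩⟩
    · refine hL''.add hA₁ hAn₁ hs₁ (fun v hv => ?_) hX1
      have h1 := ho'' v
      have h2 := hAo₁ v hv
      have h3 : A₂.count v = 0 := List.count_eq_zero_of_not_mem fun h => hdisj v hv h
      omega
    · intro w hwY hwo hw1
      have h1 := hw w hwY hwo hw1
      have h2 := ho'' w
      rw [occ_cons]
      omega
  · exfalso
    have heE₁ : e ∈ E₁ := by
      have : e ∈ u₂ ::ₘ u₁ ::ₘ E₁ := heE ▸ Multiset.mem_cons_self _ _
      simpa [hue, hue'] using this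
    obtain ⟨E₂, rfl⟩ := Multiset.exists_cons_of_mem heE₁
    rw [Multiset.cons_swap u₁ e, Multiset.cons_swap u₂ e] at heE
    obtain rfl := (Multiset.cons_inj_right _).1 heE
    obtain ⟨B', L'', hL'', ho''⟩ := hL'.glue hA₂ hAn₂ hs₂ hAo₂ (h.adj_last hp₂) hX22
    rw [Multiset.cons_swap] at hL''
    obtain ⟨B'', L''', hL''', -⟩ := hL''.glue hA₁ hAn₁ hs₁ (fun v hv => by
      have h1 := ho'' v
      have h2 := hAo₁ v hv
      have h3 : A₂.count v = 0 := List.count_eq_zero_of_not_mem fun h => hdisj v hv h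
      omega) (h.adj_last hp₁) hX1
    refine hr ⟨e, _, _, ?_, hL'''⟩
    rw [Multiset.cons_swap s₂ e, Multiset.cons_swap s₁ e]

end Detach

section Roots

variable {G : SimpleGraph V} {Y X : Finset V} {E : Multiset V} {L L₀ : Multiset (List V)}

lemma IsCov.reducible_of_trivial (h : IsCov G Y X E L) {y : V} (hy : y ∈ Y) (hp : [y] ∈ L) :
    Reducible G Y X E := by
  obtain ⟨s, p', L₀, E₀, he, rfl, rfl, -⟩ := h.exists_head hp
  obtain rfl : y = s := by simpa using congrArg List.head? he
  exact ⟨_, _, _, rfl, h.drop_trivial hy⟩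

lemma IsTrail.left {A B : List V} (h : IsTrail G Y (A ++ B)) (hA : ∀ a ∈ A.getLast?, a ∉ Y) :
    IsTrail G Y A :=
  ⟨(List.isChain_append.1 h.1).1, fun y hy hyY => absurd hyY (hA y hy)⟩

/-- Join a path to a path starting in `Y`. -/
lemma IsCov.reducible_of_join {A r : List V} {y : V}
    (h : IsCov G Y X E (A ::ₘ (y :: r) ::ₘ L₀)) (hy : y ∈ Y)
    (hA : ∀ z ∈ A.getLast?, G.Adj z y) : Reducible G Y X E := by
  by_cases hr : r = []
  · exact h.reducible_of_trivial hy (by simp [hr])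
  obtain ⟨s, p', L₁, E₀, rfl, hL, rfl, hh⟩ := h.exists_head (Multiset.mem_cons_self _ _)
  obtain rfl := (Multiset.cons_inj_right _).1 hL
  have hyE : y ∈ E₀ := by
    have : some y ∈ E₀.map some := by rw [← hh]; simp
    simpa using this
  obtain ⟨E₁, rfl⟩ := Multiset.exists_cons_of_mem hyE
  refine ⟨y, s ::ₘ E₁, ((s :: p') ++ y :: r) ::ₘ L₀, Multiset.cons_swap _ _ _, ?_, ?_, ?_, ?_⟩
  · simp only [Multiset.mem_cons, forall_eq_or_imp]
    exact ⟨(h.trail _ (by simp)).append (h.trail _ (by simp)) (by simp [hr]) hA,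
      fun q hq => h.trail q (by simp [hq])⟩
  · intro v
    have := h.le_one v
    simp only [occ_cons, List.count_append] at *
    omega
  · intro v hv
    rw [h.mem_iff v hv]
    simp only [occ_cons, List.count_append]
    omega
  · simpa using hh

lemma IsCov.false_of_root_other (h : IsCov G Y X E L) (hG : IsSubcubic G Y)
    (hE : ∀ y ∈ E, y ∈ Y → AtMostTwo G X y) (ih : SmallerReducible G Y X E)
    (hr : ¬ Reducible G Y X E) {y z : V} {q : List V} (hyE : y ∈ E) (hy : y ∈ Y)
    (hq : q ∈ L) (hzq : z ∈ q) (hyq : y ∉ q) (hyz : G.Adj y z) : False := by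
  obtain ⟨l, t, rfl⟩ := List.append_of_mem hzq
  have hz : z ∉ Y := (hG.side _ _ hyz).1 hy
  have key : ∀ L, IsCov G Y X E L → l ++ [z] ∈ L → False := by
    intro L hL hmem
    obtain ⟨r, hyr⟩ := hL.exists_of_start hyE
    obtain ⟨L, rfl⟩ := Multiset.exists_cons_of_mem hmem
    have hyL : y :: r ∈ L := by
      rcases Multiset.mem_cons.1 hyr with he | he
      · have h1 : y ∈ l ++ [z] := he ▸ List.mem_cons_self
        simp at hyq h1
        tauto
      · exact he
    obtain ⟨L, rfl⟩ := Multiset.exists_cons_of_mem hyL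
    exact hr (hL.reducible_of_join hy (by simpa using hyz.symm))
  cases t with
  | nil => exact key L h hq
  | cons u B =>
    have e : l ++ z :: u :: B = (l ++ [z]) ++ u :: B := by simp
    rw [e] at hq
    obtain ⟨L', hL', -⟩ := h.detach hG hE ih hq (by simp)
      ((h.trail _ hq).left (by simpa using hz)) (fun y' h' hy' => by
        have := congrArg List.getLast? h'
        simp only [List.getLast?_append, List.getLast?_singleton, Option.some_or,
          Option.some.injEq] at this
        exact absurd (this ▸ hy') hz) hr
    exact key _ hL' (Multiset.mem_cons_self _ _)

lemma IsCov.start_notMem (h : IsCov G Y X E L) (hG : IsSubcubic G Y)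
    (hE : ∀ y ∈ E, y ∈ Y → AtMostTwo G X y) (ih : SmallerReducible G Y X E)
    (hr : ¬ Reducible G Y X E) {y : V} (hyE : y ∈ E) : y ∉ Y := by
  intro hy
  obtain ⟨r, hp⟩ := h.exists_of_start hyE
  cases r with
  | nil => exact hr (h.reducible_of_trivial hy hp)
  | cons x r =>
    have hyx : G.Adj y x := (h.trail _ hp).1.rel
    have hx : x ∉ Y := (hG.side _ _ hyx).1 hy
    by_cases hone : AtMostOne G X y
    · have hp' : [y] ++ x :: r ∈ L := hp
      obtain ⟨L', hL', -⟩ := h.detach hG hE ih hp' (by simp) ⟨by simp, by simp⟩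
        (fun y' h' _ => by simp at h'; exact h' ▸ hone) hr
      exact hr (hL'.reducible_of_trivial hy (Multiset.mem_cons_self _ _))
    · obtain ⟨z, hz, hyz, hzx⟩ : ∃ z ∈ X, G.Adj y z ∧ z ≠ x := by
        by_contra! hcon
        exact hone fun a ha b hb h1 h2 => (hcon a ha h1).trans (hcon b hb h2).symm
      have hzY : z ∉ Y := (hG.side _ _ hyz).1 hy
      obtain ⟨q, hq, hzq⟩ := occ_pos_iff.1 ((h.mem_iff z hzY).1 hz)
      by_cases hyq : y ∈ q
      · obtain rfl := h.eq_of_mem hq hp hyq (by simp)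
        have hzr : z ∈ r := by
          have := hyz.ne'
          simpa [this, hzx] using hzq
        obtain ⟨l, t, rfl⟩ := List.append_of_mem hzr
        have hn := h.nodup hq
        rcases List.eq_nil_or_concat l with rfl | ⟨l, u, rfl⟩
        · have h1 := (h.trail _ hq).1
          simp only [List.nil_append, List.isChain_cons_cons] at h1
          have := hG.side _ _ h1.2.1
          tauto
        · have e : y :: x :: (l.concat u ++ z :: t) = (y :: x :: l) ++ u :: (z :: t) := by simp
          rw [e] at hq hn
          have huz : G.Adj u z := (List.isChain_append.1 (h.trail _ hq).1).2.1.rel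
          have hu : u ∈ Y := (hG.side _ _ huz).2 hzY
          have hlast : ∀ a ∈ (y :: x :: l).getLast?, a ∉ Y := fun a ha haY =>
            (hG.side _ _ (h.adj_last hq a ha)).1 haY hu
          obtain ⟨L', hL', -⟩ := h.detach hG hE ih hq (by simp)
            ((h.trail _ hq).left hlast) (by simp) hr
          obtain ⟨q', hq', hzq'⟩ := occ_pos_iff.1 ((hL'.mem_iff z hzY).1 hz)
          refine hL'.false_of_root_other hG hE ih hr hyE hy hq' hzq' (fun hyq' => ?_) hyz
          obtain rfl := hL'.eq_of_mem hq' (Multiset.mem_cons_self _ _) hyq' (by simp)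
          simp [List.nodup_append] at hn
          simp at hzq'
          grind
      · exact h.false_of_root_other hG hE ih hr hyE hy hq hzq hyq hyz

end Roots

/-- Vertices of `X` reached from `E` in at most `t` rounds, where a round adds every neighbor of a
vertex of `Y` having two neighbors already reached. -/
def Reached (G : SimpleGraph V) (Y X : Finset V) (E : Multiset V) : ℕ → V → Prop
  | 0, v => v ∈ E
  | t + 1, v => Reached G Y X E t v ∨ v ∈ X ∧ ∃ y ∈ Y, ∃ a b, a ≠ b ∧
      Reached G Y X E t a ∧ Reached G Y X E t b ∧ G.Adj y v ∧ G.Adj y a ∧ G.Adj y b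

/-- Some vertex of `Y` avoided by `L` has two neighbors reached within `t` rounds. -/
def Conflict (G : SimpleGraph V) (Y X : Finset V) (E : Multiset V) (L : Multiset (List V))
    (t : ℕ) : Prop :=
  ∃ w ∈ Y, occ L w = 0 ∧ ∃ a b, a ≠ b ∧ Reached G Y X E t a ∧ Reached G Y X E t b ∧
    G.Adj w a ∧ G.Adj w b


section Pure

variable {G : SimpleGraph V} {Y X : Finset V} {E : Multiset V} {L L₀ : Multiset (List V)}

lemma Reached.mono {s t : ℕ} (hst : s ≤ t) {v : V} (h : Reached G Y X E s v) :
    Reached G Y X E t v := by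
  induction hst with
  | refl => exact h
  | step _ ih => exact Or.inl ih

lemma IsCov.start_mem_X (h : IsCov G Y X E L) (hpure : ∀ e ∈ E, e ∉ Y) {e : V} (he : e ∈ E) :
    e ∈ X := (h.mem_iff e (hpure e he)).2 (h.start_pos he)

lemma IsCov.reached_mem (h : IsCov G Y X E L) (hpure : ∀ e ∈ E, e ∉ Y) {t : ℕ} {v : V}
    (hv : Reached G Y X E t v) : v ∈ X := by
  induction t with
  | zero => exact h.start_mem_X hpure hv
  | succ t ih =>
    rcases hv with hv | hv
    · exact ih hv
    · exact hv.1

lemma IsCov.starts_nodup (h : IsCov G Y X E L) : E.Nodup := by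
  rw [Multiset.nodup_iff_ne_cons_cons]
  rintro e E₁ rfl
  obtain ⟨p, hp⟩ := h.exists_of_start (Multiset.mem_cons_self e _)
  obtain ⟨s, p', L₀, E₀, he, rfl, hE, hh⟩ := h.exists_head hp
  obtain ⟨rfl, rfl⟩ := List.cons.inj he
  obtain rfl := (Multiset.cons_inj_right _).1 hE
  have h1 : some e ∈ L₀.map List.head? := by rw [hh]; simp
  obtain ⟨q, hq, hqe⟩ := Multiset.mem_map.1 h1
  have h2 : 0 < occ L₀ e := occ_pos_iff.2 ⟨q, hq, List.mem_of_mem_head? hqe⟩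
  have h3 := h.le_one e
  have h4 : 0 < (e :: p).count e := List.count_pos_iff.2 (by simp)
  rw [occ_cons] at h3
  omega

lemma IsCov.exists_conflict (h : IsCov G Y X E L) (hG : IsSubcubic G Y)
    (hpure : ∀ e ∈ E, e ∉ Y) (hdef : ∀ S ⊆ X, lamDefSet G Y S < E.card) :
    ∃ t, Conflict G Y X E L t := by
  by_contra! hno
  set R := X.filter fun v => ∃ t, Reached G Y X E t v with hR
  have key : ∀ y ∈ lamSet G Y R, ∃ c ∈ R \ E.toFinset, ∃ l r, l ++ y :: c :: r ∈ L := by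
    intro y hy
    obtain ⟨hyY, hy⟩ := Finset.mem_filter.1 hy
    obtain ⟨a, ha, b, hb, hab⟩ := Finset.one_lt_card.1 hy
    simp only [Finset.mem_filter, hR] at ha hb
    obtain ⟨⟨-, s, hs⟩, hya⟩ := ha
    obtain ⟨⟨-, t, ht⟩, hyb⟩ := hb
    have hs' := hs.mono (le_max_left s t)
    have ht' := ht.mono (le_max_right s t)
    have ho : occ L y ≠ 0 := fun ho => hno _ ⟨y, hyY, ho, a, b, hab, hs', ht', hya, hyb⟩
    obtain ⟨l, a', c, r, hp, -, hc, -, hyc, -⟩ :=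
      h.exists_split hG hyY (fun hyE => hpure y hyE hyY) ho
    have e : l ++ a' :: y :: c :: r = (l ++ [a', y]) ++ c :: r := by simp
    refine ⟨c, ?_, l ++ [a'], r, by simpa using hp⟩
    simp only [mem_sdiff, hR, Finset.mem_filter, Multiset.mem_toFinset]
    refine ⟨⟨hc, max s t + 1, Or.inr ⟨hc, y, hyY, a, b, hab, hs', ht', hyc, hya, hyb⟩⟩,
      fun hcE => ?_⟩
    have := h.start_nil hcE (e ▸ hp)
    simp at this
  choose! f hf hf' using key
  have hinj : Set.InjOn f (lamSet G Y R) := by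
    intro y hy z hz hyz
    obtain ⟨l, r, hp⟩ := hf' y hy
    obtain ⟨l', r', hq⟩ := hf' z hz
    rw [hyz] at hp
    have hp' : (l ++ [y]) ++ f z :: r ∈ L := by simpa using hp
    have hq' : (l' ++ [z]) ++ f z :: r' ∈ L := by simpa using hq
    have := (h.split_unique hp' hq').1
    simpa using congrArg List.getLast? this
  have h1 := Finset.card_le_card_of_injOn f hf hinj
  have h2 : E.toFinset ⊆ R := by
    intro e he
    rw [Multiset.mem_toFinset] at he
    simp only [hR, Finset.mem_filter]
    exact ⟨h.start_mem_X hpure he, 0, he⟩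
  have h3 := Finset.card_sdiff_add_card_eq_card h2
  have h4 : E.toFinset.card = E.card := Multiset.toFinset_card_of_nodup h.starts_nodup
  have h5 := hdef R (Finset.filter_subset _ _)
  unfold lamDefSet at h5
  omega

/-- Without earlier conflicts, a reached vertex that is not a start was reached through its
predecessor on its path. -/
lemma IsCov.reached_pred (h : IsCov G Y X E L) (hG : IsSubcubic G Y) (hpure : ∀ e ∈ E, e ∉ Y)
    {T : ℕ} (hno : ∀ s < T, ¬ Conflict G Y X E L s) {t : ℕ} (ht : t ≤ T) {x : V}
    (hx : Reached G Y X E t x) {l r : List V} (hp : l ++ x :: r ∈ L) (hl : l ≠ []) :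
    ∃ l' q y b s, l = l' ++ [q, y] ∧ y ∈ Y ∧ s < t ∧ Reached G Y X E s q ∧ Reached G Y X E s b ∧
      b ≠ q ∧ b ≠ x ∧ G.Adj y q ∧ G.Adj y b ∧ G.Adj y x := by
  induction t generalizing x l r with
  | zero => exact absurd (h.start_nil hx hp) hl
  | succ t ih =>
    by_cases hxt : Reached G Y X E t x
    · obtain ⟨l', q, y, b, s, h1, h2, h3, h4⟩ := ih (by omega) hxt hp hl
      exact ⟨l', q, y, b, s, h1, h2, by omega, h4⟩
    obtain ⟨hxX, y, hyY, a, b, hab, ha, hb, hyx, hya, hyb⟩ := hx.resolve_left hxt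
    have hne : ∀ v s, s ≤ t → Reached G Y X E s v → x ≠ v := by
      rintro v s hs hv rfl
      exact hxt (hv.mono hs)
    have hxa := hne a t le_rfl ha
    have hxb := hne b t le_rfl hb
    have ho : occ L y ≠ 0 := fun ho =>
      hno t (by omega) ⟨y, hyY, ho, a, b, hab, ha, hb, hya, hyb⟩
    obtain ⟨l₁, a', c, r₁, hp₁, ha'X, hcX, hya', hyc, hac⟩ :=
      h.exists_split hG hyY (fun hyE => hpure y hyE hyY) ho
    have e : l₁ ++ a' :: y :: c :: r₁ = (l₁ ++ [a', y]) ++ c :: r₁ := by simp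
    rw [e] at hp₁
    obtain rfl : c = x := by
      by_contra hcx
      have hct : Reached G Y X E t c := by
        have := hG.four y hyY x a b c hyx hya hyb hyc
        grind
      obtain ⟨l', q, y', b', s, h1, -, hs, hq, hb', hbq, hbc, -, hyb', -⟩ :=
        ih (by omega) hct hp₁ (by simp)
      have h2 := congrArg List.reverse h1
      simp only [List.reverse_append, List.reverse_cons, List.reverse_nil, List.nil_append,
        List.cons_append, List.cons.injEq] at h2
      obtain ⟨rfl, rfl, -⟩ := h2
      have h3 := hG.four y hyY x a' b' c hyx hya' hyb' hyc
      have h4 := hne _ s hs.le hq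
      have h5 := hne _ s hs.le hb'
      grind
    have h1 := (h.split_unique hp hp₁).1
    have h2 := hG.four y hyY c a b a' hyx hya hyb hya'
    have h3 : a' = a ∨ a' = b := by grind
    rcases h3 with rfl | rfl
    · exact ⟨l₁, a', y, b, t, h1, hyY, by omega, ha, hb, hab.symm, hxb.symm, hya, hyb, hyx⟩
    · exact ⟨l₁, a', y, a, t, h1, hyY, by omega, hb, ha, hab, hxa.symm, hyb, hya, hyx⟩

end Pure

section Final

variable {G : SimpleGraph V} {Y X : Finset V} {E : Multiset V} {L L₀ : Multiset (List V)}

/-- The vertex two steps after a given vertex preceding `β` on its path is reached with `β`. -/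
lemma IsCov.exists_reached_succ (h : IsCov G Y X E L) (hG : IsSubcubic G Y)
    (hpure : ∀ e ∈ E, e ∉ Y) {T : ℕ} (hno : ∀ s < T, ¬ Conflict G Y X E L s) {α : V} (hα : α ∉ Y)
    {l : List V} (n : ℕ) {m r : List V} (hm : m.length ≤ n) {β : V} (hβ : Reached G Y X E T β)
    (hp : l ++ α :: (m ++ β :: r) ∈ L) :
    ∃ y x n', m ++ [β] = y :: x :: n' ∧ Reached G Y X E T x := by
  induction n using Nat.strong_induction_on generalizing m r β with
  | _ n ih =>
    have hp' : (l ++ α :: m) ++ β :: r ∈ L := by simpa using hp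
    obtain ⟨l', q, y, b, s, he, hy, hs, hq, -⟩ :=
      h.reached_pred hG hpure hno le_rfl hβ hp' (by simp)
    rcases List.eq_nil_or_concat m with rfl | ⟨m, y', rfl⟩
    · have := congrArg List.getLast? he
      simp only [List.getLast?_append, List.getLast?_singleton, List.getLast?_cons_cons,
        Option.some_or, Option.some.injEq] at this
      exact absurd (this ▸ hy) hα
    have h1 := congrArg List.reverse he
    simp only [List.concat_eq_append, List.reverse_append, List.reverse_cons, List.reverse_nil,
      List.nil_append, List.cons_append, List.cons.injEq] at h1
    obtain ⟨rfl, h1⟩ := h1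
    rcases List.eq_nil_or_concat m with rfl | ⟨m, q', rfl⟩
    · exact ⟨y', β, [], by simp, hβ⟩
    simp only [List.concat_eq_append, List.reverse_append, List.reverse_cons, List.reverse_nil,
      List.nil_append, List.cons_append, List.cons.injEq] at h1
    obtain ⟨rfl, -⟩ := h1
    simp only [List.concat_eq_append, List.length_append, List.length_cons, List.length_nil] at hm
    obtain ⟨y, x, n', h2, h3⟩ := ih m.length (by omega) le_rfl (hq.mono hs.le)
      (r := y' :: β :: r) (by simpa using hp)
    refine ⟨y, x, n' ++ [y', β], ?_, h3⟩
    simp only [List.concat_eq_append, h2, List.cons_append, List.append_assoc, List.nil_append]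

lemma count_singleton_of_notMem {w v : V} (hw : w ∈ Y) (hv : v ∉ Y) : [w].count v = 0 :=
  List.count_eq_zero_of_not_mem fun h => hv (List.mem_singleton.1 h ▸ hw)

lemma isTrail_of_last {p : List V} (hc : p.IsChain G.Adj) (h : ∀ a ∈ p.getLast?, a ∉ Y) :
    IsTrail G Y p := ⟨hc, fun a ha haY => absurd haY (h a ha)⟩

lemma IsTrail.last_notMem {l r : List V} {α : V} (h : IsTrail G Y (l ++ α :: r)) (hα : α ∉ Y) :
    ∀ a ∈ (α :: r).getLast?, a ∉ Y := by
  intro a ha haY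
  have h1 := h.2 a (by rwa [List.getLast?_append_of_ne_nil _ (by simp)]) haY
  have h2 : α ∈ [a] := h1 ▸ by simp
  rw [List.mem_singleton] at h2
  exact hα (h2 ▸ haY)

/-- Reroute a path ending in `β` through `w`, reversing the part after `α`. -/
lemma IsCov.reroute {l n' : List V} {α β y x w : V}
    (h : IsCov G Y X E ((l ++ α :: y :: x :: n') ::ₘ L₀)) (hy : y ∈ Y) (hw : w ∈ Y) (hx : x ∉ Y)
    (hβ : β ∈ (x :: n').getLast?) (hwα : G.Adj w α) (hwβ : G.Adj w β)
    (ho : occ ((l ++ α :: y :: x :: n') ::ₘ L₀) w = 0) :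
    ∃ L', IsCov G Y X E L' ∧ occ L' y = 0 := by
  have hp : l ++ α :: y :: x :: n' ∈ (l ++ α :: y :: x :: n') ::ₘ L₀ := by simp
  have hcnt : ∀ v, occ ((l ++ α :: w :: (x :: n').reverse) ::ₘ L₀) v + [y].count v =
      occ ((l ++ α :: y :: x :: n') ::ₘ L₀) v + [w].count v := by
    intro v
    have e1 : l ++ α :: w :: (x :: n').reverse = (l ++ [α]) ++ ([w] ++ (x :: n').reverse) := by simp
    have e2 : l ++ α :: y :: x :: n' = (l ++ [α]) ++ ([y] ++ (x :: n')) := by simp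
    rw [e1, e2]
    simp only [occ_cons, List.count_append, List.count_reverse]
    omega
  have hyo : 0 < occ ((l ++ α :: y :: x :: n') ::ₘ L₀) y := occ_pos_iff.2 ⟨_, hp, by simp⟩
  have hyw : y ≠ w := by
    rintro rfl
    omega
  have hc := (h.trail _ hp).1
  refine ⟨(l ++ α :: w :: (x :: n').reverse) ::ₘ L₀, ⟨?_, ?_, ?_, ?_⟩, ?_⟩
  · simp only [Multiset.mem_cons, forall_eq_or_imp]
    refine ⟨isTrail_of_last ?_ ?_, fun q hq => h.trail q (by simp [hq])⟩
    · rw [List.isChain_append_cons_cons] at hc ⊢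
      refine ⟨hc.1, hwα.symm, List.isChain_cons.2 ⟨?_, ?_⟩⟩
      · intro b hb
        rw [List.head?_reverse] at hb
        obtain rfl := Option.mem_unique hb hβ
        exact hwβ
      · rw [List.isChain_reverse]
        exact hc.2.2.of_cons.imp fun _ _ h => h.symm
    · intro a ha
      have e : l ++ α :: w :: (x :: n').reverse = (l ++ α :: w :: n'.reverse) ++ [x] := by simp
      rw [e, List.getLast?_append_of_ne_nil _ (by simp)] at ha
      simp at ha
      exact ha ▸ hx
  · intro v
    have h1 := hcnt v
    have h2 := h.le_one v
    by_cases hvw : v = w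
    · subst hvw
      simp only [List.count_singleton_self] at h1
      omega
    · rw [List.count_eq_zero_of_not_mem (l := [w]) (by simpa using hvw)] at h1
      omega
  · intro v hv
    have h1 := hcnt v
    rw [count_singleton_of_notMem hw hv,
      count_singleton_of_notMem hy hv] at h1
    rw [h.mem_iff v hv]
    omega
  · have := h.heads
    cases l <;> simpa using this
  · have h1 := hcnt y
    have h2 := h.le_one y
    rw [List.count_eq_zero_of_not_mem (l := [w]) (by simpa using hyw)] at h1
    simp only [List.count_singleton_self] at h1
    omega

lemma IsCov.join_trail {A l r : List V} {α w : V}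
    (h : IsCov G Y X E (A ::ₘ (l ++ α :: r) ::ₘ L₀)) (hα : α ∉ Y)
    (hA : ∀ z ∈ A.getLast?, G.Adj w z) (hwα : G.Adj w α) : IsTrail G Y (A ++ w :: α :: r) := by
  have h1 := h.trail A (by simp)
  have h2 := h.trail (l ++ α :: r) (by simp)
  refine h1.append (isTrail_of_last ?_ ?_) (by simp) fun z hz => (hA z hz).symm
  · exact List.isChain_cons_cons.2 ⟨hwα, (List.isChain_append.1 h2.1).2.1⟩
  · rw [List.getLast?_cons_cons]
    exact h2.last_notMem hα

/-- Join a path to a path starting at `α` through an unused vertex. -/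
lemma IsCov.reducible_of_start {A r : List V} {α w : V}
    (h : IsCov G Y X E (A ::ₘ (α :: r) ::ₘ L₀)) (hα : α ∉ Y) (hw : w ∈ Y)
    (hA : ∀ z ∈ A.getLast?, G.Adj w z) (hwα : G.Adj w α)
    (ho : occ (A ::ₘ (α :: r) ::ₘ L₀) w = 0) : Reducible G Y X E := by
  obtain ⟨s, p', L₁, E₀, rfl, hL, rfl, hh⟩ := h.exists_head (Multiset.mem_cons_self _ _)
  obtain rfl := (Multiset.cons_inj_right _).1 hL
  have hαE : α ∈ E₀ := by
    have : some α ∈ E₀.map some := by rw [← hh]; simp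
    simpa using this
  obtain ⟨E₁, rfl⟩ := Multiset.exists_cons_of_mem hαE
  have hcnt : ∀ v, occ (((s :: p') ++ w :: α :: r) ::ₘ L₀) v =
      occ ((s :: p') ::ₘ (α :: r) ::ₘ L₀) v + [w].count v := by
    intro v
    have e : (s :: p') ++ w :: α :: r = (s :: p') ++ ([w] ++ α :: r) := by simp
    rw [e]
    simp only [occ_cons, List.count_append]
    omega
  refine ⟨α, s ::ₘ E₁, ((s :: p') ++ w :: α :: r) ::ₘ L₀, Multiset.cons_swap _ _ _,
    ?_, ?_, ?_, ?_⟩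
  · simp only [Multiset.mem_cons, forall_eq_or_imp]
    exact ⟨h.join_trail (l := []) hα hA hwα, fun q hq => h.trail q (by simp [hq])⟩
  · intro v
    have h1 := hcnt v
    have h2 := h.le_one v
    by_cases hvw : v = w
    · subst hvw
      simp only [List.count_singleton_self] at h1
      omega
    · rw [List.count_eq_zero_of_not_mem (l := [w]) (by simpa using hvw)] at h1
      omega
  · intro v hv
    rw [h.mem_iff v hv, hcnt v,
      count_singleton_of_notMem hw hv]
    simp
  · simpa using hh

/-- Move the part of a path from `α` on to the end of another path, through an unused vertex. -/
lemma IsCov.transfer {A l r : List V} {α q y w : V}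
    (h : IsCov G Y X E (A ::ₘ ((l ++ [q, y]) ++ α :: r) ::ₘ L₀)) (hG : IsSubcubic G Y)
    (hα : α ∉ Y) (hw : w ∈ Y) (hy : y ∈ Y) (hA : ∀ z ∈ A.getLast?, G.Adj w z) (hA0 : A ≠ [])
    (hwα : G.Adj w α) (ho : occ (A ::ₘ ((l ++ [q, y]) ++ α :: r) ::ₘ L₀) w = 0) :
    ∃ L', IsCov G Y X E L' ∧ occ L' y = 0 := by
  have hcnt : ∀ v, occ ((A ++ w :: α :: r) ::ₘ (l ++ [q]) ::ₘ L₀) v + [y].count v =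
      occ (A ::ₘ ((l ++ [q, y]) ++ α :: r) ::ₘ L₀) v + [w].count v := by
    intro v
    have e1 : A ++ w :: α :: r = A ++ ([w] ++ α :: r) := by simp
    have e2 : (l ++ [q, y]) ++ α :: r = (l ++ [q]) ++ ([y] ++ α :: r) := by simp
    rw [e1, e2]
    simp only [occ_cons, List.count_append]
    omega
  have hp : (l ++ [q, y]) ++ α :: r ∈ A ::ₘ ((l ++ [q, y]) ++ α :: r) ::ₘ L₀ := by simp
  have hyo : 0 < occ (A ::ₘ ((l ++ [q, y]) ++ α :: r) ::ₘ L₀) y :=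
    occ_pos_iff.2 ⟨_, hp, by simp⟩
  have hyw : y ≠ w := by
    rintro rfl
    omega
  have hc := (h.trail _ hp).1
  have e : (l ++ [q, y]) ++ α :: r = l ++ q :: y :: α :: r := by simp
  have hqy : G.Adj q y := by
    rw [e, List.isChain_append_cons_cons] at hc
    exact hc.2.1
  refine ⟨(A ++ w :: α :: r) ::ₘ (l ++ [q]) ::ₘ L₀, ⟨?_, ?_, ?_, ?_⟩, ?_⟩
  · simp only [Multiset.mem_cons, forall_eq_or_imp]
    refine ⟨h.join_trail hα hA hwα, isTrail_of_last ?_ ?_, fun q hq => h.trail q (by simp [hq])⟩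
    · rw [e, List.isChain_append_cons_cons] at hc
      exact hc.1
    · have := hG.side _ _ hqy
      simp
      tauto
  · intro v
    have h1 := hcnt v
    have h2 := h.le_one v
    by_cases hvw : v = w
    · subst hvw
      simp only [List.count_singleton_self] at h1
      omega
    · rw [List.count_eq_zero_of_not_mem (l := [w]) (by simpa using hvw)] at h1
      omega
  · intro v hv
    have h1 := hcnt v
    rw [count_singleton_of_notMem hw hv,
      count_singleton_of_notMem hy hv] at h1
    rw [h.mem_iff v hv]
    omega
  · have := h.heads
    have h2 := exists_first hA0
    obtain ⟨a, ha⟩ := h2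
    cases l <;> simpa [ha] using this
  · have h1 := hcnt y
    have h2 := h.le_one y
    rw [List.count_eq_zero_of_not_mem (l := [w]) (by simpa using hyw)] at h1
    simp only [List.count_singleton_self] at h1
    omega

/-- No conflict of minimal level has its two reached vertices on one path. -/
lemma IsCov.false_of_same (h : IsCov G Y X E L) (hG : IsSubcubic G Y)
    (hpure : ∀ e ∈ E, e ∉ Y) (ih : SmallerReducible G Y X E) (hr : ¬ Reducible G Y X E) {T : ℕ}
    (hmin : ∀ s < T, ∀ L, IsCov G Y X E L → ¬ Conflict G Y X E L s) {l m r : List V} {α β w : V}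
    (hp : l ++ α :: (m ++ β :: r) ∈ L) (hw : w ∈ Y) (ho : occ L w = 0)
    (hβ : Reached G Y X E T β) (hwα : G.Adj w α) (hwβ : G.Adj w β) : False := by
  have hE : ∀ y ∈ E, y ∈ Y → AtMostTwo G X y := fun y hy hyY => absurd hyY (hpure y hy)
  have hα : α ∉ Y := (hG.side _ _ hwα).1 hw
  have hβY : β ∉ Y := (hG.side _ _ hwβ).1 hw
  obtain ⟨y, x, n', hm, hx⟩ := h.exists_reached_succ hG hpure (fun s hs => hmin s hs L h) hα
    m.length le_rfl hβ hp
  have e : l ++ α :: (m ++ β :: r) = (l ++ [α, y]) ++ x :: (n' ++ r) := by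
    have : m ++ β :: r = (m ++ [β]) ++ r := by simp
    rw [this, hm]
    simp
  have hlast : β ∈ (x :: n').getLast? := by
    have := congrArg List.getLast? hm
    rw [List.getLast?_append_of_ne_nil _ (by simp), List.getLast?_cons_cons] at this
    simpa using this.symm
  have e' : l ++ α :: (m ++ β :: r) = (l ++ α :: y :: x :: n') ++ r := by
    rw [e]
    simp
  obtain ⟨l', q, y', b, s, h1, hy', hs, hq, hb, hbq, -, hyq, hyb, hyx⟩ :=
    h.reached_pred hG hpure (fun s hs => hmin s hs L h) le_rfl hx (e ▸ hp) (by simp)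
  have h2 := congrArg List.reverse h1
  simp only [List.reverse_append, List.reverse_cons, List.reverse_nil, List.nil_append,
    List.cons_append, List.cons.injEq] at h2
  obtain ⟨rfl, rfl, -⟩ := h2
  have hxY : x ∉ Y := (hG.side _ _ hyx).1 hy'
  have key : ∀ L₀, IsCov G Y X E ((l ++ α :: y :: x :: n') ::ₘ L₀) →
      occ ((l ++ α :: y :: x :: n') ::ₘ L₀) w = 0 → False := by
    intro L₀ hL ho'
    obtain ⟨L', hL', hyo⟩ := hL.reroute hy' hw hxY hlast hwα hwβ ho'
    exact hmin s hs L' hL' ⟨y, hy', hyo, α, b, hbq.symm, hq, hb, hyq, hyb⟩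
  rw [e'] at hp
  cases r with
  | nil =>
    rw [List.append_nil] at hp
    obtain ⟨L₀, rfl⟩ := Multiset.exists_cons_of_mem hp
    exact key L₀ h ho
  | cons u B =>
    have hlast' : β ∈ (l ++ α :: y :: x :: n').getLast? := by
      rwa [List.getLast?_append_of_ne_nil _ (by simp), List.getLast?_cons_cons,
        List.getLast?_cons_cons]
    have hmem : β ∈ l ++ α :: y :: x :: n' := List.mem_of_mem_getLast? hlast'
    have hαβ : α ≠ β := by
      rintro rfl
      have hn := h.nodup hp
      have : α ∈ x :: n' := List.mem_of_mem_getLast? hlast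
      simp [List.nodup_append] at hn this
      grind
    obtain ⟨L', hL', ho'⟩ := h.detach hG hE ih hp (by simp) ((h.trail _ hp).left (by
      intro a ha
      obtain rfl := Option.mem_unique ha hlast'
      exact hβY)) (fun z hz _ => by
        have := congrArg List.length hz
        simp only [List.length_append, List.length_cons, List.length_nil] at this
        omega) hr
    refine key L' hL' (ho' w hw ho fun a ha b hb hwa hwb => ?_)
    have h4 := hG.four w hw a b α β hwa hwb hwα hwβ
    simp only [mem_sdiff, List.mem_toFinset] at ha hb
    have h5 : α ∈ l ++ α :: y :: x :: n' := by simp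
    grind

/-- No conflict of minimal level has its two reached vertices on different paths, one of which
ends there. -/
lemma IsCov.false_of_tailless (h : IsCov G Y X E L) (hG : IsSubcubic G Y)
    (hpure : ∀ e ∈ E, e ∉ Y) (hr : ¬ Reducible G Y X E) {T : ℕ}
    (hmin : ∀ s < T, ∀ L, IsCov G Y X E L → ¬ Conflict G Y X E L s)
    {l r A r' : List V} {α w : V}
    (hp : l ++ α :: r ∈ L) (hw : w ∈ Y) (hα : Reached G Y X E T α) (hwα : G.Adj w α)
    (hL : IsCov G Y X E (A ::ₘ (l ++ α :: r') ::ₘ L₀))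
    (ho : occ (A ::ₘ (l ++ α :: r') ::ₘ L₀) w = 0)
    (hA0 : A ≠ []) (hA : ∀ z ∈ A.getLast?, G.Adj w z) : False := by
  have hαY : α ∉ Y := (hG.side _ _ hwα).1 hw
  by_cases hl : l = []
  · subst hl
    exact hr (hL.reducible_of_start hαY hw hA hwα ho)
  · obtain ⟨l', q, y, b, s, rfl, hy, hs, hq, hb, hbq, -, hyq, hyb, -⟩ :=
      h.reached_pred hG hpure (fun s hs => hmin s hs L h) le_rfl hα hp hl
    obtain ⟨L', hL', hyo⟩ := hL.transfer hG hαY hw hy hA hA0 hwα ho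
    exact hmin s hs L' hL' ⟨y, hy, hyo, q, b, hbq.symm, hq, hb, hyq, hyb⟩

lemma IsCov.false_of_conflict (h : IsCov G Y X E L) (hG : IsSubcubic G Y)
    (hpure : ∀ e ∈ E, e ∉ Y) (ih : SmallerReducible G Y X E) (hr : ¬ Reducible G Y X E) {T : ℕ}
    (hmin : ∀ s < T, ∀ L, IsCov G Y X E L → ¬ Conflict G Y X E L s)
    (hT : Conflict G Y X E L T) : False := by
  obtain ⟨w, hw, ho, α, β, hαβ, hα, hβ, hwα, hwβ⟩ := hT
  have hE : ∀ y ∈ E, y ∈ Y → AtMostTwo G X y := fun y hy hyY => absurd hyY (hpure y hy)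
  have hαY : α ∉ Y := (hG.side _ _ hwα).1 hw
  have hβY : β ∉ Y := (hG.side _ _ hwβ).1 hw
  obtain ⟨p, hp, hαp⟩ := occ_pos_iff.1 ((h.mem_iff α hαY).1 (h.reached_mem hpure hα))
  obtain ⟨q, hq, hβq⟩ := occ_pos_iff.1 ((h.mem_iff β hβY).1 (h.reached_mem hpure hβ))
  obtain ⟨l₁, r₁, rfl⟩ := List.append_of_mem hαp
  by_cases hpq : q = l₁ ++ α :: r₁
  · subst hpq
    rcases List.mem_append.1 hβq with h1 | h1
    · obtain ⟨l, m, rfl⟩ := List.append_of_mem h1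
      exact h.false_of_same hG hpure ih hr hmin (l := l) (m := m) (r := r₁)
        (by simpa using hp) hw ho hα hwβ hwα
    · have h2 : β ∈ r₁ := by simpa [hαβ.symm] using h1
      obtain ⟨m, r, rfl⟩ := List.append_of_mem h2
      exact h.false_of_same hG hpure ih hr hmin hp hw ho hβ hwα hwβ
  obtain ⟨l₂, r₂, rfl⟩ := List.append_of_mem hβq
  obtain ⟨L₁, rfl⟩ := Multiset.exists_cons_of_mem hp
  have hq' : l₂ ++ β :: r₂ ∈ L₁ := by simpa [hpq] using hq
  obtain ⟨L₀, rfl⟩ := Multiset.exists_cons_of_mem hq'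
  have hA₁ : ∀ z ∈ (l₁ ++ [α]).getLast?, G.Adj w z := by simpa using hwα
  have hA₂ : ∀ z ∈ (l₂ ++ [β]).getLast?, G.Adj w z := by simpa using hwβ
  have e₁ : ∀ r, l₁ ++ α :: r = (l₁ ++ [α]) ++ r := by simp
  have e₂ : ∀ r, l₂ ++ β :: r = (l₂ ++ [β]) ++ r := by simp
  cases r₂ with
  | nil =>
    have hs := Multiset.cons_swap (l₁ ++ α :: r₁) (l₂ ++ [β]) L₀
    exact h.false_of_tailless hG hpure hr hmin hp hw hα hwα (hs ▸ h) (hs ▸ ho) (by simp) hA₂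
  | cons u₂ B₂ =>
  cases r₁ with
  | nil => exact h.false_of_tailless hG hpure hr hmin hq hw hβ hwβ h ho (by simp) hA₁
  | cons u₁ B₁ =>
    have hone : ∀ (l : List V) (v : V), v ∉ Y → ∀ y, l ++ [v] = [y] → y ∈ Y → AtMostOne G X y := by
      intro l v hv y hy hyY
      have := congrArg List.getLast? hy
      simp at this
      exact absurd (this ▸ hyY) hv
    have htr : ∀ (l r : List V) (v : V), v ∉ Y → IsTrail G Y (l ++ v :: r) →
        IsTrail G Y (l ++ [v]) := by
      intro l r v hv hlr
      have : l ++ v :: r = (l ++ [v]) ++ r := by simp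
      exact IsTrail.left (this ▸ hlr) (by simpa using hv)
    have hw1 : AtMostOne G ((X \ (l₁ ++ [α]).toFinset) \ (l₂ ++ [β]).toFinset) w := by
      intro a ha b hb hwa hwb
      have h4 := hG.four w hw a b α β hwa hwb hwα hwβ
      simp only [mem_sdiff, List.mem_toFinset, List.mem_append, List.mem_singleton] at ha hb
      grind
    obtain ⟨B, L', h1 | h1⟩ := h.detach_two hG hE ih (A₁ := l₁ ++ [α]) (A₂ := l₂ ++ [β])
      (by rw [e₁, e₂]) (htr _ _ _ hαY (h.trail _ hp)) (htr _ _ _ hβY (h.trail _ hq)) (by simp)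
      (by simp) (hone _ _ hαY) (hone _ _ hβY) hr
    · have ho' := h1.2 w hw ho hw1
      rw [← e₂] at h1 ho'
      exact h.false_of_tailless hG hpure hr hmin hq hw hβ hwβ h1.1 ho' (by simp) hA₁
    · have ho' := h1.2 w hw ho hw1
      rw [← e₁] at h1 ho'
      exact h.false_of_tailless hG hpure hr hmin hp hw hα hwα h1.1 ho' (by simp) hA₂

/-- If `E` is larger than every deficiency and each of its elements in `Y` has at most two
neighbors in `X`, then some cover starts from `E` with one element removed. -/
theorem IsCov.reducible (h : IsCov G Y X E L) (hG : IsSubcubic G Y)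
    (hE : ∀ y ∈ E, y ∈ Y → AtMostTwo G X y) (hdef : ∀ S ⊆ X, lamDefSet G Y S < E.card) :
    Reducible G Y X E := by
  induction hn : 2 * X.card + (E.filter (· ∈ Y)).card using Nat.strong_induction_on
    generalizing X E L with
  | _ n IH =>
  by_contra hr
  have ih : SmallerReducible G Y X E := by
    intro X₁ hX₁ E₁ L₁ hc hlt h₁ hE₁
    exact IH _ (hn ▸ hlt) h₁ hE₁ (fun S hS => hc ▸ hdef S (hS.trans hX₁)) rfl
  have hpure : ∀ e ∈ E, e ∉ Y := fun e he => h.start_notMem hG hE ih hr he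
  obtain ⟨t, ht⟩ := h.exists_conflict hG hpure hdef
  have hex : ∃ t L, IsCov G Y X E L ∧ Conflict G Y X E L t := ⟨t, L, h, ht⟩
  obtain ⟨L', hL', hT⟩ := Nat.find_spec hex
  exact hL'.false_of_conflict hG hpure ih hr
    (fun s hs L hL hcon => Nat.find_min hex hs ⟨L, hL, hcon⟩) hT

end Final

section Walks

variable {G : SimpleGraph V} {Y X : Finset V} {E : Multiset V} {L : Multiset (List V)}

/-- The cover of `X` by single vertices. -/
lemma isCov_singletons : IsCov G Y X X.val (X.val.map fun x => [x]) := by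
  have hocc : ∀ v, occ (X.val.map fun x => [x]) v = X.val.count v := by
    intro v
    generalize X.val = M
    induction M using Multiset.induction_on with
    | empty => simp
    | cons a M ih =>
      rw [Multiset.map_cons, occ_cons, ih, Multiset.count_cons, List.count_singleton, add_comm]
      by_cases hva : v = a
      · simp [hva]
      · simp [hva, Ne.symm hva]
  refine ⟨?_, fun v => ?_, fun v hv => ?_, by rw [Multiset.map_map]; rfl⟩
  · intro p hp
    obtain ⟨x, hx, rfl⟩ := Multiset.mem_map.1 hp
    exact ⟨by simp, by simp⟩
  · rw [hocc]
    exact Multiset.nodup_iff_count_le_one.1 X.nodup v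
  · rw [hocc, Multiset.count_pos, Finset.mem_val]

lemma exists_isCov_card_le (hG : IsSubcubic G Y) (hXY : Disjoint X Y) :
    ∃ E L, IsCov G Y X E L ∧ (E.card : ℤ) ≤ lamDef G X Y := by
  have key : ∀ n : ℕ, ∀ E L, E.card = n → (∀ e ∈ E, e ∉ Y) → IsCov G Y X E L →
      ∃ E L, IsCov G Y X E L ∧ (E.card : ℤ) ≤ lamDef G X Y := by
    intro n
    induction n with
    | zero =>
      intro E L hn _ h
      refine ⟨E, L, h, ?_⟩
      have := Finset.le_sup' (fun S => lamDefSet G Y S) (Finset.empty_mem_powerset X)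
      refine le_trans ?_ this
      simp [lamDefSet, lamSet, hn]
    | succ n ih =>
      intro E L hn hE h
      by_cases hle : (E.card : ℤ) ≤ lamDef G X Y
      · exact ⟨E, L, h, hle⟩
      obtain ⟨e, E', L', rfl, hL'⟩ := h.reducible hG (fun y hy hyY => absurd hyY (hE y hy))
        fun S hS => lt_of_le_of_lt
          (Finset.le_sup' (fun S => lamDefSet G Y S) (Finset.mem_powerset.2 hS)) (not_le.1 hle)
      exact ih E' L' (by simpa using hn) (fun e' he' => hE e' (Multiset.mem_cons_of_mem he')) hL'
  exact key _ X.val _ rfl (fun e he => Finset.disjoint_left.1 hXY he) isCov_singletons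

lemma exists_walk {p : List V} (hp : p ≠ []) (hc : p.IsChain G.Adj) :
    ∃ q : (Σ u : V, Σ v : V, G.Walk u v), q.2.2.support = p :=
  ⟨⟨_, _, Walk.ofSupport p hp hc⟩, Walk.support_ofSupport hp hc⟩

lemma pairwise_disjoint_of_occ {l : List (List V)} (h : ∀ v, occ (l : Multiset (List V)) v ≤ 1) :
    l.Pairwise fun p q => ∀ w ∈ p, w ∉ q := by
  induction l with
  | nil => simp
  | cons p l ih =>
    have hocc : ∀ v, p.count v + occ (l : Multiset (List V)) v ≤ 1 := by
      intro v
      have := h v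
      rwa [← Multiset.cons_coe, occ_cons] at this
    refine List.pairwise_cons.2 ⟨fun q hq w hw hwq => ?_, ih fun v => ?_⟩
    · have h1 := hocc w
      have h2 := List.count_pos_iff.2 hw
      have h3 : 0 < occ (l : Multiset (List V)) w := occ_pos_iff.2 ⟨q, by simpa using hq, hwq⟩
      omega
    · have := hocc v
      omega

lemma IsCov.exists_isPathXCover (h : IsCov G Y X E L) (hXY : Disjoint X Y) :
    ∃ P : List (Σ u : V, Σ v : V, G.Walk u v), IsPathXCover G X P ∧ P.length = E.card := by
  have hwalk : ∀ p ∈ L, ∃ q : (Σ u : V, Σ v : V, G.Walk u v), q.2.2.support = p := by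
    intro p hp
    obtain ⟨s, p', -, -, rfl, -⟩ := h.exists_head hp
    exact exists_walk (by simp) (h.trail _ hp).1
  have hlen : L.card = E.card := by simpa using congrArg Multiset.card h.heads
  obtain ⟨l, rfl⟩ := Quot.exists_rep L
  change ∀ p ∈ (l : Multiset (List V)), _ at hwalk
  obtain ⟨P, hP⟩ : ∃ P : List (Σ u : V, Σ v : V, G.Walk u v),
      P.map (fun q => q.2.2.support) = l := by
    have : l ∈ Set.range (List.map fun q : (Σ u : V, Σ v : V, G.Walk u v) => q.2.2.support) := by
      rw [Set.range_list_map]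
      exact fun p hp => hwalk p (by simpa using hp)
    exact this
  subst hP
  refine ⟨P, ⟨fun p hp => ?_, ?_, fun x hx => ?_⟩, ?_⟩
  · refine (Walk.isPath_def _).2 (h.nodup ?_)
    exact Multiset.mem_coe.2 (List.mem_map_of_mem hp)
  · have := pairwise_disjoint_of_occ h.le_one
    exact List.pairwise_map.1 this
  · obtain ⟨p, hp, hxp⟩ := occ_pos_iff.1 ((h.mem_iff x (Finset.disjoint_left.1 hXY hx)).1 hx)
    obtain ⟨q, hq, rfl⟩ := List.mem_map.1 (Multiset.mem_coe.1 hp)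
    exact ⟨q, hq, hxp⟩
  · simpa using hlen

lemma isSubcubic_of_isBigraph [Fintype V] [DecidableRel G.Adj] (hBG : IsBigraph G X Y)
    (hdeg : ∀ v : V, G.degree v ≤ 3) : IsSubcubic G Y := by
  obtain ⟨hXY, -, hadj⟩ := hBG
  refine ⟨fun u v huv => ?_, fun y _ a b c d ha hb hc hd => ?_⟩
  · have hu : u ∈ X → u ∉ Y := fun h => Finset.disjoint_left.1 hXY h
    have hv : v ∈ X → v ∉ Y := fun h => Finset.disjoint_left.1 hXY h
    rcases hadj huv with ⟨h1, h2⟩ | ⟨h1, h2⟩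
    · simp [hu h1, h2]
    · simp [h1, hv h2]
  · by_contra! hne
    have h1 : ({a, b, c, d} : Finset V) ⊆ G.neighborFinset y := by
      intro x hx
      rw [mem_neighborFinset]
      simp only [Finset.mem_insert, Finset.mem_singleton] at hx
      rcases hx with rfl | rfl | rfl | rfl <;> assumption
    have h2 := Finset.card_le_card h1
    rw [card_neighborFinset_eq_degree] at h2
    have h3 : ({a, b, c, d} : Finset V).card = 4 := by
      obtain ⟨h1, h2, h3, h4, h5, h6⟩ := hne
      simp [*]
    have := hdeg y
    omega

end Walks

/-- If `G` is an `(X,Y)`-bigraph with maximum degree at most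
`3`, then `G` has a path `X`-cover of size at most `def(G)`. -/
theorem maxDegree_three_path_cover {V : Type*} [Fintype V] (G : SimpleGraph V)
    [DecidableRel G.Adj] (X Y : Finset V) (hBG : IsBigraph G X Y)
    (hdeg : ∀ v : V, G.degree v ≤ 3) :
    ∃ P : List (Σ u : V, Σ v : V, G.Walk u v),
      IsPathXCover G X P ∧ (P.length : ℤ) ≤ lamDef G X Y := by
  obtain ⟨E, L, h, hcard⟩ := exists_isCov_card_le (isSubcubic_of_isBigraph hBG hdeg) hBG.1
  obtain ⟨P, hP, hlen⟩ := h.exists_isPathXCover hBG.1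
  exact ⟨P, hP, hlen ▸ hcard⟩
end
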